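/- arXiv:2107.10380 — 3 statements merged into one kernel-verified Lean document; each statement's English description precedes it below -/
import Mathlib

section
/- Let α and β be fixed nonzero integers such that gcd(α,β) is squarefree. For a squarefree positive integer m, let N_m(X;α,β) = #{(a,b) ∈ ℤ² : |a| ≤ X³, |b| ≤ X⁴, βa⁴ + αb³ ≠ 0, and m² ∣ βa⁴ + αb³}. Then for every ε > 0 there is a constant C_ε (depending on α, β, ε) such that for all real M > 0 and all X ≥ 2, the sum over all squarefree integers m > M of N_m(X;α,β) is at most C_ε·(X^{7+ε}/√M + X^{6.992+ε}). -/
open scoped BigOperators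

lemma omega_bound (K δ : ℝ) (hK : 1 ≤ K) (hδ : 0 < δ) :
    ∃ C : ℝ, 1 ≤ C ∧ ∀ n : ℕ, n ≠ 0 → K ^ n.primeFactors.card ≤ C * (n : ℝ) ^ δ := by
  obtain ⟨P, hP⟩ : ∃ P : ℕ, ∀ p : ℕ, P ≤ p → K ≤ (p : ℝ) ^ δ := by
    have := ((tendsto_rpow_atTop hδ).comp tendsto_natCast_atTop_atTop).eventually_ge_atTop K
    rw [Filter.eventually_atTop] at this
    exact this
  refine ⟨K ^ P, one_le_pow₀ hK, fun n hn => ?_⟩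
  have h1 : ∀ p ∈ n.primeFactors, K ≤ (if p < P then K else 1) * (p : ℝ) ^ δ := by
    intro p hp
    have hp1 : (1 : ℝ) ≤ (p : ℝ) ^ δ :=
      Real.one_le_rpow (by exact_mod_cast (Nat.prime_of_mem_primeFactors hp).one_le) hδ.le
    split_ifs with h
    · nlinarith
    · simpa using hP p (by omega)
  calc K ^ n.primeFactors.card = ∏ p ∈ n.primeFactors, K := by simp
    _ ≤ ∏ p ∈ n.primeFactors, ((if p < P then K else 1) * (p : ℝ) ^ δ) :=
        Finset.prod_le_prod (fun _ _ => by linarith) h1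
    _ = (∏ p ∈ n.primeFactors, (if p < P then K else 1)) * ∏ p ∈ n.primeFactors, (p : ℝ) ^ δ :=
        Finset.prod_mul_distrib
    _ ≤ K ^ P * (n : ℝ) ^ δ := by
        apply mul_le_mul
        · rw [← Finset.prod_filter, Finset.prod_const]
          apply pow_le_pow_right₀ hK
          calc _ ≤ (Finset.range P).card := by
                apply Finset.card_le_card
                intro p hp
                simp at hp
                simp [hp.2]
            _ = P := by simp
        · rw [Real.finsetProd_rpow _ _ (fun _ _ => by positivity)]
          apply Real.rpow_le_rpow (by positivity) _ hδ.le
          have := Nat.le_of_dvd (Nat.pos_of_ne_zero hn) (Nat.prod_primeFactors_dvd n)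
          calc ∏ i ∈ n.primeFactors, (i : ℝ) = ((∏ i ∈ n.primeFactors, i : ℕ) : ℝ) := by push_cast; rfl
            _ ≤ n := by exact_mod_cast this
        · positivity
        · positivity

lemma sqfree_card (T : Finset ℕ) (n : ℕ) (hn : n ≠ 0)
    (h : ∀ m ∈ T, Squarefree m ∧ m ∣ n) : T.card ≤ 2 ^ n.primeFactors.card := by
  rw [← Finset.card_powerset]
  apply Finset.card_le_card_of_injOn (fun m => m.primeFactors)
  · intro m hm
    simpa using Nat.primeFactors_mono (h m hm).2 hn
  · intro m hm k hk hmk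
    have h1 := Nat.prod_primeFactors_of_squarefree (h m hm).1
    have h2 := Nat.prod_primeFactors_of_squarefree (h k hk).1
    simp only at hmk
    rw [← h1, ← h2, hmk]

lemma cube_prime (p : ℕ) (hp : p.Prime) :
    Nat.card {x : ZMod (p ^ 2) // x ^ 3 = 1} ≤ 3 := by
  have : Fact p.Prime := ⟨hp⟩
  have : NeZero (p ^ 2) := ⟨by have := hp.pos; positivity⟩
  have : IsCyclic (ZMod (p ^ 2))ˣ := by
    by_cases h2 : p = 2
    · subst h2
      exact (ZMod.isCyclic_units_two_pow_iff 2).mpr (by norm_num)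
    · exact ZMod.isCyclic_units_of_prime_pow p hp h2 2
  classical
  have h := IsCyclic.card_pow_eq_one_le (α := (ZMod (p ^ 2))ˣ) (n := 3) (by norm_num)
  refine le_trans ?_ h
  rw [← Fintype.card_coe, ← Nat.card_eq_fintype_card]
  refine Nat.card_le_card_of_injective
    (fun x : {x : ZMod (p ^ 2) // x ^ 3 = 1} =>
      (⟨Units.mkOfMulEqOne x.1 (x.1 ^ 2) ((mul_comm _ _).trans ((pow_succ x.1 2).symm.trans x.2)), by
        simp only [Finset.mem_filter, Finset.mem_univ, true_and]
        ext
        simpa using x.2⟩ : {a // a ∈ Finset.univ.filter (fun a : (ZMod (p ^ 2))ˣ => a ^ 3 = 1)})) ?_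
  intro x y hxy
  simp only [Subtype.mk.injEq] at hxy
  have := congrArg Units.val hxy
  exact Subtype.ext (by simpa using this)

lemma cube_sqfree (n : ℕ) : Squarefree n →
    Nat.card {x : ZMod (n ^ 2) // x ^ 3 = 1} ≤ 3 ^ n.primeFactors.card := by
  induction n using Nat.strong_induction_on with
  | _ n ih =>
    intro hn
    by_cases h1 : n = 1
    · subst h1
      simp only [Nat.primeFactors_one, Finset.card_empty, pow_zero]
      have : Subsingleton (ZMod (1 ^ 2)) := by
        rw [one_pow]; infer_instance
      exact Finite.card_le_one_iff_subsingleton.mpr inferInstance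
    · obtain ⟨p, hp, k, rfl⟩ := Nat.exists_prime_and_dvd h1
      have hs := Nat.squarefree_mul_iff.mp hn
      have hk0 : 0 < k := Nat.pos_of_ne_zero hs.2.2.ne_zero
      have hk := ih k (by have := hp.two_le; nlinarith) hs.2.2
      have hco : (p ^ 2).Coprime (k ^ 2) := Nat.Coprime.pow 2 2 hs.1
      have : NeZero (p ^ 2) := ⟨by have := hp.pos; positivity⟩
      have : NeZero (k ^ 2) := ⟨by positivity⟩
      have e : ZMod ((p * k) ^ 2) ≃+* ZMod (p ^ 2) × ZMod (k ^ 2) :=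
        (ZMod.ringEquivCongr (by ring)).trans (ZMod.chineseRemainder hco)
      have : Nat.card {x : ZMod ((p * k) ^ 2) // x ^ 3 = 1} ≤
          Nat.card ({x : ZMod (p ^ 2) // x ^ 3 = 1} × {x : ZMod (k ^ 2) // x ^ 3 = 1}) := by
        refine Nat.card_le_card_of_injective (fun x =>
          (⟨(e x.1).1, by have := congrArg (fun y => (e y).1) x.2; simpa using this⟩,
           ⟨(e x.1).2, by have := congrArg (fun y => (e y).2) x.2; simpa using this⟩)) ?_
        intro x y hxy
        simp only [Prod.mk.injEq, Subtype.mk.injEq] at hxy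
        exact Subtype.ext (e.injective (Prod.ext hxy.1 hxy.2))
      rw [Nat.card_prod] at this
      rw [Nat.Coprime.primeFactors_mul hs.1, Finset.card_union_of_disjoint hs.1.disjoint_primeFactors,
        hp.primeFactors, Finset.card_singleton, pow_add]
      exact this.trans (Nat.mul_le_mul (by simpa using cube_prime p hp) hk)

lemma fiber_card (F : Finset ℤ) (N : ℕ) (hN : 0 < N) (B : ℝ) (hB : ∀ b ∈ F, |(b : ℝ)| ≤ B)
    (hc : ∀ b ∈ F, ∀ b' ∈ F, (N : ℤ) ∣ b - b') : F.card ≤ ⌊2 * B / N⌋₊ + 1 := by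
  rcases F.eq_empty_or_nonempty with rfl | hne
  · simp
  set b0 := F.min' hne with hb0
  have hb0m : b0 ∈ F := F.min'_mem hne
  rw [← Finset.card_range (⌊2 * B / N⌋₊ + 1)]
  apply Finset.card_le_card_of_injOn (fun b => ((b - b0) / N).toNat)
  · intro b hb
    have hle : b0 ≤ b := F.min'_le b hb
    obtain ⟨k, hk⟩ := hc b hb b0 hb0m
    have hN' : (0 : ℤ) < N := by exact_mod_cast hN
    have hk0 : 0 ≤ k := by nlinarith
    simp only [Finset.coe_range, Set.mem_Iio, hk, Int.mul_ediv_cancel_left _ hN'.ne']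
    rw [Nat.lt_succ_iff]
    apply Nat.le_floor
    have e1 : ((k.toNat : ℕ) : ℝ) = (k : ℝ) := by
      exact_mod_cast congrArg (Int.cast : ℤ → ℝ) (Int.toNat_of_nonneg hk0)
    rw [e1, le_div_iff₀ (by exact_mod_cast hN)]
    have h1 := hB b hb
    have h2 := hB b0 hb0m
    rw [abs_le] at h1 h2
    have h3 : (b : ℝ) - b0 = N * k := by exact_mod_cast hk
    linarith
  · intro b hb b' hb' h
    have hle : b0 ≤ b := F.min'_le b hb
    have hle' : b0 ≤ b' := F.min'_le b' hb'
    obtain ⟨k, hk⟩ := hc b hb b0 hb0m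
    obtain ⟨k', hk'⟩ := hc b' hb' b0 hb0m
    have hN' : (0 : ℤ) < N := by exact_mod_cast hN
    have hk0 : 0 ≤ k := by nlinarith
    have hk0' : 0 ≤ k' := by nlinarith
    simp only [hk, hk', Int.mul_ediv_cancel_left _ hN'.ne'] at h
    have : k = k' := by omega
    subst this
    omega

lemma count_b (T : Finset ℤ) (n : ℕ) (hn : Squarefree n) (A c : ℤ) (B : ℝ) (hB0 : 0 ≤ B)
    (hA : IsCoprime A n)
    (hT : ∀ b ∈ T, |(b : ℝ)| ≤ B ∧ IsCoprime b (n : ℤ) ∧ (n : ℤ) ^ 2 ∣ A * b ^ 3 + c) :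
    (T.card : ℝ) ≤ 3 ^ n.primeFactors.card * (2 * B / (n : ℝ) ^ 2 + 1) := by
  classical
  have hn0 : 0 < n := Nat.pos_of_ne_zero hn.ne_zero
  have hN : 0 < n ^ 2 := by positivity
  have : NeZero (n ^ 2) := ⟨hN.ne'⟩
  set f : ℤ → ZMod (n ^ 2) := fun b => (b : ZMod (n ^ 2)) with hf
  have h1 := Finset.card_le_mul_card_image (f := f) T (⌊2 * B / ((n ^ 2 : ℕ) : ℝ)⌋₊ + 1) (by
    intro r hr
    apply fiber_card _ (n ^ 2) hN B
    · intro b hb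
      exact (hT b (Finset.mem_filter.mp hb).1).1
    · intro b hb b' hb'
      have e1 := (Finset.mem_filter.mp hb).2
      have e2 := (Finset.mem_filter.mp hb').2
      have e3 : ((b' : ℤ) : ZMod (n ^ 2)) = (b : ℤ) := e2.trans e1.symm
      exact (ZMod.intCast_eq_intCast_iff_dvd_sub _ _ _).mp e3)
  have h2 : (T.image f).card ≤ 3 ^ n.primeFactors.card := by
    refine le_trans ?_ (cube_sqfree n hn)
    rcases T.eq_empty_or_nonempty with rfl | ⟨b0, hb0⟩
    · simp
    have hu : ∀ b : ℤ, IsCoprime b (n : ℤ) → IsUnit (b : ZMod (n ^ 2)) := by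
      intro b hb
      have : IsCoprime b ((n ^ 2 : ℕ) : ℤ) := by push_cast; exact hb.pow_right
      exact (ZMod.coe_int_isUnit_iff_isCoprime b (n ^ 2)).mpr this.symm
    obtain ⟨u, hu0⟩ := hu b0 (hT b0 hb0).2.1
    have hz : ∀ b ∈ T, (A : ZMod (n ^ 2)) * (b : ZMod (n ^ 2)) ^ 3 + c = 0 := by
      intro b hb
      have := (hT b hb).2.2
      have h3 := (ZMod.intCast_zmod_eq_zero_iff_dvd (A * b ^ 3 + c) (n ^ 2)).mpr (by push_cast; exact this)
      push_cast at h3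
      exact h3
    have hAu := hu A hA
    have hcu : ∀ x ∈ T.image f, (x * (↑u⁻¹ : ZMod (n ^ 2))) ^ 3 = 1 := by
      intro x hx
      obtain ⟨b, hb, rfl⟩ := Finset.mem_image.mp hx
      have e1 := hz b hb
      have e2 := hz b0 hb0
      rw [← hu0] at e2
      have e3 : (A : ZMod (n ^ 2)) * (f b) ^ 3 = A * (u : ZMod (n ^ 2)) ^ 3 := by
        have : (A : ZMod (n ^ 2)) * (f b) ^ 3 + c = A * (u : ZMod (n ^ 2)) ^ 3 + c := e1.trans e2.symm
        exact add_right_cancel this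
      have e4 := hAu.mul_left_cancel e3
      rw [mul_pow, e4, ← mul_pow, Units.mul_inv, one_pow]
    rw [← Nat.card_eq_finsetCard]
    refine Nat.card_le_card_of_injective
      (fun x : {x // x ∈ T.image f} => (⟨x.1 * (↑u⁻¹ : ZMod (n ^ 2)), hcu x.1 x.2⟩ :
        {x : ZMod (n ^ 2) // x ^ 3 = 1})) ?_
    intro x y hxy
    simp only [Subtype.mk.injEq] at hxy
    exact Subtype.ext (u⁻¹.isUnit.mul_right_cancel hxy)
  have h3 : (T.card : ℝ) ≤ ((⌊2 * B / ((n ^ 2 : ℕ) : ℝ)⌋₊ : ℝ) + 1) * (3 ^ n.primeFactors.card) := by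
    have h4 := h1.trans (Nat.mul_le_mul_left _ h2)
    exact_mod_cast h4
  have h5 : (⌊2 * B / ((n ^ 2 : ℕ) : ℝ)⌋₊ : ℝ) ≤ 2 * B / (n : ℝ) ^ 2 := by
    have := Nat.floor_le (a := 2 * B / ((n ^ 2 : ℕ) : ℝ)) (by positivity)
    push_cast at this ⊢
    exact this
  rw [mul_comm]
  refine h3.trans ?_
  gcongr

/-- Rankin trick for counting integer tuples with bounded product. -/
lemma rankin (k : ℕ) (δ : ℝ) (hδ : 0 < δ) : ∃ C : ℝ, 0 < C ∧ ∀ (N : ℝ), 0 < N →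
    ∀ T : Finset (Fin k → ℤ), (∀ n ∈ T, ∏ i, (|(n i : ℝ)| + 1) ≤ N) →
      (T.card : ℝ) ≤ C * N ^ (1 + δ) := by
  classical
  set f : ℤ → ℝ := fun n => ((|(n : ℝ)| + 1) ^ (1 + δ))⁻¹ with hf
  have hfs : Summable f := by
    have h0 : Summable (fun n : ℕ => (((n : ℝ) + 1) ^ (1 + δ))⁻¹) := by
      have := (summable_nat_add_iff 1).mpr (Real.summable_nat_rpow_inv.mpr (by linarith : 1 < 1 + δ))
      simpa using this
    apply Summable.of_nat_of_neg
    · simpa [hf] using h0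
    · simpa [hf] using h0
  have hf0 : ∀ n, 0 < f n := fun n => by positivity
  set S := ∑' n, f n with hS
  have hS0 : 0 < S := hfs.tsum_pos (fun n => (hf0 n).le) 0 (hf0 0)
  refine ⟨S ^ k, by positivity, fun N hN T hT => ?_⟩
  set box : Finset ℤ := T.biUnion (fun n => Finset.univ.image n) with hbox
  calc (T.card : ℝ) = ∑ n ∈ T, 1 := by simp
    _ ≤ ∑ n ∈ T, N ^ (1 + δ) * ∏ i, f (n i) := by
        apply Finset.sum_le_sum
        intro n hn
        have hp : 0 < ∏ i, (|(n i : ℝ)| + 1) := Finset.prod_pos (fun i _ => by positivity)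
        have : ∏ i, f (n i) = ((∏ i, (|(n i : ℝ)| + 1)) ^ (1 + δ))⁻¹ := by
          rw [← Real.finsetProd_rpow _ _ (fun _ _ => by positivity), ← Finset.prod_inv_distrib]
        rw [this, ← div_eq_mul_inv, le_div_iff₀ (by positivity), one_mul]
        exact Real.rpow_le_rpow hp.le (hT n hn) (by linarith)
    _ = N ^ (1 + δ) * ∑ n ∈ T, ∏ i, f (n i) := by rw [Finset.mul_sum]
    _ ≤ N ^ (1 + δ) * ∑ n ∈ Fintype.piFinset (fun _ : Fin k => box), ∏ i, f (n i) := by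
        refine mul_le_mul_of_nonneg_left ?_ (by positivity)
        refine Finset.sum_le_sum_of_subset_of_nonneg ?_ ?_
        · intro n hn
          rw [Fintype.mem_piFinset]
          intro i
          exact Finset.mem_biUnion.mpr ⟨n, hn, Finset.mem_image_of_mem _ (Finset.mem_univ i)⟩
        · intro n _ _; exact Finset.prod_nonneg (fun i _ => (hf0 _).le)
    _ = N ^ (1 + δ) * ∏ _i : Fin k, ∑ j ∈ box, f j := by
        rw [Finset.prod_univ_sum]
    _ ≤ N ^ (1 + δ) * ∏ _i : Fin k, S := by
        gcongr
        · exact hfs.sum_le_tsum _ (fun i _ => (hf0 _).le)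
    _ = S ^ k * N ^ (1 + δ) := by simp; ring

/-- Reduction of a positive definite integral binary quadratic form
`(u z)² + Y w²` along the lattice spanned by `(m,0),(ρ,1)`. -/
lemma gauss_red (m ρ Y : ℤ) (hm : 0 < m) (hY : 0 < Y) : ∃ p0 p1 q0 q1 : ℤ,
    p0 * q1 - p1 * q0 = 1 ∧
    2 * |(m * p0 + ρ * p1) * (m * q0 + ρ * q1) + Y * (p1 * q1)| ≤ (m * p0 + ρ * p1) ^ 2 + Y * p1 ^ 2 ∧
    (m * p0 + ρ * p1) ^ 2 + Y * p1 ^ 2 ≤ (m * q0 + ρ * q1) ^ 2 + Y * q1 ^ 2 := by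
  let P : ℕ → Prop := fun n => ∃ p0 p1 q0 q1 : ℤ, p0 * q1 - p1 * q0 = 1 ∧
    ((m * p0 + ρ * p1) ^ 2 + Y * p1 ^ 2).toNat = n
  have hP : ∃ n, P n := ⟨_, 1, 0, 0, 1, by norm_num, rfl⟩
  classical
  obtain ⟨p0, p1, q0, q1, hdet, hn⟩ := Nat.find_spec hP
  have hmin : ∀ r0 r1 s0 s1 : ℤ, r0 * s1 - r1 * s0 = 1 →
      (m * p0 + ρ * p1) ^ 2 + Y * p1 ^ 2 ≤ (m * r0 + ρ * r1) ^ 2 + Y * r1 ^ 2 := by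
    intro r0 r1 s0 s1 h
    have h1 := Nat.find_min' hP ⟨r0, r1, s0, s1, h, rfl⟩
    rw [← hn] at h1
    have e1 : 0 ≤ (m * p0 + ρ * p1) ^ 2 + Y * p1 ^ 2 := by positivity
    have e2 : 0 ≤ (m * r0 + ρ * r1) ^ 2 + Y * r1 ^ 2 := by positivity
    omega
  set A := (m * p0 + ρ * p1) ^ 2 + Y * p1 ^ 2 with hA
  set B := (m * p0 + ρ * p1) * (m * q0 + ρ * q1) + Y * (p1 * q1) with hB
  have hA0 : 0 < A := by
    by_contra hcon
    have h0 : A = 0 := le_antisymm (not_lt.mp hcon) (by positivity)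
    have hp1 : p1 = 0 := by
      by_contra h
      have : 0 < p1 ^ 2 := by positivity
      nlinarith [sq_nonneg (m * p0 + ρ * p1)]
    subst hp1
    have hp0 : p0 = 0 := by
      by_contra h
      have : 0 < (m * p0) ^ 2 := by positivity
      simp at hA
      nlinarith
    subst hp0
    simp at hdet
  -- shift q by k p
  obtain ⟨k, hk⟩ : ∃ k : ℤ, 2 * |B + k * A| ≤ A := by
    refine ⟨-((2 * B + A) / (2 * A)), ?_⟩
    have h1 := Int.mul_ediv_add_emod (2 * B + A) (2 * A)
    have h2 := Int.emod_nonneg (2 * B + A) (show 2 * A ≠ 0 by omega)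
    have h3 := Int.emod_lt_of_pos (2 * B + A) (show 0 < 2 * A by omega)
    set t := (2 * B + A) / (2 * A)
    set r := (2 * B + A) % (2 * A)
    have h4 : 2 * (B + -t * A) = r - A := by linear_combination -h1
    have : |2 * (B + -t * A)| ≤ A := by rw [h4, abs_le]; constructor <;> linarith
    rwa [abs_mul, abs_two] at this
  refine ⟨p0, p1, q0 + k * p0, q1 + k * p1, by linear_combination hdet, ?_, ?_⟩
  · have : (m * p0 + ρ * p1) * (m * (q0 + k * p0) + ρ * (q1 + k * p1)) + Y * (p1 * (q1 + k * p1))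
        = B + k * A := by rw [hA, hB]; ring
    rw [this]; exact hk
  · have := hmin (-(q0 + k * p0)) (-(q1 + k * p1)) p0 p1 (by linear_combination hdet)
    refine this.trans (le_of_eq (by ring))


lemma mono_bd (c x P u v w a1 a2 a3 : ℝ) (hx : 0 < x) (hc : 0 ≤ c) (hP : |P| ≤ c * x ^ 2)
    (hu : |u| ≤ a1) (hv : |v| * x ≤ a2) (hw : |w| * x ≤ a3) :
    |P * (u * v * w)| ≤ c * (a1 * a2 * a3) := by
  rw [abs_mul, abs_mul, abs_mul]
  have h2 : 0 ≤ |v| * x := by positivity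
  have h3 : 0 ≤ |w| * x := by positivity
  have g1 : 0 ≤ a1 := (abs_nonneg u).trans hu
  have g2 : 0 ≤ a2 := h2.trans hv
  calc |P| * (|u| * |v| * |w|) ≤ (c * x ^ 2) * (|u| * |v| * |w|) := by gcongr
    _ = c * (|u| * (|v| * x) * (|w| * x)) := by ring
    _ ≤ c * (a1 * a2 * a3) := by gcongr

lemma mono_bd' (c x P u v w a1 a2 a3 : ℝ) (hx : 0 < x) (hc : 0 ≤ c) (hP : |P| ≤ c * x ^ 3)
    (hu : |u| * x ≤ a1) (hv : |v| * x ≤ a2) (hw : |w| * x ≤ a3) :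
    |P * (u * v * w)| ≤ c * (a1 * a2 * a3) := by
  rw [abs_mul, abs_mul, abs_mul]
  have h1 : 0 ≤ |u| * x := by positivity
  have h2 : 0 ≤ |v| * x := by positivity
  have h3 : 0 ≤ |w| * x := by positivity
  have g1 : 0 ≤ a1 := h1.trans hu
  have g2 : 0 ≤ a2 := h2.trans hv
  calc |P| * (|u| * |v| * |w|) ≤ (c * x ^ 3) * (|u| * |v| * |w|) := by gcongr
    _ = c * ((|u| * x) * (|v| * x) * (|w| * x)) := by ring
    _ ≤ c * (a1 * a2 * a3) := by gcongr

lemma int_root (u p P Q : ℤ) (hp : p ≠ 0) (h : u ^ 3 + 3 * P * (u * p * p) + 2 * Q * (p * p * p) = 0) :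
    ∃ z : ℤ, z ^ 3 + 3 * P * z + 2 * Q = 0 := by
  have hg : Int.gcd u p ≠ 0 := by
    intro h0; exact hp (Int.gcd_eq_zero_iff.mp h0).2
  obtain ⟨u', p', hco, hu, hp'⟩ := Int.exists_gcd_one (Nat.pos_of_ne_zero hg)
  set g : ℤ := (Int.gcd u p : ℤ) with hgdef
  have hg0 : g ≠ 0 := by rw [hgdef]; exact_mod_cast hg
  have h1 : u' ^ 3 + 3 * P * (u' * p' * p') + 2 * Q * (p' * p' * p') = 0 := by
    have : g ^ 3 * (u' ^ 3 + 3 * P * (u' * p' * p') + 2 * Q * (p' * p' * p')) = 0 := by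
      rw [← h]
      conv_rhs => rw [hu, hp']
      ring
    rcases mul_eq_zero.mp this with h2 | h2
    · exact absurd h2 (pow_ne_zero _ hg0)
    · exact h2
  have hd : p' ∣ u' ^ 3 := ⟨-(3 * P * (u' * p') + 2 * Q * (p' * p')), by linear_combination h1⟩
  have hcop : IsCoprime p' (u' ^ 3) := (Int.isCoprime_iff_gcd_eq_one.mpr hco).symm.pow_right
  have hunit : IsUnit p' := hcop.isUnit_of_dvd' dvd_rfl hd
  rcases Int.isUnit_iff.mp hunit with rfl | rfl
  · exact ⟨u', by linear_combination h1⟩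
  · exact ⟨-u', by linear_combination -h1⟩

lemma final_bd (p q c0 c1 c2 c3 a k x m c : ℝ) (hx : 0 < x) (hm : 0 < m) (hc : 1 ≤ c)
    (ha : 0 ≤ a) (hak : a ≤ k) (hak2 : a * k ≤ 2 * (m * x))
    (hp1 : 1 ≤ |p|) (hc01 : 1 ≤ |c0|)
    (hp : |p| * x ≤ a) (hq : |q| * x ≤ k) (h0 : m ^ 2 * |c0| ≤ 18 * c * (a * a * a))
    (h1 : m ^ 2 * |c1| ≤ 18 * c * (a * a * k)) (h2 : m ^ 2 * |c2| ≤ 18 * c * (a * k * k))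
    (h3 : m ^ 2 * |c3| ≤ 18 * c * (k * k * k)) :
    (|p| + 1) * (|q| + 1) * (|c0| + 1) * (|c1| + 1) * (|c2| + 1) * (|c3| + 1) ≤
      (64 * 18 ^ 4 * 2 ^ 7) * c ^ 4 * x ^ 5 / m := by
  have hk : 0 ≤ k := ha.trans hak
  have hm0 : m ^ 2 ≤ 18 * c * (a * a * a) := by
    refine le_trans ?_ h0
    have : 0 < m ^ 2 := by positivity
    nlinarith
  have e1 : a * a * a ≤ a * a * k := by gcongr
  have e2 : a * a * k ≤ a * k * k := by gcongr
  have e3 : a * k * k ≤ k * k * k := by gcongr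
  have hcp : 0 < 18 * c := by linarith
  have hxa : x ≤ a := by nlinarith
  have bp : (|p| + 1) * x ≤ 2 * a := by nlinarith
  have bq : (|q| + 1) * x ≤ 2 * k := by nlinarith
  have b0 : m ^ 2 * (|c0| + 1) ≤ 2 * (18 * c * (a * a * a)) := by nlinarith
  have m1 : m ^ 2 ≤ 18 * c * (a * a * k) := hm0.trans (by gcongr)
  have m2 : m ^ 2 ≤ 18 * c * (a * k * k) := m1.trans (by gcongr)
  have m3 : m ^ 2 ≤ 18 * c * (k * k * k) := m2.trans (by gcongr)
  have b1 : m ^ 2 * (|c1| + 1) ≤ 2 * (18 * c * (a * a * k)) := by nlinarith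
  have b2 : m ^ 2 * (|c2| + 1) ≤ 2 * (18 * c * (a * k * k)) := by nlinarith
  have b3 : m ^ 2 * (|c3| + 1) ≤ 2 * (18 * c * (k * k * k)) := by nlinarith
  rw [le_div_iff₀ hm]
  have hpos : 0 < m ^ 7 * x ^ 2 := by positivity
  rw [← mul_le_mul_iff_right₀ hpos]
  calc m ^ 7 * x ^ 2 * ((|p| + 1) * (|q| + 1) * (|c0| + 1) * (|c1| + 1) * (|c2| + 1) * (|c3| + 1) * m)
      = ((|p| + 1) * x) * ((|q| + 1) * x) * (m ^ 2 * (|c0| + 1)) * (m ^ 2 * (|c1| + 1)) *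
        (m ^ 2 * (|c2| + 1)) * (m ^ 2 * (|c3| + 1)) := by ring
    _ ≤ (2 * a) * (2 * k) * (2 * (18 * c * (a * a * a))) * (2 * (18 * c * (a * a * k))) *
        (2 * (18 * c * (a * k * k))) * (2 * (18 * c * (k * k * k))) := by gcongr
    _ = 64 * 18 ^ 4 * c ^ 4 * (a * k) ^ 7 := by ring
    _ ≤ 64 * 18 ^ 4 * c ^ 4 * (2 * (m * x)) ^ 7 := by gcongr
    _ = m ^ 7 * x ^ 2 * (64 * 18 ^ 4 * 2 ^ 7 * c ^ 4 * x ^ 5) := by ring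

/-- quadratic and cubic invariants of the quartic form `(p,q)·(c0,c1,c2,c3)` -/
def invI (p q c0 c1 c2 c3 : ℤ) : ℤ :=
  12 * (p * c0) * (q * c3) - 3 * (p * c1 + q * c0) * (p * c3 + q * c2) + (p * c2 + q * c1) ^ 2

def invJ (p q c0 c1 c2 c3 : ℤ) : ℤ :=
  72 * (p * c0) * (p * c2 + q * c1) * (q * c3)
    + 9 * (p * c1 + q * c0) * (p * c2 + q * c1) * (p * c3 + q * c2)
    - 27 * (p * c0) * (p * c3 + q * c2) ^ 2 - 27 * (q * c3) * (p * c1 + q * c0) ^ 2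
    - 2 * (p * c2 + q * c1) ^ 3

lemma invI_smul (t p q c0 c1 c2 c3 : ℤ) :
    t ^ 2 * invI p q c0 c1 c2 c3 = invI p q (t * c0) (t * c1) (t * c2) (t * c3) := by
  unfold invI; ring

lemma invJ_smul (t p q c0 c1 c2 c3 : ℤ) :
    t ^ 3 * invJ p q c0 c1 c2 c3 = invJ p q (t * c0) (t * c1) (t * c2) (t * c3) := by
  unfold invJ; ring

lemma invI_eq (p q u v P Q : ℤ) :
    invI p q (u ^ 3 + 3 * P * (u * p * p) + 2 * Q * (p * p * p))
      (3 * u ^ 2 * v + 3 * P * (2 * (u * p * q) + v * p * p) + 6 * Q * (p * p * q))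
      (3 * u * v ^ 2 + 3 * P * (u * q * q + 2 * (v * p * q)) + 6 * Q * (p * q * q))
      (v ^ 3 + 3 * P * (v * q * q) + 2 * Q * (q * q * q)) = (u * q - v * p) ^ 4 * (-9 * P) := by
  unfold invI; ring

lemma invJ_eq (p q u v P Q : ℤ) :
    invJ p q (u ^ 3 + 3 * P * (u * p * p) + 2 * Q * (p * p * p))
      (3 * u ^ 2 * v + 3 * P * (2 * (u * p * q) + v * p * p) + 6 * Q * (p * p * q))
      (3 * u * v ^ 2 + 3 * P * (u * q * q + 2 * (v * p * q)) + 6 * Q * (p * q * q))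
      (v ^ 3 + 3 * P * (v * q * q) + 2 * Q * (q * q * q)) = (u * q - v * p) ^ 6 * (-54 * Q) := by
  unfold invJ; ring


set_option maxHeartbeats 2000000 in
lemma tuple_exists (c : ℝ) (hc : 1 ≤ c) (X : ℕ) (hX : 1 ≤ X) (P Q m ρ h0 h1 : ℤ) (hm : 0 < m)
    (hmX : 4 * (X : ℤ) ^ 2 ≤ m) (hP : |(P : ℝ)| ≤ c * (X : ℝ) ^ 4) (hQ : |(Q : ℝ)| ≤ c * (X : ℝ) ^ 6)
    (e1 : m * h1 = ρ ^ 2 + P) (e0 : m ^ 2 * h0 = ρ ^ 3 + 3 * P * ρ + 2 * Q) :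
    (∃ z : ℤ, z ^ 3 + 3 * P * z + 2 * Q = 0) ∨
    ∃ p q c0 c1 c2 c3 : ℤ, invI p q c0 c1 c2 c3 = -9 * P ∧ invJ p q c0 c1 c2 c3 = -54 * Q ∧
      (|(p : ℝ)| + 1) * (|(q : ℝ)| + 1) * (|(c0 : ℝ)| + 1) * (|(c1 : ℝ)| + 1) * (|(c2 : ℝ)| + 1) *
        (|(c3 : ℝ)| + 1) ≤ (64 * 18 ^ 4 * 2 ^ 7) * c ^ 4 * (X : ℝ) ^ 10 / m := by
  obtain ⟨p0, p, q0, q, hdet, hB, hAC⟩ := gauss_red m ρ ((X : ℤ) ^ 4) hm (by positivity)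
  set u := m * p0 + ρ * p with hu
  set v := m * q0 + ρ * q with hv
  have huv : u * q - v * p = m := by rw [hu, hv]; linear_combination m * hdet
  set A := u ^ 2 + (X : ℤ) ^ 4 * p ^ 2 with hA
  set C := v ^ 2 + (X : ℤ) ^ 4 * q ^ 2 with hC
  set B := u * v + (X : ℤ) ^ 4 * (p * q) with hBd
  have hABC : A * C - B ^ 2 = (X : ℤ) ^ 4 * m ^ 2 := by
    rw [← huv, hA, hC, hBd]; ring
  have hA0 : 0 ≤ A := by positivity
  have hAC4 : A * C ≤ 4 * ((X : ℤ) ^ 4 * m ^ 2) := by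
    have h2 : (2 * |B|) ^ 2 ≤ A ^ 2 := by gcongr
    have h3 : (2 * |B|) ^ 2 = 4 * B ^ 2 := by rw [mul_pow, sq_abs]; ring
    have h4 : A ^ 2 ≤ A * C := by nlinarith
    nlinarith
  have hp : p ≠ 0 := by
    intro h
    have hp0 : p0 ^ 2 = 1 := by
      rw [h] at hdet
      have : IsUnit p0 := IsUnit.of_mul_eq_one q (by linarith)
      rcases Int.isUnit_iff.mp this with h | h <;> rw [h] <;> norm_num
    have hAm : A = m ^ 2 := by
      rw [hA, hu, h]; linear_combination m ^ 2 * hp0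
    have h5 : m ^ 2 * m ^ 2 ≤ A * C := by rw [hAm] at hAC ⊢; gcongr
    have h6 : m ^ 2 * m ^ 2 ≤ m ^ 2 * (4 * (X : ℤ) ^ 4) := by linarith
    have h7 : m ^ 2 ≤ 4 * (X : ℤ) ^ 4 := le_of_mul_le_mul_left h6 (by positivity)
    have h8 : (4 * (X : ℤ) ^ 2) ^ 2 ≤ m ^ 2 := by gcongr
    have h9 : 0 < (X : ℤ) ^ 4 := by positivity
    nlinarith
  -- the cubic form
  set c0 := m * p0 ^ 3 + 3 * ρ * p0 ^ 2 * p + 3 * h1 * p0 * p ^ 2 + h0 * p ^ 3 with hc0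
  set c1 := 3 * m * p0 ^ 2 * q0 + 3 * ρ * (2 * p0 * q0 * p + p0 ^ 2 * q)
    + 3 * h1 * (q0 * p ^ 2 + 2 * p0 * p * q) + 3 * h0 * p ^ 2 * q with hc1
  set c2 := 3 * m * p0 * q0 ^ 2 + 3 * ρ * (2 * p0 * q0 * q + q0 ^ 2 * p)
    + 3 * h1 * (p0 * q ^ 2 + 2 * q0 * p * q) + 3 * h0 * p * q ^ 2 with hc2
  set c3 := m * q0 ^ 3 + 3 * ρ * q0 ^ 2 * q + 3 * h1 * q0 * q ^ 2 + h0 * q ^ 3 with hc3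
  have f0 : m ^ 2 * c0 = u ^ 3 + 3 * P * (u * p * p) + 2 * Q * (p * p * p) := by
    rw [hc0, hu]; linear_combination 3 * m * p0 * p ^ 2 * e1 + p ^ 3 * e0
  have f1 : m ^ 2 * c1 = 3 * u ^ 2 * v + 3 * P * (2 * (u * p * q) + v * p * p) + 6 * Q * (p * p * q) := by
    rw [hc1, hu, hv]
    linear_combination 3 * m * (q0 * p ^ 2 + 2 * p0 * p * q) * e1 + 3 * p ^ 2 * q * e0
  have f2 : m ^ 2 * c2 = 3 * u * v ^ 2 + 3 * P * (u * q * q + 2 * (v * p * q)) + 6 * Q * (p * q * q) := by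
    rw [hc2, hu, hv]
    linear_combination 3 * m * (p0 * q ^ 2 + 2 * q0 * p * q) * e1 + 3 * p * q ^ 2 * e0
  have f3 : m ^ 2 * c3 = v ^ 3 + 3 * P * (v * q * q) + 2 * Q * (q * q * q) := by
    rw [hc3, hv]; linear_combination 3 * m * q0 * q ^ 2 * e1 + q ^ 3 * e0
  by_cases hc00 : c0 = 0
  · left
    apply int_root u p P Q hp
    rw [← f0, hc00, mul_zero]
  right
  refine ⟨p, q, c0, c1, c2, c3, ?_, ?_, ?_⟩
  · have h := invI_smul (m ^ 2) p q c0 c1 c2 c3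
    rw [f0, f1, f2, f3, invI_eq, huv] at h
    have hm4 : m ^ 4 ≠ 0 := by positivity
    apply mul_left_cancel₀ hm4
    linear_combination h
  · have h := invJ_smul (m ^ 2) p q c0 c1 c2 c3
    rw [f0, f1, f2, f3, invJ_eq, huv] at h
    have hm4 : m ^ 6 ≠ 0 := by positivity
    apply mul_left_cancel₀ hm4
    linear_combination h
  -- real bounds
  set x : ℝ := (X : ℝ) ^ 2 with hx
  have hXr : (1 : ℝ) ≤ X := by exact_mod_cast hX
  have hx0 : 0 < x := by positivity
  set a : ℝ := Real.sqrt A with ha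
  set k : ℝ := Real.sqrt C with hk
  have hA0r : (0 : ℝ) ≤ A := by exact_mod_cast hA0
  have hACr : (A : ℝ) ≤ C := by exact_mod_cast hAC
  have ha2 : a ^ 2 = A := Real.sq_sqrt hA0r
  have hk2 : k ^ 2 = C := Real.sq_sqrt (hA0r.trans hACr)
  have ha0 : 0 ≤ a := Real.sqrt_nonneg _
  have hk0 : 0 ≤ k := Real.sqrt_nonneg _
  have hak : a ≤ k := Real.sqrt_le_sqrt hACr
  have hmr : (0 : ℝ) < m := by exact_mod_cast hm
  have hAr : (A : ℝ) = u ^ 2 + x ^ 2 * p ^ 2 := by rw [hA, hx]; push_cast; ring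
  have hCr : (C : ℝ) = v ^ 2 + x ^ 2 * q ^ 2 := by rw [hC, hx]; push_cast; ring
  have bu : |(u : ℝ)| ≤ a := abs_le_of_sq_le_sq (by rw [ha2, hAr]; nlinarith [sq_nonneg (x * (p : ℝ))]) ha0
  have bv : |(v : ℝ)| ≤ k := abs_le_of_sq_le_sq (by rw [hk2, hCr]; nlinarith [sq_nonneg (x * (q : ℝ))]) hk0
  have bp : |(p : ℝ)| * x ≤ a := by
    have : |(p : ℝ) * x| ≤ a := abs_le_of_sq_le_sq (by rw [ha2, hAr]; nlinarith [sq_nonneg (u : ℝ)]) ha0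
    rwa [abs_mul, abs_of_pos hx0] at this
  have bq : |(q : ℝ)| * x ≤ k := by
    have : |(q : ℝ) * x| ≤ k := abs_le_of_sq_le_sq (by rw [hk2, hCr]; nlinarith [sq_nonneg (v : ℝ)]) hk0
    rwa [abs_mul, abs_of_pos hx0] at this
  have hakm : a * k ≤ 2 * (m * x) := by
    refine (le_abs_self _).trans (abs_le_of_sq_le_sq ?_ (by positivity))
    have : ((A : ℝ) * C) ≤ 4 * ((X : ℝ) ^ 4 * m ^ 2) := by exact_mod_cast hAC4
    rw [mul_pow, ha2, hk2]
    refine this.trans (le_of_eq ?_)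
    rw [hx]; ring
  have hP' : |(P : ℝ)| ≤ c * x ^ 2 := by rw [hx, ← pow_mul]; exact hP
  have hQ' : |(Q : ℝ)| ≤ c * x ^ 3 := by rw [hx, ← pow_mul]; exact hQ
  have hc0' : 0 ≤ c := by linarith
  have tri3 : ∀ y1 y2 y3 : ℝ, |y1 + y2 + y3| ≤ |y1| + |y2| + |y3| := fun y1 y2 y3 => abs_add_three _ _ _
  have one_le : ∀ n : ℤ, n ≠ 0 → (1 : ℝ) ≤ |(n : ℝ)| := fun n hn => by
    exact_mod_cast Int.one_le_abs hn
  have mon3 : ∀ (y1 y2 y3 : ℤ) (b1 b2 b3 : ℝ), |(y1 : ℝ)| ≤ b1 → |(y2 : ℝ)| ≤ b2 → |(y3 : ℝ)| ≤ b3 →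
      |(y1 : ℝ) * y2 * y3| ≤ b1 * b2 * b3 := by
    intro y1 y2 y3 b1 b2 b3 g1 g2 g3
    rw [abs_mul, abs_mul]
    have := (abs_nonneg _).trans g1
    have := (abs_nonneg _).trans g2
    gcongr
  have absm : ∀ n : ℤ, (m : ℝ) ^ 2 * |(n : ℝ)| = |((m ^ 2 * n : ℤ) : ℝ)| := by
    intro n; push_cast; rw [abs_mul, abs_of_pos (by positivity : (0 : ℝ) < (m : ℝ) ^ 2)]
  have := final_bd p q c0 c1 c2 c3 a k x m c hx0 hmr hc ha0 hak hakm (one_le p hp) (one_le c0 hc00)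
    bp bq ?_ ?_ ?_ ?_
  · refine this.trans (le_of_eq ?_)
    rw [hx]; ring
  · rw [absm, f0]; push_cast
    have t1 := mon3 u u u a a a bu bu bu
    have t2 := mono_bd c x P u p p a a a hx0 hc0' hP' bu bp bp
    have t3 := mono_bd' c x Q p p p a a a hx0 hc0' hQ' bp bp bp
    have haaa : 0 ≤ a * a * a := by positivity
    have hca : a * a * a ≤ c * (a * a * a) := le_mul_of_one_le_left haaa hc
    rw [abs_le] at t1 t2 t3 ⊢
    constructor <;> linarith
  · rw [absm, f1]; push_cast
    have t1 := mon3 u u v a a k bu bu bv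
    have t2 := mono_bd c x P u p q a a k hx0 hc0' hP' bu bp bq
    have t2' := mono_bd c x P v p p k a a hx0 hc0' hP' bv bp bp
    have t3 := mono_bd' c x Q p p q a a k hx0 hc0' hQ' bp bp bq
    have haaa : 0 ≤ a * a * k := by positivity
    have hca : a * a * k ≤ c * (a * a * k) := le_mul_of_one_le_left haaa hc
    rw [show k * a * a = a * a * k by ring] at t2'
    rw [abs_le] at t1 t2 t2' t3 ⊢
    constructor <;> linarith
  · rw [absm, f2]; push_cast
    have t1 := mon3 u v v a k k bu bv bv
    have t2 := mono_bd c x P u q q a k k hx0 hc0' hP' bu bq bq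
    have t2' := mono_bd c x P v p q k a k hx0 hc0' hP' bv bp bq
    have t3 := mono_bd' c x Q p q q a k k hx0 hc0' hQ' bp bq bq
    have haaa : 0 ≤ a * k * k := by positivity
    have hca : a * k * k ≤ c * (a * k * k) := le_mul_of_one_le_left haaa hc
    rw [show k * a * k = a * k * k by ring] at t2'
    rw [abs_le] at t1 t2 t2' t3 ⊢
    constructor <;> linarith
  · rw [absm, f3]; push_cast
    have t1 := mon3 v v v k k k bv bv bv
    have t2 := mono_bd c x P v q q k k k hx0 hc0' hP' bv bq bq
    have t3 := mono_bd' c x Q q q q k k k hx0 hc0' hQ' bq bq bq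
    have haaa : 0 ≤ k * k * k := by positivity
    have hca : k * k * k ≤ c * (k * k * k) := le_mul_of_one_le_left haaa hc
    rw [abs_le] at t1 t2 t3 ⊢
    constructor <;> linarith


lemma rho_exists (m P Q : ℤ) (hco : IsCoprime m P) (hD : m ^ 2 ∣ P ^ 3 + Q ^ 2) :
    ∃ ρ h1 h0 : ℤ, m * h1 = ρ ^ 2 + P ∧ m ^ 2 * h0 = ρ ^ 3 + 3 * P * ρ + 2 * Q := by
  obtain ⟨s, t, hst⟩ := hco.pow_left (m := 2)
  obtain ⟨d, hd⟩ := hD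
  have hPρ : P * (-(t * Q)) = -Q + m ^ 2 * (s * Q) := by linear_combination -Q * hst
  set ρ := -(t * Q)
  set e := s * Q
  have h1 : m ^ 2 ∣ ρ ^ 2 + P := by
    have hc : IsCoprime (m ^ 2) (P ^ 2) := hco.pow
    apply hc.dvd_of_dvd_mul_left
    refine ⟨d + (-2 * Q * e + m ^ 2 * e ^ 2), ?_⟩
    have : P ^ 2 * (ρ ^ 2 + P) = (P * ρ) ^ 2 + P ^ 3 := by ring
    rw [this, hPρ]; linear_combination hd
  have h0 : m ^ 2 ∣ ρ ^ 3 + 3 * P * ρ + 2 * Q := by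
    have hc : IsCoprime (m ^ 2) (P ^ 3) := hco.pow
    apply hc.dvd_of_dvd_mul_left
    refine ⟨-Q * d + (3 * Q ^ 2 * e - 3 * Q * m ^ 2 * e ^ 2 + m ^ 4 * e ^ 3) + 3 * P ^ 3 * e, ?_⟩
    have : P ^ 3 * (ρ ^ 3 + 3 * P * ρ + 2 * Q) = (P * ρ) ^ 3 + 3 * P ^ 3 * (P * ρ) + 2 * Q * P ^ 3 := by ring
    rw [this, hPρ]; linear_combination -Q * hd
  obtain ⟨k1, hk1⟩ := h1
  obtain ⟨k0, hk0⟩ := h0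
  exact ⟨ρ, m * k1, k0, by rw [hk1]; ring, hk0.symm⟩

lemma root_bd (c X z P Q : ℝ) (hc : 1 ≤ c) (hX : 1 ≤ X) (hP : |P| ≤ c * X ^ 4)
    (hQ : |Q| ≤ c * X ^ 6) (h : z ^ 3 + 3 * P * z + 2 * Q = 0) : |z| ≤ 5 * c * X ^ 2 := by
  by_contra hcon
  push Not at hcon
  have hX2 : 0 < X ^ 2 := by positivity
  set t := |z| with ht
  have h1 : t ^ 3 ≤ 3 * (c * X ^ 4) * t + 2 * (c * X ^ 6) := by
    have e : t ^ 3 = |3 * P * z + 2 * Q| := by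
      rw [ht, ← abs_pow, ← abs_neg (z ^ 3)]; congr 1; linarith
    rw [e]
    calc |3 * P * z + 2 * Q| ≤ |3 * P * z| + |2 * Q| := abs_add_le _ _
      _ = 3 * |P| * t + 2 * |Q| := by rw [abs_mul, abs_mul, abs_mul]; norm_num [ht]
      _ ≤ _ := by gcongr
  have ht0 : X ^ 2 ≤ t := by nlinarith
  have htp : 0 < t := by linarith
  have h2 : 2 * (c * X ^ 6) ≤ 2 * (c * X ^ 4) * t := by
    have : X ^ 6 = X ^ 4 * X ^ 2 := by ring
    rw [this]
    have : 0 ≤ c * X ^ 4 := by positivity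
    nlinarith
  have h3 : t ^ 2 * t ≤ 5 * (c * X ^ 4) * t := by nlinarith
  have h4 : t ^ 2 ≤ 5 * (c * X ^ 4) := le_of_mul_le_mul_right h3 htp
  have h5 : (5 * c * X ^ 2) ^ 2 < t ^ 2 := by gcongr
  have h6 : c * X ^ 4 ≤ c ^ 2 * X ^ 4 := by gcongr; nlinarith
  nlinarith [show 0 < c * X ^ 4 by positivity]

lemma count_root (α β : ℤ) (hα : α ≠ 0) (hβ : β ≠ 0) (X c : ℕ) (hX : 1 ≤ X) (hc : 1 ≤ c)
    (hcP : (|α * β| : ℤ) ≤ c) (hcQ : (|α * β ^ 2| : ℤ) ≤ c)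
    (T : Finset (ℤ × ℤ)) (hT : ∀ x ∈ T, x.1 ≠ 0 ∧ |x.1| ≤ (X : ℤ) ^ 3 ∧ |x.2| ≤ (X : ℤ) ^ 4 ∧
      ∃ z : ℤ, z ^ 3 + 3 * (α * β * x.2) * z + 2 * (α * β ^ 2 * x.1 ^ 2) = 0) :
    T.card ≤ 33 * c * X ^ 5 := by
  classical
  choose! z hz using fun x hx => (hT x hx).2.2.2
  have hcard : ((Finset.Icc (-(X : ℤ) ^ 3) ((X : ℤ) ^ 3)) ×ˢ
      (Finset.Icc (-(5 * c * (X : ℤ) ^ 2)) (5 * c * (X : ℤ) ^ 2))).card ≤ 33 * c * X ^ 5 := by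
    rw [Finset.card_product, Int.card_Icc, Int.card_Icc]
    have e1 : ((X : ℤ) ^ 3 + 1 - -(X : ℤ) ^ 3).toNat = 2 * X ^ 3 + 1 := by
      rw [show ((X : ℤ) ^ 3 + 1 - -(X : ℤ) ^ 3) = ((2 * X ^ 3 + 1 : ℕ) : ℤ) by push_cast; ring]
      exact Int.toNat_natCast _
    have e2 : (5 * (c : ℤ) * (X : ℤ) ^ 2 + 1 - -(5 * (c : ℤ) * (X : ℤ) ^ 2)).toNat
        = 10 * c * X ^ 2 + 1 := by
      rw [show (5 * (c : ℤ) * (X : ℤ) ^ 2 + 1 - -(5 * (c : ℤ) * (X : ℤ) ^ 2))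
        = ((10 * c * X ^ 2 + 1 : ℕ) : ℤ) by push_cast; ring]
      exact Int.toNat_natCast _
    rw [e1, e2]
    have g1 : 1 ≤ X ^ 3 := Nat.one_le_pow _ _ hX
    have g2 : 1 ≤ c * X ^ 2 := Nat.one_le_iff_ne_zero.mpr (by positivity)
    calc (2 * X ^ 3 + 1) * (10 * c * X ^ 2 + 1) ≤ (3 * X ^ 3) * (11 * (c * X ^ 2)) := by
          apply Nat.mul_le_mul
          · omega
          · rw [mul_assoc]; omega
      _ = _ := by ring
  refine le_trans ?_ hcard
  apply Finset.card_le_card_of_injOn (fun x => (x.1, z x))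
  · intro x hx
    obtain ⟨h0, h1, h2, -⟩ := hT x hx
    have hzx := hz x hx
    have hb := root_bd (c : ℝ) X (z x) ((α * β * x.2 : ℤ) : ℝ) ((α * β ^ 2 * x.1 ^ 2 : ℤ) : ℝ)
      (by exact_mod_cast hc) (by exact_mod_cast hX)
      (by
        have : |α * β * x.2| ≤ c * (X : ℤ) ^ 4 := by rw [abs_mul]; gcongr
        exact_mod_cast this)
      (by
        have : |α * β ^ 2 * x.1 ^ 2| ≤ c * (X : ℤ) ^ 6 := by
          rw [abs_mul, abs_pow x.1, show (X : ℤ) ^ 6 = ((X : ℤ) ^ 3) ^ 2 by ring]; gcongr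
        exact_mod_cast this)
      (by exact_mod_cast hzx)
    have hb' : |z x| ≤ 5 * c * (X : ℤ) ^ 2 := by exact_mod_cast hb
    simp only [Finset.coe_product, Set.mem_prod, Finset.coe_Icc, Set.mem_Icc]
    exact ⟨abs_le.mp h1, abs_le.mp hb'⟩
  · intro x hx y hy hxy
    simp only [Prod.mk.injEq] at hxy
    obtain ⟨ha, hzz⟩ := hxy
    have e1 := hz x hx
    have e2 := hz y hy
    rw [← hzz, ← ha] at e2
    have hz0 : z x ≠ 0 := by
      intro h
      rw [h] at e1
      have : α * β ^ 2 * x.1 ^ 2 ≠ 0 :=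
        mul_ne_zero (mul_ne_zero hα (pow_ne_zero _ hβ)) (pow_ne_zero _ (hT x hx).1)
      apply this; linarith
    have hne : 3 * (α * β) * z x ≠ 0 := mul_ne_zero (mul_ne_zero (by norm_num) (mul_ne_zero hα hβ)) hz0
    have : x.2 = y.2 := by
      apply mul_left_cancel₀ hne
      linear_combination e1 - e2
    exact Prod.ext ha this

lemma count_main (α β : ℤ) (hα : α ≠ 0) (hβ : β ≠ 0) (δ : ℝ) (hδ : 0 < δ) :
    ∃ C : ℝ, 0 < C ∧ ∀ (X : ℕ) (Y : ℝ), 1 ≤ X → 4 * (X : ℝ) ^ 2 ≤ Y → ∀ T : Finset (ℤ × ℤ),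
      (∀ x ∈ T, x.1 ≠ 0 ∧ |x.1| ≤ (X : ℤ) ^ 3 ∧ |x.2| ≤ (X : ℤ) ^ 4 ∧
        ∃ m : ℕ, Y ≤ m ∧ IsCoprime (m : ℤ) (α * β * x.2) ∧ (m : ℤ) ^ 2 ∣ β * x.1 ^ 4 + α * x.2 ^ 3) →
      (T.card : ℝ) ≤ C * (((X : ℝ) ^ 10 / Y) ^ (1 + δ) + (X : ℝ) ^ 5) := by
  classical
  obtain ⟨C0, hC0, hR⟩ := rankin 7 δ hδ
  set c : ℕ := (|α * β|).toNat + (|α * β ^ 2|).toNat with hc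
  have hc1 : 1 ≤ c := by
    have : 0 < |α * β| := abs_pos.mpr (mul_ne_zero hα hβ)
    omega
  have hcP : (|α * β| : ℤ) ≤ c := by
    have := abs_nonneg (α * β)
    omega
  have hcQ : (|α * β ^ 2| : ℤ) ≤ c := by
    have := abs_nonneg (α * β ^ 2)
    omega
  set K : ℝ := 2 * ((64 * 18 ^ 4 * 2 ^ 7) * (c : ℝ) ^ 4) with hK
  have hcr : (1 : ℝ) ≤ c := by exact_mod_cast hc1
  have hK0 : 0 < K := by positivity
  refine ⟨C0 * K ^ (1 + δ) + 33 * c, by positivity, fun X Y hX hY T hT => ?_⟩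
  have hXr : (1 : ℝ) ≤ X := by exact_mod_cast hX
  have hY0 : 0 < Y := by nlinarith
  set Rt : ℤ × ℤ → Prop := fun x =>
    ∃ z : ℤ, z ^ 3 + 3 * (α * β * x.2) * z + 2 * (α * β ^ 2 * x.1 ^ 2) = 0 with hRt
  have hsplit := Finset.card_filter_add_card_filter_not (s := T) Rt
  have h1 : (T.filter Rt).card ≤ 33 * c * X ^ 5 := by
    apply count_root α β hα hβ X c hX hc1 hcP hcQ
    intro x hx
    obtain ⟨hxT, hr⟩ := Finset.mem_filter.mp hx
    obtain ⟨g1, g2, g3, -⟩ := hT x hxT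
    exact ⟨g1, g2, g3, hr⟩
  have hex : ∀ x ∈ T.filter (fun x => ¬ Rt x), ∃ n : Fin 7 → ℤ,
      invI (n 0) (n 1) (n 2) (n 3) (n 4) (n 5) = -9 * (α * β * x.2) ∧
      invJ (n 0) (n 1) (n 2) (n 3) (n 4) (n 5) = -54 * (α * β ^ 2 * x.1 ^ 2) ∧
      n 6 = x.1.sign ∧ ∏ i, (|(n i : ℝ)| + 1) ≤ K * ((X : ℝ) ^ 10 / Y) := by
    intro x hx
    obtain ⟨hxT, hr⟩ := Finset.mem_filter.mp hx
    obtain ⟨g1, g2, g3, m, hm, hco, hdvd⟩ := hT x hxT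
    obtain ⟨ρ, k1, k0, e1, e0⟩ := rho_exists (m : ℤ) (α * β * x.2) (α * β ^ 2 * x.1 ^ 2) hco
      (Dvd.dvd.trans hdvd ⟨α ^ 2 * β ^ 3, by ring⟩)
    have hmr : 0 < (m : ℝ) := hY0.trans_le hm
    have hm0 : (0 : ℤ) < m := by exact_mod_cast hmr
    have hmX : 4 * (X : ℤ) ^ 2 ≤ m := by
      have := hY.trans hm
      exact_mod_cast this
    rcases tuple_exists c hcr X hX _ _ _ ρ k0 k1 hm0 hmX
      (by
        have : |α * β * x.2| ≤ c * (X : ℤ) ^ 4 := by rw [abs_mul]; gcongr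
        exact_mod_cast this)
      (by
        have : |α * β ^ 2 * x.1 ^ 2| ≤ c * (X : ℤ) ^ 6 := by
          rw [abs_mul, abs_pow x.1, show (X : ℤ) ^ 6 = ((X : ℤ) ^ 3) ^ 2 by ring]; gcongr
        exact_mod_cast this) e1 e0 with hroot | ⟨p, q, c0, c1, c2, c3, hI, hJ, hb⟩
    · exact absurd hroot hr
    · refine ⟨![p, q, c0, c1, c2, c3, x.1.sign], hI, hJ, rfl, ?_⟩
      have hs : |((x.1.sign : ℤ) : ℝ)| = 1 := by
        rw [← Int.cast_abs, Int.abs_sign_of_ne_zero g1]; norm_num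
      rw [Fin.prod_univ_seven]
      change (|(p : ℝ)| + 1) * (|(q : ℝ)| + 1) * (|(c0 : ℝ)| + 1) * (|(c1 : ℝ)| + 1) * (|(c2 : ℝ)| + 1) *
        (|(c3 : ℝ)| + 1) * (|((x.1.sign : ℤ) : ℝ)| + 1) ≤ _
      rw [hs]
      calc _ ≤ ((64 * 18 ^ 4 * 2 ^ 7) * (c : ℝ) ^ 4 * (X : ℝ) ^ 10 / ((m : ℤ) : ℝ)) * (1 + 1) := by gcongr
        _ ≤ ((64 * 18 ^ 4 * 2 ^ 7) * (c : ℝ) ^ 4 * (X : ℝ) ^ 10 / Y) * (1 + 1) := by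
            have : ((m : ℤ) : ℝ) = m := by norm_cast
            rw [this]; gcongr
        _ = _ := by rw [hK]; ring
  choose! n hnI hnJ hns hnb using hex
  have h2 : ((T.filter (fun x => ¬ Rt x)).card : ℝ) ≤ C0 * (K * ((X : ℝ) ^ 10 / Y)) ^ (1 + δ) := by
    have hinj : Set.InjOn n (T.filter (fun x => ¬ Rt x)) := by
      intro x hx y hy hxy
      have i1 := hnI x hx
      have i2 := hnI y hy
      have j1 := hnJ x hx
      have j2 := hnJ y hy
      have s1 := hns x hx
      have s2 := hns y hy
      rw [hxy] at i1 j1 s1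
      have hb : x.2 = y.2 := by
        apply mul_left_cancel₀ (mul_ne_zero hα hβ); linarith
      have ha2 : x.1 ^ 2 = y.1 ^ 2 := by
        apply mul_left_cancel₀ (mul_ne_zero hα (pow_ne_zero 2 hβ)); linarith
      have hab : |x.1| = |y.1| := sq_eq_sq_iff_abs_eq_abs _ _ |>.mp ha2
      have ha : x.1 = y.1 := by
        rw [← Int.sign_mul_abs x.1, ← Int.sign_mul_abs y.1, hab, ← s1, ← s2]
      exact Prod.ext ha hb
    rw [← Finset.card_image_of_injOn hinj]
    apply hR _ (by positivity)
    intro w hw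
    obtain ⟨x, hx, rfl⟩ := Finset.mem_image.mp hw
    exact hnb x hx
  rw [Real.mul_rpow hK0.le (by positivity)] at h2
  have h1r : ((T.filter Rt).card : ℝ) ≤ 33 * c * (X : ℝ) ^ 5 := by exact_mod_cast h1
  have hsr : (T.card : ℝ) = ((T.filter Rt).card : ℝ) + ((T.filter (fun x => ¬ Rt x)).card : ℝ) := by
    exact_mod_cast hsplit.symm
  rw [hsr]
  have hpos1 : 0 ≤ ((X : ℝ) ^ 10 / Y) ^ (1 + δ) := by positivity
  have hpos2 : 0 ≤ (X : ℝ) ^ 5 := by positivity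
  have hpos3 : 0 ≤ C0 * K ^ (1 + δ) := by positivity
  have hpos4 : (0 : ℝ) ≤ 33 * c := by positivity
  nlinarith [mul_nonneg hpos3 hpos2, mul_nonneg hpos4 hpos1]


/-- Splitting of a squarefree modulus. -/
lemma decomp (α β : ℤ) (hα : α ≠ 0) (hβ : β ≠ 0) (m : ℕ) (hm : Squarefree m) (a b : ℤ)
    (hdiv : (m:ℤ)^2 ∣ β * a^4 + α * b^3) :
    ∃ d n : ℕ, d ∣ m ∧ n ∣ m ∧ (d:ℤ) ∣ a ∧ (d:ℤ) ∣ b ∧ IsCoprime (n:ℤ) (α*β*b) ∧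
      d.Coprime n ∧ m ≤ (α*β).natAbs * (d*n) := by
  have hm0 : m ≠ 0 := hm.ne_zero
  set K := (α*β).natAbs with hK
  have hK0 : 0 < K := Int.natAbs_pos.mpr (mul_ne_zero hα hβ)
  set m1 := Nat.gcd m (α*β*b).natAbs with hm1
  obtain ⟨n, hn⟩ : m1 ∣ m := Nat.gcd_dvd_left _ _
  set m0 := Nat.gcd m1 K with hm0'
  obtain ⟨d, hd⟩ : m0 ∣ m1 := Nat.gcd_dvd_left _ _
  have h1 : Nat.Coprime m1 n := Nat.coprime_of_squarefree_mul (hn ▸ hm)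
  have hsq1 : Squarefree m1 := hm.squarefree_of_dvd ⟨n, hn⟩
  have h2 : Nat.Coprime m0 d := Nat.coprime_of_squarefree_mul (hd ▸ hsq1)
  have hdm1 : d ∣ m1 := ⟨m0, by rw [hd, mul_comm]⟩
  have hsqd : Squarefree d := hsq1.squarefree_of_dvd hdm1
  have hnm : n ∣ m := ⟨m1, by rw [hn, mul_comm]⟩
  have hdm : d ∣ m := hdm1.trans ⟨n, hn⟩
  have hdK : Nat.Coprime d K := by
    have : Nat.gcd d K ∣ m0 := Nat.dvd_gcd ((Nat.gcd_dvd_left _ _).trans hdm1) (Nat.gcd_dvd_right _ _)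
    exact Nat.eq_one_of_dvd_coprimes h2 this (Nat.gcd_dvd_left _ _)
  have hdK' : IsCoprime (d:ℤ) (α*β) := by
    rw [Int.isCoprime_iff_gcd_eq_one]
    simpa [Int.gcd] using hdK
  have hdb : (d:ℤ) ∣ b := by
    have : (d:ℤ) ∣ α*β*b := by
      rw [Int.natCast_dvd]
      exact hdm1.trans (Nat.gcd_dvd_right _ _)
    exact hdK'.dvd_of_dvd_mul_left this
  have hda : (d:ℤ) ∣ a := by
    have e1 : (d:ℤ) ∣ β * a^4 + α * b^3 :=
      (Int.natCast_dvd_natCast.mpr hdm).trans ((dvd_pow_self _ two_ne_zero).trans hdiv)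
    have e2 : (d:ℤ) ∣ α * b^3 := Dvd.dvd.mul_left (hdb.trans (dvd_pow_self _ three_ne_zero)) _
    have e3 : (d:ℤ) ∣ β * a^4 := (dvd_add_left e2).mp e1
    have e4 : (d:ℤ) ∣ a^4 := (IsCoprime.of_mul_right_right hdK').dvd_of_dvd_mul_left e3
    have e5 : Squarefree (d:ℤ) := Int.squarefree_natCast.mpr hsqd
    exact (e5.dvd_pow_iff_dvd (by norm_num)).mp e4
  refine ⟨d, n, hdm, hnm, hda, hdb, ?_, h1.coprime_dvd_left hdm1, ?_⟩
  · rw [Int.isCoprime_iff_gcd_eq_one]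
    have : Nat.gcd n (α*β*b).natAbs ∣ m1 :=
      Nat.dvd_gcd ((Nat.gcd_dvd_left _ _).trans hnm) (Nat.gcd_dvd_right _ _)
    have := Nat.eq_one_of_dvd_coprimes h1 this (Nat.gcd_dvd_left _ _)
    simpa [Int.gcd] using this
  · have : m0 ≤ K := Nat.le_of_dvd hK0 (Nat.gcd_dvd_right _ _)
    calc m = m0 * (d * n) := by rw [← mul_assoc, ← hd, ← hn]
      _ ≤ _ := Nat.mul_le_mul_right _ this

lemma mult_card (U : Finset ℤ) (d : ℕ) (hd : 0 < d) (R : ℝ) (hR : 0 ≤ R)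
    (h : ∀ a ∈ U, a ≠ 0 ∧ |(a:ℝ)| ≤ R ∧ (d:ℤ) ∣ a) : (U.card : ℝ) ≤ 2 * R / d := by
  have hd' : (0:ℝ) < d := by exact_mod_cast hd
  set k := ⌊R/d⌋₊ with hk
  have hk' : (k:ℝ) ≤ R/d := Nat.floor_le (by positivity)
  have hsub : U ⊆ ((Finset.Icc (-(k:ℤ)) k).erase 0).image (fun t => (d:ℤ) * t) := by
    intro a ha
    obtain ⟨h0, h1, t, rfl⟩ := h a ha
    refine Finset.mem_image.mpr ⟨t, ?_, rfl⟩
    have ht0 : t ≠ 0 := by rintro rfl; simp at h0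
    have : |t| ≤ (k:ℤ) := by
      have : t.natAbs ≤ k := by
        apply Nat.le_floor
        rw [le_div_iff₀ hd', Nat.cast_natAbs]
        push_cast at h1 ⊢
        rw [abs_mul, abs_of_pos hd'] at h1
        linarith
      rw [Int.abs_eq_natAbs]
      exact_mod_cast this
    rw [abs_le] at this
    simp [ht0, this]
  have hc : U.card ≤ 2 * k := by
    refine (Finset.card_le_card hsub).trans (Finset.card_image_le.trans ?_)
    rw [Finset.card_erase_of_mem (by simp)]
    simp; omega
  calc (U.card:ℝ) ≤ 2 * k := by exact_mod_cast hc
    _ ≤ 2 * (R/d) := by linarith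
    _ = _ := by ring

/-- Fibre counting for pairs. -/
lemma pair_card (T : Finset (ℤ × ℤ)) (P Q : ℝ) (hQ : 0 ≤ Q) (h1 : ((T.image Prod.fst).card : ℝ) ≤ P)
    (h2 : ∀ a, (((T.filter (fun x => x.1 = a)).image Prod.snd).card : ℝ) ≤ Q) :
    (T.card : ℝ) ≤ P * Q := by
  rw [Finset.card_eq_sum_card_image Prod.fst T]
  push_cast
  calc _ ≤ ∑ a ∈ T.image Prod.fst, Q := by
        refine Finset.sum_le_sum fun a _ => ?_
        refine le_trans ?_ (h2 a)
        rw [Finset.card_image_of_injOn]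
        rintro ⟨x, y⟩ hx ⟨x', y'⟩ hx' hh
        simp at hx hx' hh
        simp [hx.2, hx'.2, hh]
    _ = ((T.image Prod.fst).card : ℝ) * Q := by simp
    _ ≤ P * Q := by gcongr

lemma fiber_small (α β : ℤ) (d n : ℕ) (hd : 0 < d) (hn : Squarefree n) (hdn : d.Coprime n)
    (A B : ℝ) (hA : 0 ≤ A) (hB : 0 ≤ B) (T : Finset (ℤ × ℤ))
    (hT : ∀ x ∈ T, x.1 ≠ 0 ∧ |(x.1:ℝ)| ≤ A ∧ |(x.2:ℝ)| ≤ B ∧ (d:ℤ) ∣ x.1 ∧ (d:ℤ) ∣ x.2 ∧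
      IsCoprime (n:ℤ) (α*β*x.2) ∧ (n:ℤ)^2 ∣ β * x.1^4 + α * x.2^3) :
    (T.card : ℝ) ≤ (2*A/d) * (3 ^ n.primeFactors.card * (2*(B/d)/(n:ℝ)^2 + 1)) := by
  have hd' : (0:ℝ) < d := by exact_mod_cast hd
  apply pair_card _ _ _ (by positivity)
  · apply mult_card _ _ hd _ hA
    intro a ha
    obtain ⟨x, hx, rfl⟩ := Finset.mem_image.mp ha
    exact ⟨(hT x hx).1, (hT x hx).2.1, (hT x hx).2.2.2.1⟩
  · intro a
    set U := (T.filter (fun x => x.1 = a)).image Prod.snd with hU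
    have hUm : ∀ b ∈ U, (a, b) ∈ T := by
      intro b hb
      obtain ⟨⟨x, y⟩, hx, rfl⟩ := Finset.mem_image.mp hb
      obtain ⟨h1, h2⟩ := Finset.mem_filter.mp hx
      simp only at h2
      subst h2
      exact h1
    rcases U.eq_empty_or_nonempty with he | ⟨b0, hb0⟩
    · rw [he]; simp; positivity
    have hcard : (U.image (fun b => b / (d:ℤ))).card = U.card := by
      apply Finset.card_image_of_injOn
      intro b hb b' hb' hh
      obtain ⟨u, hu⟩ := (hT _ (hUm b hb)).2.2.2.2.1
      obtain ⟨v, hv⟩ := (hT _ (hUm b' hb')).2.2.2.2.1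
      simp only at hu hv hh
      have hdz : (d:ℤ) ≠ 0 := by exact_mod_cast hd.ne'
      rw [hu, hv, Int.mul_ediv_cancel_left _ hdz, Int.mul_ediv_cancel_left _ hdz] at hh
      rw [hu, hv, hh]
    rw [← hcard]
    have hcop := (hT _ (hUm b0 hb0)).2.2.2.2.2.1
    have hdn' : IsCoprime (d:ℤ) (n:ℤ) := Nat.isCoprime_iff_coprime.mpr hdn
    have hαn : IsCoprime α (n:ℤ) := (IsCoprime.of_mul_right_left (IsCoprime.of_mul_right_left hcop)).symm
    apply count_b _ n hn (α * (d:ℤ)^3) (β * a^4) (B/d) (by positivity)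
    · exact hαn.mul_left hdn'.pow_left
    · intro b' hb'
      obtain ⟨b, hb, rfl⟩ := Finset.mem_image.mp hb'
      obtain ⟨-, -, h3, -, ⟨u, hu⟩, h6, h7⟩ := hT _ (hUm b hb)
      simp only at hu h3 h6 h7
      have hdz : (d:ℤ) ≠ 0 := by exact_mod_cast hd.ne'
      subst hu
      rw [Int.mul_ediv_cancel_left _ hdz]
      refine ⟨?_, ?_, ?_⟩
      · rw [le_div_iff₀ hd']
        push_cast at h3
        rw [abs_mul, abs_of_pos hd'] at h3
        linarith
      · exact (IsCoprime.of_mul_right_right (IsCoprime.of_mul_right_right h6)).symm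
      · convert h7 using 1; ring

lemma small_m (α β : ℤ) (hα : α ≠ 0) (hβ : β ≠ 0) (m : ℕ) (hm : Squarefree m) (X : ℝ) (hX : 1 ≤ X)
    (T : Finset (ℤ × ℤ))
    (hT : ∀ x ∈ T, x.1 ≠ 0 ∧ |(x.1:ℝ)| ≤ X^3 ∧ |(x.2:ℝ)| ≤ X^4 ∧
      (m:ℤ)^2 ∣ β * x.1^4 + α * x.2^3) :
    (T.card : ℝ) ≤ 12 ^ m.primeFactors.card *
      (4 * ((α*β).natAbs:ℝ)^2 * X^7 / (m:ℝ)^2 + 2 * X^3) := by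
  classical
  have hm0 : m ≠ 0 := hm.ne_zero
  set K := (α*β).natAbs with hK
  set I := (m.divisors ×ˢ m.divisors).filter (fun q => q.1.Coprime q.2 ∧ m ≤ K * (q.1*q.2)) with hI
  let G : ℕ × ℕ → Finset (ℤ × ℤ) := fun q => T.filter (fun x => (q.1:ℤ) ∣ x.1 ∧ (q.1:ℤ) ∣ x.2 ∧
      IsCoprime (q.2:ℤ) (α*β*x.2))
  have hsub : T ⊆ I.biUnion G := by
    intro x hx
    obtain ⟨d, n, h1, h2, h3, h4, h5, h6, h7⟩ := decomp α β hα hβ m hm x.1 x.2 (hT x hx).2.2.2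
    rw [Finset.mem_biUnion]
    exact ⟨(d, n), by
      simp only [hI, Finset.mem_filter, Finset.mem_product, Nat.mem_divisors]
      exact ⟨⟨⟨h1, hm0⟩, h2, hm0⟩, h6, h7⟩, by simp [G, hx, h3, h4, h5]⟩
  have hG : ∀ q ∈ I, ((G q).card : ℝ) ≤ 3 ^ m.primeFactors.card *
      (4 * (K:ℝ)^2 * X^7 / (m:ℝ)^2 + 2 * X^3) := by
    rintro ⟨d, n⟩ hq
    simp only [hI, Finset.mem_filter, Finset.mem_product, Nat.mem_divisors] at hq
    obtain ⟨⟨⟨hdm, -⟩, hnm, -⟩, hdn, hle⟩ := hq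
    have hd : 0 < d := Nat.pos_of_dvd_of_pos hdm (Nat.pos_of_ne_zero hm0)
    have hn : 0 < n := Nat.pos_of_dvd_of_pos hnm (Nat.pos_of_ne_zero hm0)
    have hd1 : (1:ℝ) ≤ d := by exact_mod_cast hd
    have hn1 : (1:ℝ) ≤ n := by exact_mod_cast hn
    have hmp : (0:ℝ) < m := by exact_mod_cast Nat.pos_of_ne_zero hm0
    have key := fiber_small α β d n hd (hm.squarefree_of_dvd hnm) hdn (X^3) (X^4) (by positivity)
      (by positivity) (G (d,n)) (by
        intro x hx
        simp only [G, Finset.mem_filter] at hx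
        obtain ⟨h1, h2, h3, h4⟩ := hT x hx.1
        exact ⟨h1, h2, h3, hx.2.1, hx.2.2.1, hx.2.2.2,
          (pow_dvd_pow_of_dvd (Int.natCast_dvd_natCast.mpr hnm) 2).trans h4⟩)
    refine key.trans ?_
    have hom : (3:ℝ) ^ n.primeFactors.card ≤ 3 ^ m.primeFactors.card :=
      pow_le_pow_right₀ (by norm_num) (Finset.card_le_card (Nat.primeFactors_mono hnm hm0))
    have hle' : (m:ℝ) ≤ K * (d*n) := by exact_mod_cast hle
    have e1 : 4 * X^7 / ((d:ℝ)*n)^2 ≤ 4 * (K:ℝ)^2 * X^7 / (m:ℝ)^2 := by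
      rw [div_le_div_iff₀ (by positivity) (by positivity)]
      have : (m:ℝ)^2 ≤ (K * (d*n))^2 := by gcongr
      calc 4 * X^7 * (m:ℝ)^2 ≤ 4 * X^7 * (K * (d*n))^2 := by gcongr
        _ = _ := by ring
    have e2 : 2 * X^3 / d ≤ 2 * X^3 := div_le_self (by positivity) hd1
    calc 2 * X ^ 3 / d * (3 ^ n.primeFactors.card * (2 * (X ^ 4 / d) / (n:ℝ) ^ 2 + 1))
        = 3 ^ n.primeFactors.card * (4 * X^7 / ((d:ℝ)*n)^2 + 2 * X^3 / d) := by
          field_simp; ring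
      _ ≤ _ := by gcongr
  have hdc : ((m.divisors.card : ℕ) : ℝ) ≤ 2 ^ m.primeFactors.card := by
    have := sqfree_card m.divisors m hm0 (fun k hk => ⟨hm.squarefree_of_dvd (Nat.dvd_of_mem_divisors hk),
      Nat.dvd_of_mem_divisors hk⟩)
    exact_mod_cast this
  have hIc : (I.card : ℝ) ≤ 4 ^ m.primeFactors.card := by
    have h1 : I.card ≤ m.divisors.card * m.divisors.card := by
      rw [← Finset.card_product]; exact Finset.card_filter_le _ _
    calc (I.card:ℝ) ≤ m.divisors.card * m.divisors.card := by exact_mod_cast h1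
      _ ≤ 2 ^ m.primeFactors.card * 2 ^ m.primeFactors.card := by gcongr
      _ = _ := by rw [← mul_pow]; norm_num
  calc (T.card:ℝ) ≤ ((I.biUnion G).card : ℝ) := by exact_mod_cast Finset.card_le_card hsub
    _ ≤ ∑ q ∈ I, ((G q).card : ℝ) := by exact_mod_cast Finset.card_biUnion_le
    _ ≤ ∑ q ∈ I, 3 ^ m.primeFactors.card * (4 * (K:ℝ)^2 * X^7 / (m:ℝ)^2 + 2 * X^3) :=
        Finset.sum_le_sum hG
    _ = I.card * (3 ^ m.primeFactors.card * (4 * (K:ℝ)^2 * X^7 / (m:ℝ)^2 + 2 * X^3)) := by simp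
    _ ≤ 4 ^ m.primeFactors.card * (3 ^ m.primeFactors.card * (4 * (K:ℝ)^2 * X^7 / (m:ℝ)^2 + 2 * X^3)) := by
        gcongr
    _ = _ := by rw [← mul_assoc, ← mul_pow]; norm_num

/-- Pairs with a large common divisor. -/
lemma gcd_card (T : Finset (ℤ × ℤ)) (X D : ℝ) (hX : 1 ≤ X) (hD : 0 < D)
    (hT : ∀ x ∈ T, x.1 ≠ 0 ∧ |(x.1:ℝ)| ≤ X^3 ∧ |(x.2:ℝ)| ≤ X^4 ∧
      ∃ d : ℕ, D ≤ d ∧ (d:ℤ) ∣ x.1 ∧ (d:ℤ) ∣ x.2) :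
    (T.card : ℝ) ≤ 6 * X^7 * D^(-(1/2):ℝ) * ∑' n : ℕ, (n:ℝ)^(-(3/2):ℝ) := by
  classical
  have hsum : Summable (fun n : ℕ => (n:ℝ)^(-(3/2):ℝ)) := Real.summable_nat_rpow.mpr (by norm_num)
  set I := (Finset.Icc 1 ⌊X^3⌋₊).filter (fun d : ℕ => D ≤ d) with hI
  let G : ℕ → Finset (ℤ × ℤ) := fun d => T.filter (fun x => (d:ℤ) ∣ x.1 ∧ (d:ℤ) ∣ x.2)
  have hsub : T ⊆ I.biUnion G := by
    intro x hx
    obtain ⟨h0, h1, h2, d, h3, h4, h5⟩ := hT x hx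
    rw [Finset.mem_biUnion]
    refine ⟨d, ?_, by simp [G, hx, h4, h5]⟩
    simp only [hI, Finset.mem_filter, Finset.mem_Icc]
    have hd : 0 < d := by exact_mod_cast hD.trans_le h3
    refine ⟨⟨hd, Nat.le_floor ?_⟩, h3⟩
    have := Int.le_of_dvd (abs_pos.mpr h0) ((dvd_abs _ _).mpr h4)
    have : (d:ℝ) ≤ |(x.1:ℝ)| := by exact_mod_cast this
    linarith
  have hG : ∀ d ∈ I, ((G d).card : ℝ) ≤ 6 * X^7 * D^(-(1/2):ℝ) * (d:ℝ)^(-(3/2):ℝ) := by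
    intro d hdI
    simp only [hI, Finset.mem_filter, Finset.mem_Icc] at hdI
    obtain ⟨⟨hd1, hd2⟩, hd3⟩ := hdI
    have hd' : (1:ℝ) ≤ d := by exact_mod_cast hd1
    have hd0 : (0:ℝ) < d := by linarith
    have hdX : (d:ℝ) ≤ X^3 := (Nat.le_floor_iff (by positivity)).mp hd2
    have hdX4 : (d:ℝ) ≤ X^4 := hdX.trans (pow_le_pow_right₀ hX (by norm_num))
    have : ((G d).card : ℝ) ≤ (2 * X^3 / d) * (2 * X^4 / d + 1) := by
      apply pair_card _ _ _ (by positivity)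
      · apply mult_card _ _ hd1 _ (by positivity)
        intro a ha
        obtain ⟨x, hx, rfl⟩ := Finset.mem_image.mp ha
        simp only [G, Finset.mem_filter] at hx
        exact ⟨(hT x hx.1).1, (hT x hx.1).2.1, hx.2.1⟩
      · intro a
        have hm : ∀ b ∈ ((G d).filter (fun x => x.1 = a)).image Prod.snd, |(b:ℝ)| ≤ X^4 ∧ (d:ℤ) ∣ b := by
          intro b hb
          obtain ⟨x, hx, rfl⟩ := Finset.mem_image.mp hb
          simp only [G, Finset.mem_filter] at hx
          exact ⟨(hT x hx.1.1).2.2.1, hx.1.2.2⟩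
        have := fiber_card _ d hd1 (X^4) (fun b hb => (hm b hb).1)
          (fun b hb b' hb' => dvd_sub (hm b hb).2 (hm b' hb').2)
        have h2 : (⌊2 * X^4 / (d:ℝ)⌋₊ : ℝ) ≤ 2 * X^4 / d := Nat.floor_le (by positivity)
        calc _ ≤ ((⌊2 * X^4 / (d:ℝ)⌋₊ + 1 : ℕ) : ℝ) := by exact_mod_cast this
          _ ≤ _ := by push_cast; linarith
    refine this.trans ?_
    have e1 : 1 ≤ X^4 / d := (one_le_div hd0).mpr hdX4
    have e2 : (d:ℝ)^(-2:ℝ) ≤ D^(-(1/2):ℝ) * (d:ℝ)^(-(3/2):ℝ) := by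
      rw [show (-2:ℝ) = -(1/2) + -(3/2) by norm_num, Real.rpow_add hd0]
      exact mul_le_mul_of_nonneg_right (Real.rpow_le_rpow_of_nonpos hD hd3 (by norm_num)) (by positivity)
    have e3 : (d:ℝ)^(-2:ℝ) = 1 / (d:ℝ)^2 := by
      rw [Real.rpow_neg hd0.le]; norm_num
    calc (2 * X^3 / d) * (2 * X^4 / d + 1) ≤ (2 * X^3 / d) * (3 * (X^4 / d)) := by
          gcongr; rw [mul_div_assoc]; linarith
      _ = 6 * X^7 * (d:ℝ)^(-2:ℝ) := by rw [e3]; field_simp; ring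
      _ ≤ 6 * X^7 * (D^(-(1/2):ℝ) * (d:ℝ)^(-(3/2):ℝ)) := by gcongr
      _ = _ := by ring
  calc (T.card:ℝ) ≤ ((I.biUnion G).card : ℝ) := by exact_mod_cast Finset.card_le_card hsub
    _ ≤ ∑ q ∈ I, ((G q).card : ℝ) := by exact_mod_cast Finset.card_biUnion_le
    _ ≤ ∑ d ∈ I, 6 * X^7 * D^(-(1/2):ℝ) * (d:ℝ)^(-(3/2):ℝ) := Finset.sum_le_sum hG
    _ = 6 * X^7 * D^(-(1/2):ℝ) * ∑ d ∈ I, (d:ℝ)^(-(3/2):ℝ) := by rw [Finset.mul_sum]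
    _ ≤ _ := by
        refine mul_le_mul_of_nonneg_left ?_ (by positivity)
        exact hsum.sum_le_tsum _ (fun i _ => by positivity)


lemma swap_lemma (α β : ℤ) (hα : α ≠ 0) : ∃ C : ℝ, 0 < C ∧ ∀ X : ℝ, 1 ≤ X →
    ∀ E : Finset (ℤ × ℤ), (∀ x ∈ E, |(x.1:ℝ)| ≤ X^3 ∧ |(x.2:ℝ)| ≤ X^4 ∧
      β * x.1^4 + α * x.2^3 ≠ 0) → ∀ S : Finset ℕ, (∀ m ∈ S, Squarefree m) →
    ∑ m ∈ S, ((E.filter (fun x => (m:ℤ)^2 ∣ β * x.1^4 + α * x.2^3)).card : ℝ)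
      ≤ C * X^(0.01:ℝ) * E.card := by
  obtain ⟨C0, hC0, hom⟩ := omega_bound 2 (0.01/12) (by norm_num) (by norm_num)
  set L : ℝ := |(α:ℝ)| + |(β:ℝ)| with hL
  have hL0 : 0 < L := by
    have : 0 < |(α:ℝ)| := abs_pos.mpr (by exact_mod_cast hα)
    positivity
  refine ⟨C0 * L^(0.01/12:ℝ), by positivity, ?_⟩
  intro X hX E hE S hS
  have hX0 : 0 < X := by linarith
  have e1 : ∑ m ∈ S, ((E.filter (fun x => (m:ℤ)^2 ∣ β * x.1^4 + α * x.2^3)).card : ℝ)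
      = ∑ x ∈ E, ((S.filter (fun m : ℕ => (m:ℤ)^2 ∣ β * x.1^4 + α * x.2^3)).card : ℝ) := by
    simp only [Finset.card_filter, Nat.cast_sum]
    exact Finset.sum_comm
  rw [e1]
  calc _ ≤ ∑ x ∈ E, C0 * L^(0.01/12:ℝ) * X^(0.01:ℝ) := by
        refine Finset.sum_le_sum fun x hx => ?_
        obtain ⟨h1, h2, h3⟩ := hE x hx
        set F := β * x.1^4 + α * x.2^3 with hF
        have hF0 : F.natAbs ≠ 0 := Int.natAbs_ne_zero.mpr h3
        have hc := sqfree_card (S.filter (fun m : ℕ => (m:ℤ)^2 ∣ F)) F.natAbs hF0 (by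
          intro m hm
          obtain ⟨hm1, hm2⟩ := Finset.mem_filter.mp hm
          refine ⟨hS m hm1, ?_⟩
          rw [← Int.natCast_dvd]
          exact (dvd_pow_self _ two_ne_zero).trans hm2)
        have hFb : ((F.natAbs : ℕ) : ℝ) ≤ L * X^12 := by
          rw [Nat.cast_natAbs, hF]
          push_cast
          calc |(β:ℝ) * x.1^4 + α * x.2^3| ≤ |(β:ℝ) * x.1^4| + |(α:ℝ) * x.2^3| := abs_add_le _ _
            _ = |(β:ℝ)| * |(x.1:ℝ)|^4 + |(α:ℝ)| * |(x.2:ℝ)|^3 := by simp [abs_mul, abs_pow]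
            _ ≤ |(β:ℝ)| * (X^3)^4 + |(α:ℝ)| * (X^4)^3 := by gcongr
            _ = L * X^12 := by rw [hL]; ring
        calc _ ≤ (2:ℝ) ^ F.natAbs.primeFactors.card := by exact_mod_cast hc
          _ ≤ C0 * ((F.natAbs:ℕ):ℝ)^(0.01/12:ℝ) := hom _ hF0
          _ ≤ C0 * (L * X^12)^(0.01/12:ℝ) := by gcongr
          _ = C0 * L^(0.01/12:ℝ) * X^(0.01:ℝ) := by
            rw [Real.mul_rpow hL0.le (by positivity), ← Real.rpow_natCast X 12, ← Real.rpow_mul hX0.le]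
            norm_num; ring
    _ = _ := by simp; ring

lemma int_card (U : Finset ℤ) (B : ℝ) (hB : 1 ≤ B) (h : ∀ b ∈ U, |(b:ℝ)| ≤ B) :
    (U.card : ℝ) ≤ 3 * B := by
  have := fiber_card U 1 one_pos B h (fun _ _ _ _ => by simp)
  have h2 : (⌊2 * B / ((1:ℕ):ℝ)⌋₊ : ℝ) ≤ 2 * B / ((1:ℕ):ℝ) := Nat.floor_le (by positivity)
  have h3 : (U.card : ℝ) ≤ ((⌊2 * B / ((1:ℕ):ℝ)⌋₊ + 1 : ℕ) : ℝ) := by exact_mod_cast this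
  push_cast at h2 h3
  linarith

lemma box_card (E : Finset (ℤ × ℤ)) (X A : ℝ) (hX : 1 ≤ X) (hA : 1 ≤ A)
    (hE : ∀ x ∈ E, |(x.1:ℝ)| ≤ A ∧ |(x.2:ℝ)| ≤ X^4) : (E.card : ℝ) ≤ (3 * A) * (3 * X^4) := by
  apply pair_card _ _ _ (by positivity)
  · apply int_card _ _ hA
    intro a ha
    obtain ⟨x, hx, rfl⟩ := Finset.mem_image.mp ha
    exact (hE x hx).1
  · intro a
    apply int_card _ _ (one_le_pow₀ hX)
    intro a ha
    obtain ⟨x, hx, rfl⟩ := Finset.mem_image.mp ha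
    exact (hE x (Finset.mem_filter.mp hx).1).2

lemma large_card (α β : ℤ) (hα : α ≠ 0) (hβ : β ≠ 0) : ∃ C : ℝ, 0 < C ∧ ∀ X : ℝ, 2 ≤ X →
    ∀ E : Finset (ℤ × ℤ), (∀ x ∈ E, x.1 ≠ 0 ∧ |(x.1:ℝ)| ≤ X^3 ∧ |(x.2:ℝ)| ≤ X^4 ∧
      ∃ m : ℕ, Squarefree m ∧ X^(3.9:ℝ) < m ∧ (m:ℤ)^2 ∣ β * x.1^4 + α * x.2^3) →
    (E.card : ℝ) ≤ C * X^(6.9:ℝ) := by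
  classical
  obtain ⟨C1, hC1, hmain⟩ := count_main α β hα hβ 0.05 (by norm_num)
  set K := (α*β).natAbs with hK
  have hK0 : 0 < K := Int.natAbs_pos.mpr (mul_ne_zero hα hβ)
  have hKr : (1:ℝ) ≤ K := by exact_mod_cast hK0
  set Z := ∑' n : ℕ, (n:ℝ)^(-(3/2):ℝ) with hZ
  have hZ0 : 0 ≤ Z := tsum_nonneg fun n => by positivity
  refine ⟨6 * Z + (C1 * ((2^10 * K)^(1.05:ℝ) + 32) + 9 * (16 * K)), by positivity, ?_⟩
  intro X hX E hE
  have hX1 : 1 ≤ X := by linarith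
  have hX0 : 0 < X := by linarith
  set Y : ℝ := X^(3.7:ℝ) / K with hY
  have hY0 : 0 < Y := by positivity
  let E1 := E.filter (fun x => ∃ d : ℕ, X^(0.2:ℝ) ≤ d ∧ (d:ℤ) ∣ x.1 ∧ (d:ℤ) ∣ x.2)
  let E2 := E.filter (fun x => ∃ n : ℕ, Y ≤ n ∧ IsCoprime (n:ℤ) (α*β*x.2) ∧
    (n:ℤ)^2 ∣ β * x.1^4 + α * x.2^3)
  have hsub : E ⊆ E1 ∪ E2 := by
    intro x hx
    obtain ⟨-, -, -, m, hm, hmX, hmd⟩ := hE x hx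
    obtain ⟨d, n, h1, h2, h3, h4, h5, h6, h7⟩ := decomp α β hα hβ m hm x.1 x.2 hmd
    rw [Finset.mem_union]
    by_cases hd : X^(0.2:ℝ) ≤ d
    · left; exact Finset.mem_filter.mpr ⟨hx, d, hd, h3, h4⟩
    · right
      refine Finset.mem_filter.mpr ⟨hx, n, ?_, h5,
        (pow_dvd_pow_of_dvd (Int.natCast_dvd_natCast.mpr h2) 2).trans hmd⟩
      push Not at hd
      have h7' : (m:ℝ) ≤ K * (d * n) := by exact_mod_cast h7
      rw [hY, div_le_iff₀ (by linarith)]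
      have e1 : X^(3.9:ℝ) = X^(0.2:ℝ) * X^(3.7:ℝ) := by
        rw [← Real.rpow_add hX0]; norm_num
      have e2 : X^(0.2:ℝ) * X^(3.7:ℝ) ≤ X^(0.2:ℝ) * (n * K) := by
        calc X^(0.2:ℝ) * X^(3.7:ℝ) ≤ K * (d * n) := by rw [← e1]; linarith
          _ = d * (n * K) := by ring
          _ ≤ X^(0.2:ℝ) * (n * K) := by gcongr
      exact le_of_mul_le_mul_left e2 (by positivity)
  have hE1 : (E1.card : ℝ) ≤ 6 * Z * X^(6.9:ℝ) := by
    have := gcd_card E1 X (X^(0.2:ℝ)) hX1 (by positivity) (by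
      intro x hx
      obtain ⟨h1, h2⟩ := Finset.mem_filter.mp hx
      obtain ⟨a1, a2, a3, -⟩ := hE x h1
      exact ⟨a1, a2, a3, h2⟩)
    refine this.trans (le_of_eq ?_)
    rw [← Real.rpow_mul hX0.le, ← Real.rpow_natCast X 7]
    have : X^(6.9:ℝ) = X^((7:ℕ):ℝ) * X^((0.2:ℝ) * -(1/2)) := by
      rw [← Real.rpow_add hX0]; norm_num
    rw [this]; ring
  have hE2 : (E2.card : ℝ) ≤ (C1 * ((2^10 * K)^(1.05:ℝ) + 32) + 9 * (16 * K)) * X^(6.9:ℝ) := by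
    set X' := ⌈X⌉₊ with hX'
    have hXX : X ≤ X' := Nat.le_ceil X
    have hX2 : (X':ℝ) ≤ 2 * X := by
      have := Nat.ceil_lt_add_one hX0.le
      linarith
    by_cases hc : 4 * (X':ℝ)^2 ≤ Y
    · have h1 := hmain X' Y (by exact_mod_cast hX1.trans hXX) hc E2 (by
        intro x hx
        obtain ⟨h1, h2⟩ := Finset.mem_filter.mp hx
        obtain ⟨a1, a2, a3, -⟩ := hE x h1
        refine ⟨a1, ?_, ?_, h2⟩
        · have : |(x.1:ℝ)| ≤ (X':ℝ)^3 := a2.trans (by gcongr)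
          exact_mod_cast this
        · have : |(x.2:ℝ)| ≤ (X':ℝ)^4 := a3.trans (by gcongr)
          exact_mod_cast this)
      have h2 : (X':ℝ)^10 / Y ≤ (2^10 * K) * X^(6.3:ℝ) := by
        rw [div_le_iff₀ hY0, hY]
        calc (X':ℝ)^10 ≤ (2*X)^10 := by gcongr
          _ = 2^10 * (X^(6.3:ℝ) * X^(3.7:ℝ)) := by
            rw [← Real.rpow_add hX0, mul_pow, ← Real.rpow_natCast X 10]; norm_num
          _ = _ := by field_simp
      have h3 : ((X':ℝ)^10 / Y)^(1+0.05:ℝ) ≤ (2^10 * K)^(1.05:ℝ) * X^(6.9:ℝ) := by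
        calc ((X':ℝ)^10 / Y)^(1+0.05:ℝ) ≤ ((2^10 * K) * X^(6.3:ℝ))^(1+0.05:ℝ) := by gcongr
          _ = (2^10 * K)^(1.05:ℝ) * X^(6.3*1.05:ℝ) := by
            rw [Real.mul_rpow (by positivity) (by positivity), ← Real.rpow_mul hX0.le]; norm_num
          _ ≤ _ := by
            gcongr
            norm_num
      have h4 : (X':ℝ)^5 ≤ 32 * X^(6.9:ℝ) := by
        calc (X':ℝ)^5 ≤ (2*X)^5 := by gcongr
          _ = 32 * X^((5:ℕ):ℝ) := by rw [Real.rpow_natCast]; ring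
          _ ≤ _ := by
            gcongr
            norm_num
      calc (E2.card:ℝ) ≤ C1 * (((X':ℝ)^10 / Y)^(1+0.05:ℝ) + (X':ℝ)^5) := h1
        _ ≤ C1 * ((2^10 * K)^(1.05:ℝ) * X^(6.9:ℝ) + 32 * X^(6.9:ℝ)) := by gcongr
        _ = C1 * ((2^10 * K)^(1.05:ℝ) + 32) * X^(6.9:ℝ) := by ring
        _ ≤ _ := by gcongr; linarith
    · push Not at hc
      have h1 : X^(3.7:ℝ) < 16 * X^2 * K := by
        rw [hY, div_lt_iff₀ (by linarith)] at hc
        calc _ < _ := hc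
          _ ≤ 4 * (2*X)^2 * K := by gcongr
          _ = _ := by ring
      have h2 : X^3 ≤ X^(3.7:ℝ) := by
        rw [← Real.rpow_natCast]
        exact Real.rpow_le_rpow_of_exponent_le hX1 (by norm_num)
      have h3 : X ≤ 16 * K := by
        have : X^2 * X ≤ X^2 * (16 * K) := by nlinarith
        exact le_of_mul_le_mul_left this (by positivity)
      have h4 := box_card E2 X (X^3) hX1 (one_le_pow₀ hX1) (by
        intro x hx
        obtain ⟨a1, a2, a3, -⟩ := hE x (Finset.mem_filter.mp hx).1
        exact ⟨a2, a3⟩)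
      have h5 : X^6 ≤ X^(6.9:ℝ) := by
        rw [← Real.rpow_natCast]
        exact Real.rpow_le_rpow_of_exponent_le hX1 (by norm_num)
      calc (E2.card:ℝ) ≤ _ := h4
        _ = 9 * X * X^6 := by ring
        _ ≤ 9 * (16 * K) * X^(6.9:ℝ) := by gcongr
        _ ≤ _ := by
          gcongr
          have : 0 ≤ C1 * ((2^10 * (K:ℝ))^(1.05:ℝ) + 32) := by positivity
          linarith
  calc (E.card:ℝ) ≤ ((E1 ∪ E2).card : ℝ) := by exact_mod_cast Finset.card_le_card hsub
    _ ≤ E1.card + E2.card := by exact_mod_cast Finset.card_union_le _ _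
    _ ≤ _ := by rw [add_mul]; exact add_le_add hE1 hE2

lemma small_range_sum (α β : ℤ) (hα : α ≠ 0) (hβ : β ≠ 0) : ∃ C : ℝ, 0 < C ∧ ∀ M X : ℝ, 0 < M → 1 ≤ X →
    ∀ E : Finset (ℤ × ℤ), (∀ x ∈ E, x.1 ≠ 0 ∧ |(x.1:ℝ)| ≤ X^3 ∧ |(x.2:ℝ)| ≤ X^4) →
    ∀ S : Finset ℕ, (∀ m ∈ S, Squarefree m ∧ M < m ∧ (m:ℝ) ≤ X^(3.9:ℝ)) →
    ∑ m ∈ S, ((E.filter (fun x => (m:ℤ)^2 ∣ β * x.1^4 + α * x.2^3)).card : ℝ)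
      ≤ C * (X^7 / Real.sqrt M + X^(6.95:ℝ)) := by
  obtain ⟨C1, hC1, hom⟩ := omega_bound 12 0.01 (by norm_num) (by norm_num)
  set K := (α*β).natAbs with hK
  set Z := ∑' n : ℕ, (n:ℝ)^(-1.49:ℝ) with hZ
  have hsum : Summable (fun n : ℕ => (n:ℝ)^(-1.49:ℝ)) := Real.summable_nat_rpow.mpr (by norm_num)
  have hZ0 : 0 ≤ Z := tsum_nonneg fun n => by positivity
  refine ⟨4 * C1 * K^2 * Z + 2 * C1, by positivity, ?_⟩
  intro M X hM hX E hE S hS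
  have hX0 : 0 < X := by linarith
  have hterm : ∀ m ∈ S, ((E.filter (fun x => (m:ℤ)^2 ∣ β * x.1^4 + α * x.2^3)).card : ℝ)
      ≤ 4 * C1 * K^2 * (X^7 / Real.sqrt M) * (m:ℝ)^(-1.49:ℝ) + 2 * C1 * X^(3.04:ℝ) := by
    intro m hm
    obtain ⟨h1, h2, h3⟩ := hS m hm
    have hm0 : (0:ℝ) < m := hM.trans h2
    have h4 := small_m α β hα hβ m h1 X hX (E.filter (fun x => (m:ℤ)^2 ∣ β * x.1^4 + α * x.2^3)) (by
      intro x hx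
      obtain ⟨b1, b2⟩ := Finset.mem_filter.mp hx
      obtain ⟨a1, a2, a3⟩ := hE x b1
      exact ⟨a1, a2, a3, b2⟩)
    have h5 := hom m h1.ne_zero
    have h6 : (m:ℝ)^(0.01:ℝ) / (m:ℝ)^2 ≤ (m:ℝ)^(-1.49:ℝ) / Real.sqrt M := by
      rw [div_le_div_iff₀ (by positivity) (Real.sqrt_pos.mpr hM)]
      have : Real.sqrt M ≤ (m:ℝ)^(0.5:ℝ) := by
        rw [Real.sqrt_eq_rpow, show (0.5:ℝ) = 1/2 by norm_num]
        gcongr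
      calc (m:ℝ)^(0.01:ℝ) * Real.sqrt M ≤ (m:ℝ)^(0.01:ℝ) * (m:ℝ)^(0.5:ℝ) := by gcongr
        _ = (m:ℝ)^(-1.49:ℝ) * (m:ℝ)^((2:ℕ):ℝ) := by
          rw [← Real.rpow_add hm0, ← Real.rpow_add hm0]; norm_num
        _ = _ := by rw [Real.rpow_natCast]
    have h7 : (m:ℝ)^(0.01:ℝ) * X^3 ≤ X^(3.04:ℝ) := by
      calc (m:ℝ)^(0.01:ℝ) * X^3 ≤ (X^(3.9:ℝ))^(0.01:ℝ) * X^((3:ℕ):ℝ) := by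
            rw [Real.rpow_natCast]; gcongr
        _ = X^(3.039:ℝ) := by
            rw [← Real.rpow_mul hX0.le, ← Real.rpow_add hX0]; norm_num
        _ ≤ _ := Real.rpow_le_rpow_of_exponent_le hX (by norm_num)
    calc _ ≤ _ := h4
      _ ≤ C1 * (m:ℝ)^(0.01:ℝ) * (4 * (K:ℝ)^2 * X^7 / (m:ℝ)^2 + 2 * X^3) := by gcongr
      _ = 4 * C1 * K^2 * X^7 * ((m:ℝ)^(0.01:ℝ) / (m:ℝ)^2) + 2 * C1 * ((m:ℝ)^(0.01:ℝ) * X^3) := by ring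
      _ ≤ 4 * C1 * K^2 * X^7 * ((m:ℝ)^(-1.49:ℝ) / Real.sqrt M) + 2 * C1 * X^(3.04:ℝ) := by gcongr
      _ = _ := by ring
  have hScard : (S.card : ℝ) ≤ X^(3.9:ℝ) := by
    have : S ⊆ Finset.Icc 1 ⌊X^(3.9:ℝ)⌋₊ := by
      intro m hm
      obtain ⟨h1, h2, h3⟩ := hS m hm
      exact Finset.mem_Icc.mpr ⟨Nat.pos_of_ne_zero h1.ne_zero, Nat.le_floor h3⟩
    have h2 := Finset.card_le_card this
    simp only [Nat.card_Icc, Nat.add_sub_cancel] at h2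
    exact (Nat.cast_le.mpr h2).trans (Nat.floor_le (by positivity))
  calc _ ≤ ∑ m ∈ S, (4 * C1 * K^2 * (X^7 / Real.sqrt M) * (m:ℝ)^(-1.49:ℝ) + 2 * C1 * X^(3.04:ℝ)) :=
        Finset.sum_le_sum hterm
    _ = 4 * C1 * K^2 * (X^7 / Real.sqrt M) * (∑ m ∈ S, (m:ℝ)^(-1.49:ℝ)) +
        2 * C1 * (S.card * X^(3.04:ℝ)) := by
        rw [Finset.sum_add_distrib, ← Finset.mul_sum]; simp; ring
    _ ≤ 4 * C1 * K^2 * (X^7 / Real.sqrt M) * Z + 2 * C1 * (X^(3.9:ℝ) * X^(3.04:ℝ)) := by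
        gcongr
        exact hsum.sum_le_tsum _ (fun i _ => by positivity)
    _ ≤ 4 * C1 * K^2 * (X^7 / Real.sqrt M) * Z + 2 * C1 * X^(6.95:ℝ) := by
        gcongr
        rw [← Real.rpow_add hX0]
        exact Real.rpow_le_rpow_of_exponent_le hX (by norm_num)
    _ ≤ _ := by
        have a1 : 0 ≤ X^7 / Real.sqrt M := by positivity
        have a2 : 0 ≤ X^(6.95:ℝ) := by positivity
        have a3 : 0 ≤ 4 * C1 * K^2 * Z := by positivity
        have a4 : 0 ≤ 2 * C1 := by positivity
        nlinarith [mul_nonneg a3 a2, mul_nonneg a4 a1]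

/-- **Tail estimate** (Theorem 1.3). For nonzero integers α, β with squarefree gcd,
the sum over squarefree m > M of the number of pairs (a,b) with |a| ≤ X³, |b| ≤ X⁴,
βa⁴+αb³ ≠ 0 and m² ∣ βa⁴+αb³ is O_ε(X^{7+ε}/√M + X^{6.992+ε}).
(The sum is expressed via arbitrary finite partial sums.) -/
theorem stmt_2 (α β : ℤ) (hα : α ≠ 0) (hβ : β ≠ 0)
    (hgcd : Squarefree (Int.gcd α β)) :
    ∀ ε : ℝ, 0 < ε → ∃ Cε : ℝ, 0 < Cε ∧ ∀ M X : ℝ, 0 < M → 2 ≤ X →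
      ∀ S : Finset ℕ, (∀ m ∈ S, Squarefree m ∧ M < (m : ℝ)) →
        ∑ m ∈ S, (({p : ℤ × ℤ | (|p.1| : ℝ) ≤ X ^ 3 ∧ (|p.2| : ℝ) ≤ X ^ 4 ∧
            β * p.1 ^ 4 + α * p.2 ^ 3 ≠ 0 ∧
            ((m : ℤ) ^ 2 ∣ β * p.1 ^ 4 + α * p.2 ^ 3)}.ncard : ℝ))
          ≤ Cε * (X ^ ((7 : ℝ) + ε) / Real.sqrt M + X ^ ((6.992 : ℝ) + ε)) := by
  classical
  intro ε hε
  obtain ⟨C1, hC1, hswap⟩ := swap_lemma α β hα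
  obtain ⟨C2, hC2, hlarge⟩ := large_card α β hα hβ
  obtain ⟨C3, hC3, hsmall⟩ := small_range_sum α β hα hβ
  refine ⟨C1 * 9 + C1 * C2 + C3, by positivity, ?_⟩
  intro M X hM hX S hS
  have hX1 : 1 ≤ X := by linarith
  have hX0 : 0 < X := by linarith
  set E : Finset (ℤ × ℤ) :=
    ((Finset.Icc (-(⌊X^3⌋₊:ℤ)) ⌊X^3⌋₊) ×ˢ (Finset.Icc (-(⌊X^4⌋₊:ℤ)) ⌊X^4⌋₊)).filter
      (fun x => |(x.1:ℝ)| ≤ X^3 ∧ |(x.2:ℝ)| ≤ X^4 ∧ β * x.1^4 + α * x.2^3 ≠ 0) with hE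
  have hbox : ∀ (a : ℤ) (R : ℝ), |(a:ℝ)| ≤ R → a ∈ Finset.Icc (-(⌊R⌋₊:ℤ)) ⌊R⌋₊ := by
    intro a R h
    have h1 : a.natAbs ≤ ⌊R⌋₊ := Nat.le_floor (by rw [Nat.cast_natAbs]; push_cast; exact h)
    have h2 : |a| ≤ (⌊R⌋₊:ℤ) := by rw [Int.abs_eq_natAbs]; exact_mod_cast h1
    rw [Finset.mem_Icc]
    exact abs_le.mp h2
  have hmem : ∀ x ∈ E, |(x.1:ℝ)| ≤ X^3 ∧ |(x.2:ℝ)| ≤ X^4 ∧ β * x.1^4 + α * x.2^3 ≠ 0 :=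
    fun x hx => (Finset.mem_filter.mp hx).2
  have hset : ∀ m : ℕ, ({p : ℤ × ℤ | (|p.1| : ℝ) ≤ X ^ 3 ∧ (|p.2| : ℝ) ≤ X ^ 4 ∧
            β * p.1 ^ 4 + α * p.2 ^ 3 ≠ 0 ∧
            ((m : ℤ) ^ 2 ∣ β * p.1 ^ 4 + α * p.2 ^ 3)}.ncard : ℝ) =
      ((E.filter (fun x => (m:ℤ)^2 ∣ β * x.1^4 + α * x.2^3)).card : ℝ) := by
    intro m
    rw [← Set.ncard_coe_finset]
    congr 2
    ext x
    simp only [Set.mem_ofPred_eq, Finset.mem_coe, Finset.mem_filter, hE, Finset.mem_product]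
    constructor
    · rintro ⟨h1, h2, h3, h4⟩
      exact ⟨⟨⟨hbox _ _ h1, hbox _ _ h2⟩, h1, h2, h3⟩, h4⟩
    · rintro ⟨⟨-, h1, h2, h3⟩, h4⟩
      exact ⟨h1, h2, h3, h4⟩
  set E0 := E.filter (fun x => x.1 = 0) with hE0
  set E1 := E.filter (fun x => x.1 ≠ 0) with hE1
  set S1 := S.filter (fun m : ℕ => (m:ℝ) ≤ X^(3.9:ℝ)) with hS1
  set S2 := S.filter (fun m : ℕ => ¬ (m:ℝ) ≤ X^(3.9:ℝ)) with hS2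
  set E2 := E1.filter (fun x => ∃ m : ℕ, Squarefree m ∧ X^(3.9:ℝ) < m ∧
    (m:ℤ)^2 ∣ β * x.1^4 + α * x.2^3) with hE2
  have hsplit : ∀ m : ℕ, ((E.filter (fun x => (m:ℤ)^2 ∣ β * x.1^4 + α * x.2^3)).card : ℝ) =
      ((E0.filter (fun x => (m:ℤ)^2 ∣ β * x.1^4 + α * x.2^3)).card : ℝ) +
      ((E1.filter (fun x => (m:ℤ)^2 ∣ β * x.1^4 + α * x.2^3)).card : ℝ) := by
    intro m
    have f0 : E0.filter (fun x => (m:ℤ)^2 ∣ β * x.1^4 + α * x.2^3) =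
        (E.filter (fun x => (m:ℤ)^2 ∣ β * x.1^4 + α * x.2^3)).filter (fun x => x.1 = 0) := by
      ext x; simp only [hE0, Finset.mem_filter]; tauto
    have f1 : E1.filter (fun x => (m:ℤ)^2 ∣ β * x.1^4 + α * x.2^3) =
        (E.filter (fun x => (m:ℤ)^2 ∣ β * x.1^4 + α * x.2^3)).filter (fun x => ¬ x.1 = 0) := by
      ext x; simp only [hE1, Finset.mem_filter]; tauto
    rw [f0, f1]
    exact_mod_cast (Finset.card_filter_add_card_filter_not (fun x : ℤ × ℤ => x.1 = 0)).symm
  have b0 := hswap X hX1 E0 (fun x hx => hmem x (Finset.mem_filter.mp hx).1) S (fun m hm => (hS m hm).1)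
  have c0 := box_card E0 X 1 hX1 le_rfl (by
    intro x hx
    obtain ⟨h1, h2⟩ := Finset.mem_filter.mp hx
    rw [h2]
    exact ⟨by simp, (hmem x h1).2.1⟩)
  have b1 := hsmall M X hM hX1 E1 (by
    intro x hx
    obtain ⟨h1, h2⟩ := Finset.mem_filter.mp hx
    exact ⟨h2, (hmem x h1).1, (hmem x h1).2.1⟩) S1 (by
    intro m hm
    obtain ⟨h1, h2⟩ := Finset.mem_filter.mp hm
    exact ⟨(hS m h1).1, (hS m h1).2, h2⟩)
  have b2 := hswap X hX1 E2 (fun x hx =>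
    hmem x (Finset.mem_filter.mp (Finset.mem_filter.mp hx).1).1) S2
    (fun m hm => (hS m (Finset.mem_filter.mp hm).1).1)
  have c2 := hlarge X hX E2 (by
    intro x hx
    obtain ⟨h1, h2⟩ := Finset.mem_filter.mp hx
    obtain ⟨h3, h4⟩ := Finset.mem_filter.mp h1
    exact ⟨h4, (hmem x h3).1, (hmem x h3).2.1, h2⟩)
  have heq : ∑ m ∈ S2, ((E1.filter (fun x => (m:ℤ)^2 ∣ β * x.1^4 + α * x.2^3)).card : ℝ) ≤
      ∑ m ∈ S2, ((E2.filter (fun x => (m:ℤ)^2 ∣ β * x.1^4 + α * x.2^3)).card : ℝ) := by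
    refine Finset.sum_le_sum fun m hm => ?_
    obtain ⟨h1, h2⟩ := Finset.mem_filter.mp hm
    refine Nat.cast_le.mpr (Finset.card_le_card ?_)
    intro x hx
    obtain ⟨h3, h4⟩ := Finset.mem_filter.mp hx
    exact Finset.mem_filter.mpr ⟨Finset.mem_filter.mpr
      ⟨h3, m, (hS m h1).1, not_le.mp h2, h4⟩, h4⟩
  have p7 : X^7 ≤ X^(7+ε) := by
    rw [← Real.rpow_natCast]
    exact Real.rpow_le_rpow_of_exponent_le hX1 (by push_cast; linarith)
  set W := X^((6.992:ℝ)+ε) with hW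
  have p1 : X^(6.95:ℝ) ≤ W := Real.rpow_le_rpow_of_exponent_le hX1 (by norm_num; linarith)
  have p2 : X^(0.01:ℝ) * X^(6.9:ℝ) ≤ W := by
    rw [← Real.rpow_add hX0]
    exact Real.rpow_le_rpow_of_exponent_le hX1 (by norm_num; linarith)
  have p3 : X^(0.01:ℝ) * X^4 ≤ W := by
    rw [← Real.rpow_natCast X 4, ← Real.rpow_add hX0]
    exact Real.rpow_le_rpow_of_exponent_le hX1 (by norm_num; linarith)
  have hV : 0 ≤ X^(7+ε) / Real.sqrt M := by positivity
  have q0 : C1 * X^(0.01:ℝ) * E0.card ≤ C1 * 9 * W := by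
    calc C1 * X^(0.01:ℝ) * E0.card ≤ C1 * X^(0.01:ℝ) * (3 * 1 * (3 * X^4)) := by gcongr
      _ = C1 * 9 * (X^(0.01:ℝ) * X^4) := by ring
      _ ≤ _ := by gcongr
  have q2 : C1 * X^(0.01:ℝ) * E2.card ≤ C1 * C2 * W := by
    calc C1 * X^(0.01:ℝ) * E2.card ≤ C1 * X^(0.01:ℝ) * (C2 * X^(6.9:ℝ)) := by gcongr
      _ = C1 * C2 * (X^(0.01:ℝ) * X^(6.9:ℝ)) := by ring
      _ ≤ _ := by gcongr
  have q1 : C3 * (X^7 / Real.sqrt M + X^(6.95:ℝ)) ≤ C3 * (X^(7+ε) / Real.sqrt M + W) := by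
    gcongr
  simp_rw [hset, hsplit]
  rw [Finset.sum_add_distrib]
  have hs := Finset.sum_filter_add_sum_filter_not S (fun m : ℕ => (m:ℝ) ≤ X^(3.9:ℝ))
    (fun m : ℕ => ((E1.filter (fun x => (m:ℤ)^2 ∣ β * x.1^4 + α * x.2^3)).card : ℝ))
  rw [← hs]
  have hr : 0 ≤ (C1 * 9 + C1 * C2) * (X^(7+ε) / Real.sqrt M) := by positivity
  calc _ ≤ C1 * 9 * W + (C3 * (X^(7+ε) / Real.sqrt M + W) + C1 * C2 * W) :=
        add_le_add (b0.trans q0) (add_le_add (b1.trans q1) (heq.trans (b2.trans q2)))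
    _ ≤ _ := by linarith
end

section
/- Let Δ(a,b) = 256b³ − 27a⁴. For a prime p and a pair (a,b) ∈ ℤ² with p² ∣ Δ(a,b), say that p² strongly divides Δ(a,b) if p² ∣ Δ(a',b') for all integers a' ≡ a (mod p) and b' ≡ b (mod p). For a squarefree positive integer m, let 𝒲_m^{(1)} be the set of pairs (a,b) ∈ ℤ² such that for every prime p ∣ m, p² divides Δ(a,b) and p² strongly divides Δ(a,b). Then there is an absolute constant C such that for all real M > 0 and all X ≥ 2, the number of pairs (a,b) with |a| < X³, |b| < X⁴ lying in 𝒲_m^{(1)} for some squarefree integer m > M is at most C·(X⁷/M + X⁴ log X). -/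
open scoped BigOperators

lemma aux_prime (a b : ℤ) (q : ℕ) (hq : q.Prime) (h2 : q ≠ 2) (h3 : q ≠ 3)
    (h : ∀ a' b' : ℤ, a' ≡ a [ZMOD q] → b' ≡ b [ZMOD q] →
      (q : ℤ) ^ 2 ∣ (256 * b' ^ 3 - 27 * a' ^ 4)) : (q : ℤ) ∣ a ∧ (q : ℤ) ∣ b := by
  have hqz : Prime (q : ℤ) := Nat.prime_iff_prime_int.mp hq
  have hq0 : (q : ℤ) ≠ 0 := hqz.ne_zero
  have n2 : ¬ (q : ℤ) ∣ 2 := by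
    intro hd
    exact h2 ((Nat.prime_dvd_prime_iff_eq hq Nat.prime_two).mp (by exact_mod_cast hd))
  have n3 : ¬ (q : ℤ) ∣ 3 := by
    intro hd
    exact h3 ((Nat.prime_dvd_prime_iff_eq hq Nat.prime_three).mp (by exact_mod_cast hd))
  have h0 := h a b rfl rfl
  have ha := h (a + q) b (by simp [Int.ModEq]) rfl
  have hb := h a (b + q) rfl (by simp [Int.ModEq])
  constructor
  · have h1 : (q : ℤ) * q ∣ q * (2 ^ 2 * 3 ^ 3 * a ^ 3) := by
      obtain ⟨c, hc⟩ := h0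
      obtain ⟨d, hd⟩ := ha
      refine ⟨c - d - 27 * (6 * a ^ 2 + 4 * a * q + q ^ 2), ?_⟩
      linear_combination hc - hd
    have h4 := (mul_dvd_mul_iff_left hq0).mp h1
    rcases hqz.dvd_or_dvd h4 with h5 | h5
    · rcases hqz.dvd_or_dvd h5 with h6 | h6
      · exact absurd (hqz.dvd_of_dvd_pow h6) n2
      · exact absurd (hqz.dvd_of_dvd_pow h6) n3
    · exact hqz.dvd_of_dvd_pow h5
  · have h1 : (q : ℤ) * q ∣ q * (2 ^ 8 * 3 * b ^ 2) := by
      obtain ⟨c, hc⟩ := h0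
      obtain ⟨d, hd⟩ := hb
      refine ⟨d - c - 256 * (3 * b + q), ?_⟩
      linear_combination hd - hc
    have h4 := (mul_dvd_mul_iff_left hq0).mp h1
    rcases hqz.dvd_or_dvd h4 with h5 | h5
    · rcases hqz.dvd_or_dvd h5 with h6 | h6
      · exact absurd (hqz.dvd_of_dvd_pow h6) n2
      · exact absurd h6 n3
    · exact hqz.dvd_of_dvd_pow h5

lemma aux_sqf (n : ℕ) (hn : Squarefree n) (a : ℤ)
    (h : ∀ q : ℕ, q.Prime → q ∣ n → (q : ℤ) ∣ a) : (n : ℤ) ∣ a := by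
  rw [Int.natCast_dvd, ← Nat.prod_primeFactors_of_squarefree hn]
  apply Finset.prod_primes_dvd
  · intro p hp
    exact (Nat.prime_of_mem_primeFactors hp).prime
  · intro p hp
    exact Int.natCast_dvd.mp (h p (Nat.prime_of_mem_primeFactors hp)
      (Nat.dvd_of_mem_primeFactors hp))

lemma aux_m (m : ℕ) (hm : Squarefree m) (a b : ℤ)
    (h : ∀ q : ℕ, q.Prime → q ∣ m → ∀ a' b' : ℤ, a' ≡ a [ZMOD q] → b' ≡ b [ZMOD q] →
      (q : ℤ) ^ 2 ∣ (256 * b' ^ 3 - 27 * a' ^ 4)) :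
    ∃ n : ℕ, 0 < n ∧ m ≤ 6 * n ∧ (n : ℤ) ∣ a ∧ (n : ℤ) ∣ b := by
  obtain ⟨n, hn⟩ := Nat.gcd_dvd_left m 6
  have hm0 : 0 < m := Nat.pos_of_ne_zero hm.ne_zero
  have hn0 : 0 < n := by
    rcases Nat.eq_zero_or_pos n with h0 | h0
    · rw [h0] at hn; omega
    · exact h0
  have hnm : n ∣ m := ⟨Nat.gcd m 6, by rw [mul_comm]; exact hn⟩
  have hsq : Squarefree n := hm.squarefree_of_dvd hnm
  have key : ∀ q : ℕ, q.Prime → q ∣ n → ¬ q ∣ 6 := by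
    intro q hq hqn hq6
    have h1 : q ∣ Nat.gcd m 6 := Nat.dvd_gcd (hqn.trans hnm) hq6
    have h2 : q * q ∣ m := by rw [hn]; exact mul_dvd_mul h1 hqn
    exact hq.one_lt.ne' (Nat.isUnit_iff.mp (hm q h2))
  have key2 : ∀ q : ℕ, q.Prime → q ∣ n → (q : ℤ) ∣ a ∧ (q : ℤ) ∣ b := by
    intro q hq hqn
    have h6 := key q hq hqn
    refine aux_prime a b q hq ?_ ?_ (h q hq (hqn.trans hnm))
    · rintro rfl; exact h6 (by norm_num)
    · rintro rfl; exact h6 (by norm_num)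
  refine ⟨n, hn0, ?_, aux_sqf n hsq a fun q hq hqn => (key2 q hq hqn).1,
    aux_sqf n hsq b fun q hq hqn => (key2 q hq hqn).2⟩
  have : Nat.gcd m 6 ≤ 6 := Nat.le_of_dvd (by norm_num) (Nat.gcd_dvd_right m 6)
  calc m = Nat.gcd m 6 * n := hn
    _ ≤ 6 * n := Nat.mul_le_mul_right _ this

/-- Integers of absolute value at most `Y`. -/
noncomputable def auxI (Y : ℝ) : Finset ℤ := Finset.Icc (-(⌊Y⌋₊ : ℤ)) ⌊Y⌋₊

lemma mem_auxI (Y : ℝ) (a : ℤ) (h : |(a : ℝ)| ≤ Y) : a ∈ auxI Y := by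
  have h1 : a.natAbs ≤ ⌊Y⌋₊ := by
    apply Nat.le_floor
    rw [Nat.cast_natAbs]; push_cast; exact h
  rw [auxI, Finset.mem_Icc]; omega

lemma card_auxI (Y : ℝ) (hY : 0 ≤ Y) : ((auxI Y).card : ℝ) ≤ 2 * Y + 1 := by
  have h : (auxI Y).card = 2 * ⌊Y⌋₊ + 1 := by rw [auxI, Int.card_Icc]; omega
  rw [h]; push_cast
  linarith [Nat.floor_le hY]

lemma card_auxI_erase (Y : ℝ) (hY : 0 ≤ Y) : (((auxI Y).erase 0).card : ℝ) ≤ 2 * Y := by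
  have h : ((auxI Y).erase 0).card = 2 * ⌊Y⌋₊ := by
    rw [Finset.card_erase_of_mem (mem_auxI Y 0 (by simpa using hY)), auxI, Int.card_Icc]; omega
  rw [h]; push_cast
  linarith [Nat.floor_le hY]

lemma aux_quot (n : ℕ) (hn : 0 < n) (a : ℤ) (ha : a ≠ 0) (Y : ℝ) (hY : |(a : ℝ)| ≤ Y)
    (hd : (n : ℤ) ∣ a) : ∃ u ∈ (auxI (Y / n)).erase 0, a = n * u := by
  obtain ⟨u, rfl⟩ := hd
  refine ⟨u, Finset.mem_erase.mpr ⟨right_ne_zero_of_mul ha, mem_auxI _ _ ?_⟩, rfl⟩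
  have : (0 : ℝ) < n := by exact_mod_cast hn
  rw [le_div_iff₀ this]
  push_cast at hY
  rw [abs_mul, abs_of_pos this] at hY
  linarith

/-- **Theorem 1.4(a)**: the number of pairs (a,b) with H(a,b) < X lying in
𝒲_m^{(1)} (strong divisibility) for some squarefree m > M is O(X⁷/M + X⁴ log X). -/
theorem stmt_3 :
    ∃ C : ℝ, 0 < C ∧ ∀ M X : ℝ, 0 < M → 2 ≤ X →
      ({p : ℤ × ℤ | (|p.1| : ℝ) < X ^ 3 ∧ (|p.2| : ℝ) < X ^ 4 ∧
          ∃ m : ℕ, Squarefree m ∧ M < (m : ℝ) ∧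
            ∀ q : ℕ, q.Prime → q ∣ m →
              ((q : ℤ) ^ 2 ∣ (256 * p.2 ^ 3 - 27 * p.1 ^ 4) ∧
                ∀ a' b' : ℤ, a' ≡ p.1 [ZMOD q] → b' ≡ p.2 [ZMOD q] →
                  (q : ℤ) ^ 2 ∣ (256 * b' ^ 3 - 27 * a' ^ 4))}.ncard : ℝ)
        ≤ C * (X ^ 7 / M + X ^ 4 * Real.log X) := by
  classical
  refine ⟨48, by norm_num, ?_⟩
  intro M X hM hX
  set k := ⌊M / 6⌋₊ with hk
  set N := ⌈X ^ 3⌉₊ with hN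
  let F : ℕ → Finset (ℤ × ℤ) := fun n =>
    (((auxI (X ^ 3 / n)).erase 0) ×ˢ ((auxI (X ^ 4 / n)).erase 0)).image
      (fun w => ((n : ℤ) * w.1, (n : ℤ) * w.2))
  let A : Finset (ℤ × ℤ) := {0} ×ˢ auxI (X ^ 4)
  let B : Finset (ℤ × ℤ) := auxI (X ^ 3) ×ˢ {0}
  let D : Finset (ℤ × ℤ) := (Finset.Ioo k N).biUnion F
  have hX0 : (0 : ℝ) < X := by linarith
  have hA : (A.card : ℝ) ≤ 2 * X ^ 4 + 1 := by
    simp only [A, Finset.card_product, Finset.card_singleton, one_mul]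
    exact card_auxI _ (by positivity)
  have hB : (B.card : ℝ) ≤ 2 * X ^ 3 + 1 := by
    simp only [B, Finset.card_product, Finset.card_singleton, mul_one]
    exact card_auxI _ (by positivity)
  have hF : ∀ n : ℕ, ((F n).card : ℝ) ≤ 4 * X ^ 7 * ((n : ℝ) ^ 2)⁻¹ := by
    intro n
    have h1 : ((F n).card : ℝ) ≤
        (((auxI (X ^ 3 / n)).erase 0).card : ℝ) * ((auxI (X ^ 4 / n)).erase 0).card := by
      rw [← Nat.cast_mul, ← Finset.card_product]
      exact_mod_cast Finset.card_image_le
    refine h1.trans ?_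
    calc _ ≤ (2 * (X ^ 3 / n)) * (2 * (X ^ 4 / n)) :=
          mul_le_mul (card_auxI_erase _ (by positivity)) (card_auxI_erase _ (by positivity))
            (by positivity) (by positivity)
      _ = _ := by rw [div_eq_mul_inv, div_eq_mul_inv, ← inv_pow]; ring
  have hD : (D.card : ℝ) ≤ 48 * (X ^ 7 / M) := by
    have h1 : (D.card : ℝ) ≤ ∑ n ∈ Finset.Ioo k N, ((F n).card : ℝ) := by
      exact_mod_cast Finset.card_biUnion_le
    have h2 : ∑ n ∈ Finset.Ioo k N, ((F n).card : ℝ) ≤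
        4 * X ^ 7 * ∑ n ∈ Finset.Ioo k N, ((n : ℝ) ^ 2)⁻¹ := by
      rw [Finset.mul_sum]
      exact Finset.sum_le_sum fun n _ => hF n
    have h3 : ∑ n ∈ Finset.Ioo k N, ((n : ℝ) ^ 2)⁻¹ ≤ 2 / ((k : ℝ) + 1) :=
      sum_Ioo_inv_sq_le k N
    have h4 : (2 : ℝ) / ((k : ℝ) + 1) ≤ 12 / M := by
      have := Nat.lt_floor_add_one (M / 6)
      rw [div_le_div_iff₀ (by positivity) hM]
      linarith
    calc (D.card : ℝ) ≤ _ := h1.trans h2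
      _ ≤ 4 * X ^ 7 * (12 / M) := by
        gcongr
        exact h3.trans h4
      _ = _ := by ring
  have hsub : {p : ℤ × ℤ | (|p.1| : ℝ) < X ^ 3 ∧ (|p.2| : ℝ) < X ^ 4 ∧
          ∃ m : ℕ, Squarefree m ∧ M < (m : ℝ) ∧
            ∀ q : ℕ, q.Prime → q ∣ m →
              ((q : ℤ) ^ 2 ∣ (256 * p.2 ^ 3 - 27 * p.1 ^ 4) ∧
                ∀ a' b' : ℤ, a' ≡ p.1 [ZMOD q] → b' ≡ p.2 [ZMOD q] →
                  (q : ℤ) ^ 2 ∣ (256 * b' ^ 3 - 27 * a' ^ 4))} ⊆ ((A ∪ B ∪ D : Finset (ℤ × ℤ)) : Set (ℤ × ℤ)) := by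
    rintro ⟨a, b⟩ ⟨h1, h2, m, hm, hMm, h3⟩
    simp only at h1 h2 h3
    rw [Finset.mem_coe, Finset.mem_union, Finset.mem_union]
    by_cases ha : a = 0
    · left; left
      exact Finset.mem_product.mpr ⟨by simp [ha], mem_auxI _ _ h2.le⟩
    by_cases hb : b = 0
    · left; right
      exact Finset.mem_product.mpr ⟨mem_auxI _ _ h1.le, by simp [hb]⟩
    right
    obtain ⟨n, hn0, hmn, hna, hnb⟩ := aux_m m hm a b fun q hq hqm => (h3 q hq hqm).2
    obtain ⟨u, hu, hau⟩ := aux_quot n hn0 a ha _ h1.le hna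
    obtain ⟨v, hv, hbv⟩ := aux_quot n hn0 b hb _ h2.le hnb
    refine Finset.mem_biUnion.mpr ⟨n, Finset.mem_Ioo.mpr ⟨?_, ?_⟩, ?_⟩
    · rw [hk, Nat.floor_lt (by positivity)]
      have : (m : ℝ) ≤ 6 * n := by exact_mod_cast hmn
      linarith
    · rw [hN, Nat.lt_ceil]
      refine lt_of_le_of_lt ?_ h1
      have h5 : (n : ℤ) ≤ |a| := Int.le_of_dvd (abs_pos.mpr ha) ((dvd_abs _ _).mpr hna)
      exact_mod_cast h5
    · exact Finset.mem_image.mpr ⟨(u, v), Finset.mem_product.mpr ⟨hu, hv⟩, by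
        simp [← hau, ← hbv]⟩
  have hcard := Set.ncard_le_ncard hsub (Finset.finite_toSet _)
  rw [Set.ncard_coe_finset] at hcard
  have hc2 : (A ∪ B ∪ D).card ≤ A.card + B.card + D.card :=
    (Finset.card_union_le _ _).trans (Nat.add_le_add_right (Finset.card_union_le _ _) _)
  refine (Nat.cast_le.mpr (hcard.trans hc2)).trans ?_
  push_cast
  have hlog : (1 / 2 : ℝ) ≤ Real.log X := by
    have h1 := Real.log_two_gt_d9
    have h2 := Real.log_le_log (by norm_num) hX
    linarith
  have h34 : X ^ 3 ≤ X ^ 4 := pow_le_pow_right₀ (by linarith) (by norm_num)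
  have h14 : 1 ≤ X ^ 4 := one_le_pow₀ (by linarith)
  have h5 : X ^ 4 * (1 / 2) ≤ X ^ 4 * Real.log X := by gcongr
  linarith
end

section
/- Let Δ(a,b) = 256b³ − 27a⁴. For a prime p and a pair (a,b) ∈ ℤ² with p² ∣ Δ(a,b), say that p² weakly divides Δ(a,b) if there exist integers a' ≡ a (mod p) and b' ≡ b (mod p) with p² ∤ Δ(a',b'). For a squarefree positive integer m, let 𝒲_m^{(2)} be the set of pairs (a,b) ∈ ℤ² such that for every prime p ∣ m, p² divides Δ(a,b) and p² weakly divides Δ(a,b). Then for every ε > 0 there is a constant C_ε such that for all real M > 0 and all X ≥ 2, the number of pairs (a,b) with |a| < X³, |b| < X⁴ lying in 𝒲_m^{(2)} for some squarefree integer m > M is at most C_ε·(X^{6.992+ε} + X^{7+ε}/M). -/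
/-- weak divisibility of the discriminant by q ^ 2 -/
def Wk (q : ℕ) (a b : ℤ) : Prop :=
  (q : ℤ) ^ 2 ∣ (256 * b ^ 3 - 27 * a ^ 4) ∧
    ∃ a' b' : ℤ, a' ≡ a [ZMOD q] ∧ b' ≡ b [ZMOD q] ∧
      ¬ ((q : ℤ) ^ 2 ∣ (256 * b' ^ 3 - 27 * a' ^ 4))

lemma wk_basic {q : ℕ} (hq : q.Prime) {a b : ℤ} (h : Wk q a b) :
    q ≠ 2 ∧ q ≠ 3 ∧ ¬ (q : ℤ) ∣ a ∧ ¬ (q : ℤ) ∣ b := by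
  have hqi : Prime (q : ℤ) := Nat.prime_iff_prime_int.mp hq
  obtain ⟨h1, a', b', ha, hb, h2⟩ := h
  have hda : (q : ℤ) ∣ a → (q : ℤ) ∣ a' := fun h => by
    have := (Int.modEq_iff_dvd.mp ha)
    have h3 := dvd_sub h this
    simpa using h3
  have hdb : (q : ℤ) ∣ b → (q : ℤ) ∣ b' := fun h => by
    have := (Int.modEq_iff_dvd.mp hb)
    have h3 := dvd_sub h this
    simpa using h3
  have h1' : (q : ℤ) ∣ (256 * b ^ 3 - 27 * a ^ 4) := (dvd_pow_self _ two_ne_zero).trans h1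
  have hq2 : q ≠ 2 := by
    rintro rfl
    have e1 : ((2 : ℕ) : ℤ) ∣ 27 * a ^ 4 := by
      have : ((2 : ℕ) : ℤ) ∣ 256 * b ^ 3 := Dvd.dvd.mul_right (by norm_num) _
      have := dvd_sub this h1'
      simpa using this
    have e2 : ((2 : ℕ) : ℤ) ∣ a := by
      rcases hqi.dvd_or_dvd e1 with h | h
      · norm_num at h
      · exact hqi.dvd_of_dvd_pow h
    obtain ⟨k, hk⟩ := hda e2
    apply h2
    refine ⟨64 * b' ^ 3 - 27 * 4 * k ^ 4, ?_⟩
    rw [hk]; push_cast; ring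
  have hq3 : q ≠ 3 := by
    rintro rfl
    have e1 : ((3 : ℕ) : ℤ) ∣ 256 * b ^ 3 := by
      have : ((3 : ℕ) : ℤ) ∣ 27 * a ^ 4 := Dvd.dvd.mul_right (by norm_num) _
      have := dvd_add h1' this
      simpa using this
    have e2 : ((3 : ℕ) : ℤ) ∣ b := by
      rcases hqi.dvd_or_dvd e1 with h | h
      · norm_num at h
      · exact hqi.dvd_of_dvd_pow h
    obtain ⟨k, hk⟩ := hdb e2
    apply h2
    refine ⟨256 * 3 * k ^ 3 - 3 * a' ^ 4, ?_⟩
    rw [hk]; push_cast; ring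
  have n2 : ¬ (q : ℤ) ∣ 2 := by
    intro h
    have : q ∣ 2 := by exact_mod_cast h
    exact hq2 ((Nat.prime_dvd_prime_iff_eq hq Nat.prime_two).mp this)
  have n3 : ¬ (q : ℤ) ∣ 3 := by
    intro h
    have : q ∣ 3 := by exact_mod_cast h
    exact hq3 ((Nat.prime_dvd_prime_iff_eq hq Nat.prime_three).mp this)
  have hboth : ¬ ((q : ℤ) ∣ a ∧ (q : ℤ) ∣ b) := by
    rintro ⟨h3, h4⟩
    obtain ⟨k, hk⟩ := hda h3
    obtain ⟨l, hl⟩ := hdb h4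
    apply h2
    refine ⟨256 * q * l ^ 3 - 27 * q ^ 2 * k ^ 4, ?_⟩
    rw [hk, hl]; ring
  refine ⟨hq2, hq3, fun h => hboth ⟨h, ?_⟩, fun h => hboth ⟨?_, h⟩⟩
  · have e1 : (q : ℤ) ∣ 2 ^ 8 * b ^ 3 := by
      have := dvd_add h1' ((dvd_pow h (n := 4) (by norm_num)).mul_left 27)
      simpa using this
    rcases hqi.dvd_or_dvd e1 with h | h
    · exact absurd (hqi.dvd_of_dvd_pow h) n2
    · exact hqi.dvd_of_dvd_pow h
  · have e1 : (q : ℤ) ∣ 3 ^ 3 * a ^ 4 := by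
      have := dvd_sub ((dvd_pow h (n := 3) (by norm_num)).mul_left 256) h1'
      simpa using this
    rcases hqi.dvd_or_dvd e1 with h | h
    · exact absurd (hqi.dvd_of_dvd_pow h) n3
    · exact hqi.dvd_of_dvd_pow h

/-- The small divisor case: for fixed a and m, two b's which agree modulo m agree modulo m^2. -/
lemma modEq_sq {m : ℕ} (hm : Squarefree m) {a b c : ℤ}
    (hb : ∀ q : ℕ, q.Prime → q ∣ m → Wk q a b) (hc : ∀ q : ℕ, q.Prime → q ∣ m → Wk q a c)
    (h : ∀ q : ℕ, q.Prime → q ∣ m → (q : ℤ) ∣ b - c) : ((m ^ 2 : ℕ) : ℤ) ∣ b - c := by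
  have hm' : ∏ p ∈ m.primeFactors, p = m := Nat.prod_primeFactors_of_squarefree hm
  rw [← hm', ← Finset.prod_pow]
  push_cast
  apply Finset.prod_dvd_of_coprime
  · intro p hp q hq hpq
    have h1 := (Nat.coprime_primes (Nat.prime_of_mem_primeFactors hp)
      (Nat.prime_of_mem_primeFactors hq)).mpr hpq
    have := (Nat.isCoprime_iff_coprime.mpr h1)
    exact this.pow
  · intro q hq
    have hqp := Nat.prime_of_mem_primeFactors hq
    have hqm := Nat.dvd_of_mem_primeFactors hq
    have hqi : Prime (q : ℤ) := Nat.prime_iff_prime_int.mp hqp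
    obtain ⟨h2, h3, ha, hbb⟩ := wk_basic hqp (hb q hqp hqm)
    have d1 := (hb q hqp hqm).1
    have d2 := (hc q hqp hqm).1
    have d3 : (q : ℤ) ^ 2 ∣ (b - c) * (256 * (b ^ 2 + b * c + c ^ 2)) := by
      have := dvd_sub d1 d2
      rwa [show (256 * b ^ 3 - 27 * a ^ 4) - (256 * c ^ 3 - 27 * a ^ 4) =
        (b - c) * (256 * (b ^ 2 + b * c + c ^ 2)) by ring] at this
    have cop : IsCoprime ((q : ℤ) ^ 2) (256 * (b ^ 2 + b * c + c ^ 2)) := by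
      apply IsCoprime.pow_left
      rw [Prime.coprime_iff_not_dvd hqi]
      intro h4
      have h5 := h q hqp hqm
      have h6 : (q : ℤ) ∣ 2 ^ 8 * (3 * b ^ 2) := by
        have := dvd_add h4 (h5.mul_right (256 * (2 * b + c)))
        rwa [show 256 * (b ^ 2 + b * c + c ^ 2) + (b - c) * (256 * (2 * b + c)) =
          2 ^ 8 * (3 * b ^ 2) by ring] at this
      rcases hqi.dvd_or_dvd h6 with h | h
      · have := hqi.dvd_of_dvd_pow h
        have : q ∣ 2 := by exact_mod_cast this
        exact h2 ((Nat.prime_dvd_prime_iff_eq hqp Nat.prime_two).mp this)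
      · rcases hqi.dvd_or_dvd h with h | h
        · have : q ∣ 3 := by exact_mod_cast h
          exact h3 ((Nat.prime_dvd_prime_iff_eq hqp Nat.prime_three).mp this)
        · exact hbb (hqi.dvd_of_dvd_pow h)
    exact cop.dvd_of_dvd_mul_right d3

lemma card_modEq {K : ℕ} (hK : 0 < K) (n : ℕ) (T : Finset ℤ) (hT : T ⊆ Finset.Icc (-(n:ℤ)) n)
    (h : ∀ b ∈ T, ∀ c ∈ T, (K : ℤ) ∣ b - c) : (T.card : ℝ) ≤ 2 * n / K + 2 := by
  rcases T.eq_empty_or_nonempty with rfl | ⟨c, hc⟩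
  · simp; positivity
  have hK' : (0 : ℤ) < K := by exact_mod_cast hK
  have hsub : T ⊆ (Finset.Ioc (-(n:ℤ) - 1) n).filter (fun x => x ≡ c [ZMOD (K : ℤ)]) := by
    intro b hb
    have h1 := hT hb
    rw [Finset.mem_Icc] at h1
    rw [Finset.mem_filter, Finset.mem_Ioc]
    refine ⟨⟨by linarith [h1.1], h1.2⟩, ?_⟩
    exact Int.modEq_iff_dvd.mpr (h c hc b hb)
  have h1 := Finset.card_le_card hsub
  have h2 := Int.Ioc_filter_modEq_card (-(n:ℤ) - 1) n hK' c
  have h3 : (T.card : ℤ) ≤ max (⌊(((n : ℤ) : ℚ) - (c : ℚ)) / ((K : ℤ) : ℚ)⌋ -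
      ⌊(((-(n:ℤ) - 1 : ℤ) : ℚ) - (c : ℚ)) / ((K : ℤ) : ℚ)⌋) 0 := by
    rw [← h2]; exact_mod_cast h1
  have hKq : (1 : ℚ) ≤ K := by exact_mod_cast hK
  have h4 : (T.card : ℚ) ≤ 2 * n / K + 2 := by
    rcases le_max_iff.mp h3 with h | h
    · have f1 := Int.floor_le ((((n : ℤ) : ℚ) - (c : ℚ)) / ((K : ℤ) : ℚ))
      have f2 := Int.lt_floor_add_one ((((-(n:ℤ) - 1 : ℤ) : ℚ) - (c : ℚ)) / ((K : ℤ) : ℚ))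
      have f3 : (T.card : ℚ) ≤ (⌊(((n : ℤ) : ℚ) - (c : ℚ)) / ((K : ℤ) : ℚ)⌋ : ℚ) -
        (⌊(((-(n:ℤ) - 1 : ℤ) : ℚ) - (c : ℚ)) / ((K : ℤ) : ℚ)⌋ : ℚ) := by exact_mod_cast h
      have f4 : (((n : ℤ) : ℚ) - (c : ℚ)) / ((K : ℤ) : ℚ) -
        (((-(n:ℤ) - 1 : ℤ) : ℚ) - (c : ℚ)) / ((K : ℤ) : ℚ) = 2 * n / K + 1 / K := by
        push_cast; ring
      have f5 : (1 : ℚ) / K ≤ 1 := by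
        rw [div_le_one (by linarith)]; exact hKq
      linarith
    · have : (T.card : ℚ) ≤ 0 := by exact_mod_cast h
      have : (0 : ℚ) ≤ 2 * n / K := by positivity
      linarith
  have h5 : ((T.card : ℚ) : ℝ) ≤ ((2 * n / K + 2 : ℚ) : ℝ) := by exact_mod_cast h4
  push_cast at h5
  exact h5

lemma card_cubes {q : ℕ} (hq : q.Prime) (x : ZMod q) :
    ∃ S : Finset (ZMod q), S.card ≤ 3 ∧ ∀ y, y ^ 3 = x → y ∈ S := by
  classical
  have := Fact.mk hq
  refine ⟨(Polynomial.nthRoots 3 x).toFinset, ?_, ?_⟩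
  · exact (Multiset.toFinset_card_le _).trans (Polynomial.card_nthRoots 3 x)
  · intro y hy
    simpa [Polynomial.mem_nthRoots] using hy

lemma card_fixed_a {m : ℕ} (hm : Squarefree m) (a : ℤ) (n : ℕ) (T : Finset ℤ)
    (hT : T ⊆ Finset.Icc (-(n:ℤ)) n)
    (h : ∀ b ∈ T, ∀ q : ℕ, q.Prime → q ∣ m → Wk q a b) :
    (T.card : ℝ) ≤ 3 ^ m.primeFactors.card * (2 * n / (m : ℝ) ^ 2 + 2) := by
  classical
  have hp : ∀ q : m.primeFactors, (q : ℕ).Prime := fun q => Nat.prime_of_mem_primeFactors q.2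
  have hd : ∀ q : m.primeFactors, (q : ℕ) ∣ m := fun q => Nat.dvd_of_mem_primeFactors q.2
  choose S hS1 hS2 using fun q : m.primeFactors =>
    card_cubes (hp q) (27 * (a : ZMod (q : ℕ)) ^ 4 * (256 : ZMod (q : ℕ))⁻¹)
  let f : ℤ → (∀ q : m.primeFactors, ZMod (q : ℕ)) := fun b q => (b : ZMod (q : ℕ))
  have hmaps : Set.MapsTo f (T : Set ℤ) (Fintype.piFinset S) := by
    intro b hb
    rw [Finset.mem_coe, Fintype.mem_piFinset]
    intro q
    apply hS2
    have := Fact.mk (hp q)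
    have hw := h b hb q (hp q) (hd q)
    obtain ⟨h2, -, -, -⟩ := wk_basic (hp q) hw
    have n2 : (2 : ZMod (q : ℕ)) ≠ 0 := by
      intro h
      have : ((2 : ℕ) : ZMod (q : ℕ)) = 0 := by exact_mod_cast h
      rw [ZMod.natCast_eq_zero_iff] at this
      exact h2 ((Nat.prime_dvd_prime_iff_eq (hp q) Nat.prime_two).mp this)
    have n256 : (256 : ZMod (q : ℕ)) ≠ 0 := by
      have := pow_ne_zero 8 n2
      norm_num at this
      exact this
    have h1 : ((q : ℕ) : ℤ) ∣ (256 * b ^ 3 - 27 * a ^ 4) := (dvd_pow_self _ two_ne_zero).trans hw.1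
    rw [← ZMod.intCast_zmod_eq_zero_iff_dvd] at h1
    push_cast at h1
    show (b : ZMod (q : ℕ)) ^ 3 = _
    field_simp
    linear_combination h1
  have hcard : (Fintype.piFinset S).card ≤ 3 ^ m.primeFactors.card := by
    rw [Fintype.card_piFinset]
    calc ∏ q, (S q).card ≤ ∏ q : m.primeFactors, 3 := Finset.prod_le_prod' (fun q _ => hS1 q)
      _ = _ := by simp
  have hm0 : 0 < m := Nat.pos_of_ne_zero hm.ne_zero
  rw [Finset.card_eq_sum_card_fiberwise hmaps]
  push_cast
  calc ∑ v ∈ Fintype.piFinset S, (({b ∈ T | f b = v}).card : ℝ)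
      ≤ ∑ v ∈ Fintype.piFinset S, (2 * n / ((m ^ 2 : ℕ) : ℝ) + 2) := by
        apply Finset.sum_le_sum
        intro v _
        apply card_modEq (by positivity) n _ ((Finset.filter_subset _ _).trans hT)
        intro b hb c hc
        rw [Finset.mem_filter] at hb hc
        apply modEq_sq hm (h b hb.1) (h c hc.1)
        intro q hq hqm
        have e := congrFun (hb.2.trans hc.2.symm) ⟨q, Nat.mem_primeFactors.mpr ⟨hq, hqm, hm.ne_zero⟩⟩
        have e' : (b : ZMod q) = (c : ZMod q) := e
        rw [← ZMod.intCast_zmod_eq_zero_iff_dvd]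
        push_cast
        rw [e', sub_self]
    _ = (Fintype.piFinset S).card * (2 * n / (m : ℝ) ^ 2 + 2) := by
        rw [Finset.sum_const, nsmul_eq_mul]; push_cast; rfl
    _ ≤ _ := by
        apply mul_le_mul_of_nonneg_right _ (by positivity)
        exact_mod_cast hcard

lemma three_pow_bound (δ : ℝ) (hδ : 0 < δ) : ∃ C : ℝ, 0 < C ∧ ∀ m : ℕ, Squarefree m →
    (3 : ℝ) ^ m.primeFactors.card ≤ C * (m : ℝ) ^ δ := by
  obtain ⟨B, hB⟩ := exists_nat_ge ((3 : ℝ) ^ (1 / δ))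
  refine ⟨3 ^ B, by positivity, fun m hm => ?_⟩
  have key : ∀ q ∈ m.primeFactors, (3 : ℝ) ≤ (if q < B then 3 else 1) * (q : ℝ) ^ δ := by
    intro q hq
    have hq1 : (1 : ℝ) ≤ q := by exact_mod_cast (Nat.prime_of_mem_primeFactors hq).one_lt.le
    split_ifs with h
    · have := Real.one_le_rpow hq1 hδ.le
      linarith
    · push Not at h
      have h1 : (3 : ℝ) ^ (1 / δ) ≤ q := hB.trans (by exact_mod_cast h)
      have h2 := Real.rpow_le_rpow (by positivity) h1 hδ.le
      rw [← Real.rpow_mul (by norm_num), one_div_mul_cancel hδ.ne', Real.rpow_one] at h2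
      linarith
  calc (3 : ℝ) ^ m.primeFactors.card = ∏ q ∈ m.primeFactors, (3 : ℝ) := by simp
    _ ≤ ∏ q ∈ m.primeFactors, ((if q < B then 3 else 1) * (q : ℝ) ^ δ) :=
        Finset.prod_le_prod (fun _ _ => by norm_num) key
    _ = (∏ q ∈ m.primeFactors, (if q < B then (3 : ℝ) else 1)) * (m : ℝ) ^ δ := by
        rw [Finset.prod_mul_distrib, Real.finsetProd_rpow _ _ (fun _ _ => by positivity)]
        congr 2
        have := Nat.prod_primeFactors_of_squarefree hm
        conv_rhs => rw [← this]
        push_cast; rfl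
    _ ≤ _ := by
        apply mul_le_mul_of_nonneg_right _ (by positivity)
        rw [Finset.prod_ite]
        simp only [Finset.prod_const, one_pow, mul_one]
        apply pow_le_pow_right₀ (by norm_num)
        calc _ ≤ (Finset.range B).card := Finset.card_le_card (by
              intro q hq
              rw [Finset.mem_filter] at hq
              exact Finset.mem_range.mpr hq.2)
          _ = B := by simp

/-- integer box containing the pairs of height less than X -/
noncomputable def Box (X : ℝ) : Finset (ℤ × ℤ) :=
  Finset.Icc (-(⌊X ^ 3⌋₊ : ℤ)) ⌊X ^ 3⌋₊ ×ˢ Finset.Icc (-(⌊X ^ 4⌋₊ : ℤ)) ⌊X ^ 4⌋₊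

lemma sum_inv_le (N : ℕ) : ∑ m ∈ Finset.Icc 1 N, (1 / (m : ℝ)) ≤ 1 + Real.log N := by
  have h := harmonic_le_one_add_log N
  rw [harmonic_eq_sum_Icc] at h
  push_cast at h
  simpa [one_div] using h

lemma small_count (δ : ℝ) (hδ : 0 < δ) : ∃ C : ℝ, 0 < C ∧ ∀ X M : ℝ, 2 ≤ X → 0 < M →
    ∀ T : Finset (ℤ × ℤ), T ⊆ Box X →
    (∀ t ∈ T, ∃ m : ℕ, Squarefree m ∧ M ≤ m ∧ (m : ℝ) ≤ X ^ (7 / 2 : ℝ) ∧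
      ∀ q : ℕ, q.Prime → q ∣ m → Wk q t.1 t.2) →
    (T.card : ℝ) ≤ C * (X ^ δ * (X ^ (7 : ℝ) / M + X ^ (13 / 2 : ℝ))) := by
  classical
  set d : ℝ := δ / 7 with hd
  have hd0 : 0 < d := by positivity
  obtain ⟨C, hC, hC'⟩ := three_pow_bound d hd0
  refine ⟨3 * C * (2 * (1 + 1 / d)), by positivity, ?_⟩
  intro X M hX hM T hT h
  have hX0 : 0 < X := by linarith
  set Y : ℝ := X ^ (7 / 2 : ℝ) with hY
  have hY1 : 1 ≤ Y := Real.one_le_rpow (by linarith) (by norm_num)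
  set I := (Finset.Icc 1 ⌊Y⌋₊).filter (fun m : ℕ => Squarefree m ∧ M ≤ m) with hI
  set J := Finset.Icc (-(⌊X ^ 3⌋₊ : ℤ)) ⌊X ^ 3⌋₊ with hJ
  set S : ℕ → ℤ → Finset ℤ := fun m a => (Finset.Icc (-(⌊X ^ 4⌋₊ : ℤ)) ⌊X ^ 4⌋₊).filter
    (fun b => ∀ q : ℕ, q.Prime → q ∣ m → Wk q a b) with hS
  have hsub : T ⊆ I.biUnion fun m => J.biUnion fun a => (S m a).image (fun b => (a, b)) := by
    rintro ⟨a, b⟩ ht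
    obtain ⟨m, h1, h2, h3, h4⟩ := h _ ht
    have hb := hT ht
    rw [Box, Finset.mem_product] at hb
    simp only [Finset.mem_biUnion, Finset.mem_image]
    refine ⟨m, ?_, a, hb.1, b, ?_, rfl⟩
    · rw [hI, Finset.mem_filter, Finset.mem_Icc]
      exact ⟨⟨Nat.pos_of_ne_zero h1.ne_zero, Nat.le_floor h3⟩, h1, h2⟩
    · rw [hS]
      simp only [Finset.mem_filter]
      exact ⟨hb.2, h4⟩
  have hcard : T.card ≤ ∑ m ∈ I, ∑ a ∈ J, (S m a).card := by
    refine (Finset.card_le_card hsub).trans (Finset.card_biUnion_le.trans ?_)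
    apply Finset.sum_le_sum
    intro m _
    refine Finset.card_biUnion_le.trans ?_
    apply Finset.sum_le_sum
    intro a _
    exact Finset.card_image_le
  have hcardR : (T.card : ℝ) ≤ ∑ m ∈ I, ∑ a ∈ J, ((S m a).card : ℝ) := by exact_mod_cast hcard
  have hJc : (J.card : ℝ) ≤ 3 * X ^ 3 := by
    have h1 : J.card = 2 * ⌊X ^ 3⌋₊ + 1 := by
      rw [hJ, Int.card_Icc]; omega
    rw [h1]
    push_cast
    have h2 : (⌊X ^ 3⌋₊ : ℝ) ≤ X ^ 3 := Nat.floor_le (by positivity)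
    have h3 : (1 : ℝ) ≤ X ^ 3 := one_le_pow₀ (by linarith)
    linarith
  have hB : (⌊X ^ 4⌋₊ : ℝ) ≤ X ^ 4 := Nat.floor_le (by positivity)
  have hm : ∀ m ∈ I, ∑ a ∈ J, ((S m a).card : ℝ) ≤
      (3 * X ^ 3) * (C * Y ^ d * (2 * X ^ 4 / M * (1 / m) + 2)) := by
    intro m hm
    rw [hI, Finset.mem_filter, Finset.mem_Icc] at hm
    obtain ⟨⟨h1, h2⟩, h3, h4⟩ := hm
    have hmY : (m : ℝ) ≤ Y := (Nat.le_floor_iff (by positivity)).mp h2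
    have hm0 : (0 : ℝ) < m := by exact_mod_cast h1
    calc ∑ a ∈ J, ((S m a).card : ℝ) ≤ ∑ a ∈ J, (C * Y ^ d * (2 * X ^ 4 / M * (1 / m) + 2)) := by
          apply Finset.sum_le_sum
          intro a _
          refine (card_fixed_a h3 a ⌊X ^ 4⌋₊ (S m a) (Finset.filter_subset _ _)
            (fun b hb => (Finset.mem_filter.mp hb).2)).trans ?_
          have e1 : (3 : ℝ) ^ m.primeFactors.card ≤ C * Y ^ d :=
            (hC' m h3).trans (mul_le_mul_of_nonneg_left
              (Real.rpow_le_rpow hm0.le hmY hd0.le) hC.le)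
          have e2 : 2 * (⌊X ^ 4⌋₊ : ℝ) / (m : ℝ) ^ 2 ≤ 2 * X ^ 4 / M * (1 / m) := by
            rw [div_mul_div_comm, mul_one, sq]
            apply div_le_div₀ (by positivity) (by linarith) (by positivity)
            exact mul_le_mul_of_nonneg_right h4 hm0.le
          apply mul_le_mul e1 (by linarith) (by positivity) (by positivity)
      _ = J.card * (C * Y ^ d * (2 * X ^ 4 / M * (1 / m) + 2)) := by
          rw [Finset.sum_const, nsmul_eq_mul]
      _ ≤ _ := mul_le_mul_of_nonneg_right hJc (by positivity)
  have hsum : ∑ m ∈ I, (2 * X ^ 4 / M * (1 / (m : ℝ)) + 2) ≤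
      2 * X ^ 4 / M * (1 + Real.log Y) + 2 * Y := by
    calc ∑ m ∈ I, (2 * X ^ 4 / M * (1 / (m : ℝ)) + 2)
        ≤ ∑ m ∈ Finset.Icc 1 ⌊Y⌋₊, (2 * X ^ 4 / M * (1 / (m : ℝ)) + 2) :=
          Finset.sum_le_sum_of_subset_of_nonneg (Finset.filter_subset _ _)
            (fun _ _ _ => by positivity)
      _ = 2 * X ^ 4 / M * (∑ m ∈ Finset.Icc 1 ⌊Y⌋₊, (1 / (m : ℝ))) + 2 * ⌊Y⌋₊ := by
          rw [Finset.sum_add_distrib, ← Finset.mul_sum]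
          simp [mul_comm]
      _ ≤ _ := by
          have f1 : (⌊Y⌋₊ : ℝ) ≤ Y := Nat.floor_le (by positivity)
          have f0 : (1 : ℝ) ≤ ⌊Y⌋₊ := by exact_mod_cast Nat.le_floor (by simpa using hY1)
          have f2 : Real.log ⌊Y⌋₊ ≤ Real.log Y := Real.log_le_log (by linarith) f1
          have f3 := sum_inv_le ⌊Y⌋₊
          have f4 : 0 ≤ 2 * X ^ 4 / M := by positivity
          have := mul_le_mul_of_nonneg_left (f3.trans (add_le_add_right f2 1)) f4
          linarith
  have hlog : 1 + Real.log Y ≤ (1 + 1 / d) * Y ^ d := by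
    have g1 := Real.log_le_rpow_div (by positivity : (0 : ℝ) ≤ Y) hd0
    have g2 : 1 ≤ Y ^ d := Real.one_le_rpow hY1 hd0.le
    have : Y ^ d / d = 1 / d * Y ^ d := by ring
    linarith
  have hYd1 : 1 ≤ Y ^ d := Real.one_le_rpow hY1 hd0.le
  have hYd : Y ^ d * Y ^ d = X ^ δ := by
    rw [hY, ← Real.rpow_mul hX0.le, ← Real.rpow_add hX0]
    congr 1; rw [hd]; ring
  have hX7 : X ^ 3 * X ^ 4 = X ^ (7 : ℝ) := by
    rw [← pow_add]; norm_cast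
  have hX13 : X ^ 3 * Y = X ^ (13 / 2 : ℝ) := by
    rw [hY, ← Real.rpow_natCast, ← Real.rpow_add hX0]; norm_num
  calc (T.card : ℝ) ≤ ∑ m ∈ I, (3 * X ^ 3) * (C * Y ^ d * (2 * X ^ 4 / M * (1 / m) + 2)) :=
        hcardR.trans (Finset.sum_le_sum hm)
    _ = (3 * X ^ 3) * (C * Y ^ d) * ∑ m ∈ I, (2 * X ^ 4 / M * (1 / (m : ℝ)) + 2) := by
        rw [Finset.mul_sum]
        apply Finset.sum_congr rfl
        intro m _; ring
    _ ≤ (3 * X ^ 3) * (C * Y ^ d) * (2 * X ^ 4 / M * ((1 + 1 / d) * Y ^ d) +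
          2 * Y * ((1 + 1 / d) * Y ^ d)) := by
        apply mul_le_mul_of_nonneg_left _ (by positivity)
        refine hsum.trans (add_le_add (mul_le_mul_of_nonneg_left hlog (by positivity)) ?_)
        have k1 : 1 ≤ (1 + 1 / d) * Y ^ d := by
          have : 0 < 1 / d := by positivity
          nlinarith
        have : 0 ≤ 2 * Y := by positivity
        nlinarith
    _ = 3 * C * (2 * (1 + 1 / d)) * ((Y ^ d * Y ^ d) * ((X ^ 3 * X ^ 4) / M + X ^ 3 * Y)) := by
        ring
    _ = _ := by rw [hYd, hX7, hX13]

lemma sum_inv_int_le (N : ℕ) :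
    ∑ e ∈ Finset.Icc (-(N : ℤ)) N, (1 / max 1 |(e : ℝ)|) ≤ 3 + 2 * Real.log N := by
  classical
  set A := (Finset.Icc 1 N).image (fun n : ℕ => (n : ℤ)) with hA
  set B := (Finset.Icc 1 N).image (fun n : ℕ => -(n : ℤ)) with hB
  have hsub : Finset.Icc (-(N : ℤ)) N ⊆ (A ∪ B) ∪ {0} := by
    intro e he
    rw [Finset.mem_Icc] at he
    simp only [Finset.mem_union, Finset.mem_singleton, hA, hB, Finset.mem_image, Finset.mem_Icc]
    rcases lt_trichotomy e 0 with h | h | h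
    · left; right; exact ⟨e.natAbs, by omega, by omega⟩
    · right; exact h
    · left; left; exact ⟨e.natAbs, by omega, by omega⟩
  have hu : ∀ S T : Finset ℤ, ∑ e ∈ S ∪ T, (1 / max 1 |(e : ℝ)|) ≤
      ∑ e ∈ S, (1 / max 1 |(e : ℝ)|) + ∑ e ∈ T, (1 / max 1 |(e : ℝ)|) := by
    intro S T
    rw [← Finset.sum_union_inter]
    have : 0 ≤ ∑ e ∈ S ∩ T, (1 / max 1 |(e : ℝ)|) := Finset.sum_nonneg (fun _ _ => by positivity)
    linarith
  have h1 : ∑ e ∈ A, (1 / max 1 |(e : ℝ)|) = ∑ m ∈ Finset.Icc 1 N, (1 / (m : ℝ)) := by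
    rw [hA, Finset.sum_image (fun x _ y _ h => by simpa using h)]
    apply Finset.sum_congr rfl
    intro m hm
    rw [Finset.mem_Icc] at hm
    have : (1 : ℝ) ≤ m := by exact_mod_cast hm.1
    push_cast
    rw [Nat.abs_cast, max_eq_right this]
  have h2 : ∑ e ∈ B, (1 / max 1 |(e : ℝ)|) = ∑ m ∈ Finset.Icc 1 N, (1 / (m : ℝ)) := by
    rw [hB, Finset.sum_image (fun x _ y _ h => by simpa using h)]
    apply Finset.sum_congr rfl
    intro m hm
    rw [Finset.mem_Icc] at hm
    have : (1 : ℝ) ≤ m := by exact_mod_cast hm.1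
    push_cast
    rw [abs_neg, Nat.abs_cast, max_eq_right this]
  have h3 := sum_inv_le N
  calc _ ≤ ∑ e ∈ (A ∪ B) ∪ {0}, (1 / max 1 |(e : ℝ)|) :=
        Finset.sum_le_sum_of_subset_of_nonneg hsub (fun _ _ _ => by positivity)
    _ ≤ (∑ e ∈ A, (1 / max 1 |(e : ℝ)|) + ∑ e ∈ B, (1 / max 1 |(e : ℝ)|)) + 1 := by
        refine (hu _ _).trans (add_le_add (hu _ _) ?_)
        simp
    _ ≤ _ := by rw [h1, h2]; linarith

lemma tuple_count (Z : ℝ) (hZ : 1 ≤ Z) (V : Finset (Fin 6 → ℤ))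
    (hV : ∀ v ∈ V, ∏ i, max 1 |(v i : ℝ)| ≤ Z) :
    (V.card : ℝ) ≤ Z * (3 + 2 * Real.log Z) ^ 6 := by
  classical
  set N := ⌊Z⌋₊ with hN
  have hN1 : 1 ≤ N := Nat.le_floor (by simpa using hZ)
  have hNZ : (N : ℝ) ≤ Z := Nat.floor_le (by linarith)
  have hsub : V ⊆ Fintype.piFinset (fun _ : Fin 6 => Finset.Icc (-(N : ℤ)) N) := by
    intro v hv
    rw [Fintype.mem_piFinset]
    intro i
    have h1 : |(v i : ℝ)| ≤ Z := by
      refine le_trans ?_ (hV v hv)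
      rw [← Finset.mul_prod_erase Finset.univ _ (Finset.mem_univ i)]
      have : 1 ≤ ∏ x ∈ Finset.univ.erase i, max 1 |(v x : ℝ)| := by
        have := Finset.prod_le_prod (s := Finset.univ.erase i) (f := fun _ => (1 : ℝ))
          (g := fun x => max 1 |(v x : ℝ)|) (fun _ _ => zero_le_one) (fun _ _ => le_max_left _ _)
        simpa using this
      calc |(v i : ℝ)| ≤ max 1 |(v i : ℝ)| := le_max_right _ _
        _ ≤ _ := le_mul_of_one_le_right (by positivity) this
    have h2 : (v i).natAbs ≤ N := by
      apply Nat.le_floor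
      rw [Nat.cast_natAbs]
      push_cast
      exact h1
    rw [Finset.mem_Icc]
    omega
  calc (V.card : ℝ) = ∑ v ∈ V, (1 : ℝ) := by simp
    _ ≤ ∑ v ∈ V, Z * ∏ i, (1 / max 1 |(v i : ℝ)|) := by
        apply Finset.sum_le_sum
        intro v hv
        have h0 : 0 < ∏ i, max 1 |(v i : ℝ)| := Finset.prod_pos (fun _ _ => by positivity)
        rw [Finset.prod_div_distrib, Finset.prod_const_one, mul_one_div, le_div_iff₀ h0, one_mul]
        exact hV v hv
    _ ≤ ∑ v ∈ Fintype.piFinset (fun _ : Fin 6 => Finset.Icc (-(N : ℤ)) N),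
          Z * ∏ i, (1 / max 1 |(v i : ℝ)|) :=
        Finset.sum_le_sum_of_subset_of_nonneg hsub (fun _ _ _ => by positivity)
    _ = Z * (∑ e ∈ Finset.Icc (-(N : ℤ)) N, (1 / max 1 |(e : ℝ)|)) ^ 6 := by
        rw [← Finset.mul_sum, ← Finset.prod_univ_sum (fun _ : Fin 6 => Finset.Icc (-(N : ℤ)) N)
          (fun _ e => 1 / max 1 |(e : ℝ)|)]
        simp
    _ ≤ _ := by
        apply mul_le_mul_of_nonneg_left _ (by linarith)
        apply pow_le_pow_left₀ (Finset.sum_nonneg (fun _ _ => by positivity))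
        refine (sum_inv_int_le N).trans ?_
        have : Real.log N ≤ Real.log Z := Real.log_le_log (by exact_mod_cast hN1) hNZ
        linarith

lemma tri_bound {X b c u1 u2 u3 y1 y2 y3 A1 A2 A3 : ℝ} (hX : 0 < X) (hb : |b| ≤ X ^ 4)
    (hc : |c| ≤ X ^ 6) (h1 : |u1| ≤ X * A1) (h2 : |u2| ≤ X * A2) (h3 : |u3| ≤ X * A3)
    (k1 : |y1| * X ≤ A1) (k2 : |y2| * X ≤ A2) (k3 : |y3| * X ≤ A3) :
    |3 * (u1 * u2 * u3) - 4 * b * (u1 * y2 * y3 + y1 * u2 * y3 + y1 * y2 * u3)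
      - 3 * c * (y1 * y2 * y3)| ≤ 18 * (X ^ 3 * (A1 * A2 * A3)) := by
  rw [← le_div_iff₀ hX] at k1 k2 k3
  have p1 : 0 ≤ A1 / X := (abs_nonneg _).trans k1
  have p2 : 0 ≤ A2 / X := (abs_nonneg _).trans k2
  have p3 : 0 ≤ A3 / X := (abs_nonneg _).trans k3
  have q1 : 0 ≤ X * A1 := (abs_nonneg _).trans h1
  have q2 : 0 ≤ X * A2 := (abs_nonneg _).trans h2
  have q3 : 0 ≤ X * A3 := (abs_nonneg _).trans h3
  have m1 : |u1 * u2 * u3| ≤ X ^ 3 * (A1 * A2 * A3) := by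
    rw [abs_mul, abs_mul]
    calc _ ≤ (X * A1) * (X * A2) * (X * A3) := by gcongr
      _ = _ := by ring
  have m2 : |b * (u1 * y2 * y3)| ≤ X ^ 3 * (A1 * A2 * A3) := by
    rw [abs_mul, abs_mul, abs_mul]
    calc _ ≤ X ^ 4 * ((X * A1) * (A2 / X) * (A3 / X)) := by gcongr
      _ = _ := by field_simp
  have m3 : |b * (y1 * u2 * y3)| ≤ X ^ 3 * (A1 * A2 * A3) := by
    rw [abs_mul, abs_mul, abs_mul]
    calc _ ≤ X ^ 4 * ((A1 / X) * (X * A2) * (A3 / X)) := by gcongr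
      _ = _ := by field_simp
  have m4 : |b * (y1 * y2 * u3)| ≤ X ^ 3 * (A1 * A2 * A3) := by
    rw [abs_mul, abs_mul, abs_mul]
    calc _ ≤ X ^ 4 * ((A1 / X) * (A2 / X) * (X * A3)) := by gcongr
      _ = _ := by field_simp
  have m5 : |c * (y1 * y2 * y3)| ≤ X ^ 3 * (A1 * A2 * A3) := by
    rw [abs_mul, abs_mul, abs_mul]
    calc _ ≤ X ^ 6 * ((A1 / X) * (A2 / X) * (A3 / X)) := by gcongr
      _ = _ := by field_simp
  rw [abs_le] at *
  constructor <;> linarith [m1.1, m1.2, m2.1, m2.2, m3.1, m3.2, m4.1, m4.2, m5.1, m5.2]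

/-- A basis of the lattice of (u, y) with u = s y mod p, reduced for the norm max(|u|/X, |y| X). -/
lemma lattice {X : ℝ} (hX : 0 < X) (p s : ℤ) (hp : X ^ 2 ≤ (p : ℝ)) :
    ∃ (x1 y1 x2 y2 : ℤ) (N : ℝ), x1 * y2 - x2 * y1 = 1 ∧ 0 < y1 ∧ X ≤ N ∧ N ^ 2 ≤ p ∧
      |((p * x1 + s * y1 : ℤ) : ℝ)| ≤ X * N ∧ |(y1 : ℝ)| * X ≤ N ∧
      |((p * x2 + s * y2 : ℤ) : ℝ)| ≤ X * (2 * p / N) ∧ |(y2 : ℝ)| * X ≤ 2 * p / N := by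
  have hp0 : (0 : ℝ) < p := lt_of_lt_of_le (by positivity) hp
  set r := Real.sqrt p with hr
  have hr2 : r ^ 2 = p := Real.sq_sqrt hp0.le
  have hr0 : 0 < r := Real.sqrt_pos.mpr hp0
  have hXr : X ≤ r := Real.le_sqrt_of_sq_le hp
  set n := ⌊r / X⌋₊ with hn
  have hn1 : 1 ≤ n := Nat.le_floor (by rw [Nat.cast_one, le_div_iff₀ hX]; linarith)
  have hn2 : (n : ℝ) * X ≤ r := by
    rw [← le_div_iff₀ hX]; exact Nat.floor_le (by positivity)
  have hn3 : r ≤ (n + 1) * X := by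
    rw [← div_le_iff₀ hX]; exact (Nat.lt_floor_add_one _).le
  obtain ⟨q, hq1, hq2⟩ := Real.exists_rat_abs_sub_le_and_den_le ((s : ℝ) / p) hn1
  set y1 : ℤ := (q.den : ℤ) with hy1
  set x1 : ℤ := -q.num with hx1
  have hy1pos : 0 < y1 := by rw [hy1]; exact_mod_cast q.den_pos
  have hy1R : (1 : ℝ) ≤ y1 := by exact_mod_cast hy1pos
  have hcop : IsCoprime x1 y1 := by
    rw [hx1, hy1]
    exact (Rat.isCoprime_num_den q).neg_left
  obtain ⟨c, d, hcd⟩ := hcop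
  set u1 : ℤ := p * x1 + s * y1 with hu1
  have hu1R : |(u1 : ℝ)| ≤ X * r := by
    have e : (u1 : ℝ) = p * y1 * ((s : ℝ) / p - q) := by
      have : (q : ℝ) = q.num / y1 := by
        rw [hy1]; push_cast; exact Rat.cast_def q
      rw [this, hu1, hx1]
      push_cast
      have : (y1 : ℝ) ≠ 0 := by positivity
      field_simp
      ring
    rw [e, abs_mul, abs_of_pos (by positivity)]
    have hden : (q.den : ℝ) = y1 := by rw [hy1]; push_cast; rfl
    rw [hden] at hq1
    calc (p : ℝ) * y1 * |(s : ℝ) / p - q| ≤ p * y1 * (1 / ((n + 1) * y1)) := by gcongr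
      _ = p / (n + 1) := by field_simp
      _ ≤ X * r := by
        rw [div_le_iff₀ (by positivity), ← hr2]
        nlinarith
  have hy1X : (y1 : ℝ) * X ≤ r := by
    have : (y1 : ℝ) ≤ n := by rw [hy1]; exact_mod_cast hq2
    nlinarith
  set N := max (|(u1 : ℝ)| / X) (y1 * X) with hN
  have hNu : |(u1 : ℝ)| ≤ X * N := by
    rw [mul_comm, ← div_le_iff₀ hX]; exact le_max_left _ _
  have hNy : (y1 : ℝ) * X ≤ N := le_max_right _ _
  have hXN : X ≤ N := by nlinarith
  have hN0 : 0 < N := by linarith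
  have hNr : N ≤ r := max_le (by rw [div_le_iff₀ hX]; linarith) hy1X
  have hN2 : N ^ 2 ≤ p := by rw [← hr2]; gcongr
  have habs : |(y1 : ℝ)| = y1 := abs_of_pos (by linarith)
  have fin : ∀ x2 y2 : ℤ, x1 * y2 - x2 * y1 = 1 →
      |((p * x2 + s * y2 : ℤ) : ℝ)| * N ≤ 2 * p * X → |(y2 : ℝ)| * X * N ≤ 2 * p →
      ∃ (x1 y1 x2 y2 : ℤ) (N : ℝ), x1 * y2 - x2 * y1 = 1 ∧ 0 < y1 ∧ X ≤ N ∧ N ^ 2 ≤ p ∧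
      |((p * x1 + s * y1 : ℤ) : ℝ)| ≤ X * N ∧ |(y1 : ℝ)| * X ≤ N ∧
      |((p * x2 + s * y2 : ℤ) : ℝ)| ≤ X * (2 * p / N) ∧ |(y2 : ℝ)| * X ≤ 2 * p / N := by
    intro x2 y2 h1 h2 h3
    refine ⟨x1, y1, x2, y2, N, h1, hy1pos, hXN, hN2, hNu, by rw [habs]; exact hNy, ?_, ?_⟩
    · rw [← mul_div_assoc, le_div_iff₀ hN0]; linarith
    · rw [le_div_iff₀ hN0]; exact h3
  rcases le_total (|(u1 : ℝ)| / X) (y1 * X) with hle | hle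
  · -- reduce the second coordinate
    have hNe : N = y1 * X := max_eq_right hle
    set t := c / y1 with ht
    set y2 := c % y1 with hy2
    have hy2a : y2 = c - y1 * t := by rw [hy2, ht, Int.emod_def]
    have hy20 : 0 ≤ y2 := Int.emod_nonneg _ hy1pos.ne'
    have hy21 : y2 < y1 := Int.emod_lt_of_pos _ hy1pos
    have hdet : x1 * y2 - (-d - t * x1) * y1 = 1 := by rw [hy2a]; linear_combination hcd
    apply fin (-d - t * x1) y2 hdet
    · set u2 : ℤ := p * (-d - t * x1) + s * y2 with hu2
      have e : u2 * y1 = u1 * y2 - p := by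
        rw [hu2, hu1]; linear_combination (-p) * hdet
      have e' : (u2 : ℝ) * y1 = u1 * y2 - p := by exact_mod_cast e
      have hy20' : (0 : ℝ) ≤ y2 := by exact_mod_cast hy20
      have hy21' : (y2 : ℝ) ≤ y1 := by exact_mod_cast hy21.le
      have e2 : |(u2 : ℝ)| * y1 ≤ |(u1 : ℝ)| * y1 + p := by
        calc |(u2 : ℝ)| * y1 = |(u2 : ℝ) * y1| := by rw [abs_mul, habs]
          _ = |(u1 : ℝ) * y2 - p| := by rw [e']
          _ ≤ |(u1 : ℝ) * y2| + |(p : ℝ)| := abs_sub _ _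
          _ ≤ _ := by
            rw [abs_mul, abs_of_nonneg hy20', abs_of_pos hp0]
            gcongr
      calc |(u2 : ℝ)| * N = (|(u2 : ℝ)| * y1) * X := by rw [hNe]; ring
        _ ≤ (|(u1 : ℝ)| * y1 + p) * X := by gcongr
        _ = |(u1 : ℝ)| * N + p * X := by rw [hNe]; ring
        _ ≤ (X * N) * N + p * X := by gcongr
        _ ≤ 2 * p * X := by nlinarith
    · have hy20' : (0 : ℝ) ≤ y2 := by exact_mod_cast hy20
      have hy21' : (y2 : ℝ) ≤ y1 := by exact_mod_cast hy21.le
      rw [abs_of_nonneg hy20']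
      calc (y2 : ℝ) * X * N ≤ y1 * X * N := by gcongr
        _ = N ^ 2 := by rw [hNe]; ring
        _ ≤ 2 * p := by linarith
  · have hNe : N = |(u1 : ℝ)| / X := max_eq_left hle
    have hNe' : |(u1 : ℝ)| = X * N := by rw [hNe]; field_simp
    have hu1pos : 0 < |(u1 : ℝ)| := by rw [hNe']; positivity
    have hu10 : u1 ≠ 0 := by
      rintro h; rw [h] at hu1pos; simp at hu1pos
    set w := p * (-d) + s * c with hw
    set t := w / u1 with ht
    have hdet : x1 * (c - t * y1) - (-d - t * x1) * y1 = 1 := by linear_combination hcd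
    have hu2 : p * (-d - t * x1) + s * (c - t * y1) = w % u1 := by
      rw [Int.emod_def, ← ht, hw, hu1]; ring
    have h0 : 0 ≤ w % u1 := Int.emod_nonneg _ hu10
    have h1 : w % u1 < |u1| := Int.emod_lt_abs _ hu10
    set v := w % u1 with hv
    have h0' : (0 : ℝ) ≤ v := by exact_mod_cast h0
    have h1' : (v : ℝ) ≤ |(u1 : ℝ)| := by exact_mod_cast h1.le
    apply fin (-d - t * x1) (c - t * y1) hdet
    · rw [hu2, abs_of_nonneg h0']
      calc (v : ℝ) * N ≤ (X * N) * N := by rw [← hNe']; gcongr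
        _ ≤ 2 * p * X := by nlinarith
    · set y2 := c - t * y1 with hy2
      have e : y2 * u1 = p + v * y1 := by
        rw [← hu2, hu1]; linear_combination p * hdet
      have e' : (y2 : ℝ) * u1 = p + v * y1 := by exact_mod_cast e
      calc |(y2 : ℝ)| * X * N = |(y2 : ℝ)| * |(u1 : ℝ)| := by rw [hNe']; ring
        _ = |(p : ℝ) + v * y1| := by rw [← abs_mul, e']
        _ = p + v * y1 := abs_of_nonneg (by positivity)
        _ ≤ p + (X * N) * y1 := by rw [← hNe']; gcongr
        _ = p + (y1 * X) * N := by ring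
        _ ≤ p + N * N := by gcongr
        _ ≤ 2 * p := by nlinarith

lemma root_case {X : ℝ} (hX : 0 < X) {a b u y : ℤ} (ha : |(a : ℝ)| ≤ X ^ 3)
    (hb : |(b : ℝ)| ≤ X ^ 4) (hy : y ≠ 0)
    (h : u ^ 3 - 4 * b * u * y ^ 2 - a ^ 2 * y ^ 3 = 0) :
    ∃ w : ℤ, |(w : ℝ)| ≤ 3 * X ^ 2 ∧ w ^ 3 - 4 * b * w - a ^ 2 = 0 := by
  have hyq : (y : ℚ) ≠ 0 := by exact_mod_cast hy
  have hq : ((u : ℚ) / y) ^ 3 - 4 * b * ((u : ℚ) / y) - a ^ 2 = 0 := by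
    have : (u : ℚ) ^ 3 - 4 * b * u * y ^ 2 - a ^ 2 * y ^ 3 = 0 := by exact_mod_cast h
    field_simp
    linear_combination this
  have hint : IsIntegral ℤ ((u : ℚ) / y) := by
    refine ⟨Polynomial.X ^ 3 + (-Polynomial.C (4 * b) * Polynomial.X - Polynomial.C (a ^ 2)), ?_, ?_⟩
    · apply Polynomial.monic_X_pow_add
      compute_degree!
    · simp only [Polynomial.eval₂_add, Polynomial.eval₂_sub, Polynomial.eval₂_mul,
        Polynomial.eval₂_neg, Polynomial.eval₂_X_pow, Polynomial.eval₂_X, Polynomial.eval₂_C]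
      simp only [algebraMap_int_eq, eq_intCast]
      push_cast
      linear_combination hq
  obtain ⟨w, hw⟩ := IsIntegrallyClosed.isIntegral_iff.mp hint
  have hw' : (w : ℚ) = (u : ℚ) / y := by simpa using hw
  have hroot : w ^ 3 - 4 * b * w - a ^ 2 = 0 := by
    rw [← hw'] at hq
    exact_mod_cast hq
  refine ⟨w, ?_, hroot⟩
  by_contra hcon
  push Not at hcon
  have hR : (w : ℝ) ^ 3 = 4 * b * w + a ^ 2 := by
    have : (w : ℝ) ^ 3 - 4 * b * w - a ^ 2 = 0 := by exact_mod_cast hroot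
    linarith
  have h1 : |(w : ℝ)| ^ 3 ≤ 4 * X ^ 4 * |(w : ℝ)| + X ^ 6 := by
    rw [← abs_pow, hR]
    refine (abs_add_le _ _).trans ?_
    rw [abs_mul, abs_mul, abs_pow]
    have e1 : |(a : ℝ)| ^ 2 ≤ X ^ 6 := by
      calc |(a : ℝ)| ^ 2 ≤ (X ^ 3) ^ 2 := by gcongr
        _ = _ := by ring
    have e2 : |(4 : ℝ)| * |(b : ℝ)| * |(w : ℝ)| ≤ 4 * X ^ 4 * |(w : ℝ)| := by
      rw [abs_of_pos (by norm_num : (0 : ℝ) < 4)]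
      gcongr
    linarith
  set z := |(w : ℝ)| with hz
  have h2 : 0 < X ^ 2 := by positivity
  have h3 : (3 * X ^ 2) ^ 2 * z ≤ z ^ 2 * z := by gcongr
  have h4 : X ^ 4 * (3 * X ^ 2) ≤ X ^ 4 * z := by gcongr
  have h5 : 0 < X ^ 6 := by positivity
  nlinarith

/-- the represented value, Hessian value and discriminant attached to a tuple -/
def Pf (e : Fin 6 → ℤ) : ℤ :=
  e 0 * e 5 ^ 3 - e 1 * e 5 ^ 2 * e 4 + e 2 * e 5 * e 4 ^ 2 - e 3 * e 4 ^ 3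

def Hf (e : Fin 6 → ℤ) : ℤ :=
  (e 1 ^ 2 - 3 * e 0 * e 2) * e 5 ^ 2 - (e 1 * e 2 - 9 * e 0 * e 3) * e 5 * e 4 +
    (e 2 ^ 2 - 3 * e 1 * e 3) * e 4 ^ 2

def Df (e : Fin 6 → ℤ) : ℤ :=
  e 1 ^ 2 * e 2 ^ 2 - 4 * e 0 * e 2 ^ 3 - 4 * e 1 ^ 3 * e 3 - 27 * e 0 ^ 2 * e 3 ^ 2 +
    18 * e 0 * e 1 * e 2 * e 3

lemma exists_s {p : ℕ} (hp : p.Prime) {a b : ℤ} (h : Wk p a b) :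
    ∃ s C D : ℤ, p * C = 3 * s ^ 2 - 4 * b ∧ p ^ 2 * D = s ^ 3 - 4 * b * s - a ^ 2 := by
  obtain ⟨h2, h3, ha, hb⟩ := wk_basic hp h
  have hpi : Prime (p : ℤ) := Nat.prime_iff_prime_int.mp hp
  have n2 : ¬ (p : ℤ) ∣ 2 := by
    intro h
    have : p ∣ 2 := by exact_mod_cast h
    exact h2 ((Nat.prime_dvd_prime_iff_eq hp Nat.prime_two).mp this)
  have c2 : IsCoprime ((p : ℤ) ^ 2) 2 := ((Prime.coprime_iff_not_dvd hpi).mpr n2).pow_left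
  have cb : IsCoprime ((p : ℤ) ^ 2) b := ((Prime.coprime_iff_not_dvd hpi).mpr hb).pow_left
  have c8b : IsCoprime ((p : ℤ) ^ 2) (2 ^ 3 * b) := c2.pow_right.mul_right cb
  obtain ⟨k, hk⟩ := h.1
  obtain ⟨i, j, hij⟩ := c8b
  set s := -3 * a ^ 2 * j with hs
  have hs8 : 8 * b * s = -3 * a ^ 2 + p ^ 2 * (3 * a ^ 2 * i) := by
    rw [hs]; linear_combination (-3 * a ^ 2) * hij
  have d1 : (p : ℤ) ^ 2 ∣ 3 * s ^ 2 - 4 * b := by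
    have cc : IsCoprime ((p : ℤ) ^ 2) ((2 ^ 3 * b) ^ 2) := (c2.pow_right.mul_right cb).pow_right
    apply cc.dvd_of_dvd_mul_left
    refine ⟨-k + 3 * (3 * a ^ 2 * i) * (-3 * a ^ 2 + 8 * b * s), ?_⟩
    linear_combination (-1) * hk + 3 * (8 * b * s - 3 * a ^ 2) * hs8
  have d2 : (p : ℤ) ^ 2 ∣ s ^ 3 - 4 * b * s - a ^ 2 := by
    have cc : IsCoprime ((p : ℤ) ^ 2) ((2 ^ 3 * b) ^ 3) := (c2.pow_right.mul_right cb).pow_right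
    apply cc.dvd_of_dvd_mul_left
    refine ⟨a ^ 2 * k + (3 * a ^ 2 * i) * ((8 * b * s) ^ 2 + (8 * b * s) * (-3 * a ^ 2) +
      9 * a ^ 4 - 256 * b ^ 3), ?_⟩
    linear_combination a ^ 2 * hk + ((8 * b * s) ^ 2 + (8 * b * s) * (-3 * a ^ 2) +
      9 * a ^ 4 - 256 * b ^ 3) * hs8
  obtain ⟨C, hC⟩ := d1
  obtain ⟨D, hD⟩ := d2
  exact ⟨s, p * C, D, by rw [hC]; ring, hD.symm⟩

lemma max_abs_int {z : ℤ} (hz : z ≠ 0) : max 1 |(z : ℝ)| = |(z : ℝ)| := by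
  apply max_eq_right
  have : 1 ≤ |z| := Int.one_le_abs hz
  exact_mod_cast this

lemma key {X R : ℝ} (hX : 2 ≤ X) {p : ℕ} (hp : p.Prime) (hR1 : X ^ 2 ≤ R) (hR2 : R ≤ X ^ 4)
    (hR3 : X ^ 6 ≤ R * p) {a b : ℤ} (ha : |(a : ℝ)| ≤ X ^ 3) (hb : |(b : ℝ)| ≤ X ^ 4)
    (h : Wk p a b) :
    (∃ w : ℤ, |(w : ℝ)| ≤ 3 * X ^ 2 ∧ w ^ 3 - 4 * b * w - a ^ 2 = 0) ∨
    ∃ e : Fin 6 → ℤ, ∏ i, max 1 |(e i : ℝ)| ≤ (576 * X ^ 4) * (2592 * R) ∧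
      Hf e = 12 * b ∧ Df e * Pf e ^ 2 = 256 * b ^ 3 - 27 * a ^ 4 := by
  have hX0 : 0 < X := by linarith
  have hR0 : 0 < R := lt_of_lt_of_le (by positivity) hR1
  have hp0 : (0 : ℝ) < p := by exact_mod_cast hp.pos
  have hpX : X ^ 2 ≤ (p : ℝ) := by
    have h1 : X ^ 4 * X ^ 2 ≤ X ^ 4 * p := by
      calc X ^ 4 * X ^ 2 = X ^ 6 := by ring
        _ ≤ R * p := hR3
        _ ≤ X ^ 4 * p := by gcongr
    exact le_of_mul_le_mul_left h1 (by positivity)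
  obtain ⟨s, C, D, hC, hD⟩ := exists_s hp h
  obtain ⟨x1, y1, x2, y2, N, hdet, hy1, hXN, hNp, hu1, hk1, hu2, hk2⟩ :=
    lattice hX0 (p : ℤ) s (by exact_mod_cast hpX)
  have hN0 : 0 < N := by linarith
  rw [Int.cast_natCast] at hNp hu2 hk2
  set u1 : ℤ := p * x1 + s * y1 with hu1d
  set u2 : ℤ := p * x2 + s * y2 with hu2d
  obtain ⟨e0, he0⟩ : ∃ e0 : ℤ, e0 = p * x1 ^ 3 + 3 * s * x1 ^ 2 * y1 + C * x1 * y1 ^ 2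
    + D * y1 ^ 3 := ⟨_, rfl⟩
  obtain ⟨e3, he3⟩ : ∃ e3 : ℤ, e3 = p * x2 ^ 3 + 3 * s * x2 ^ 2 * y2 + C * x2 * y2 ^ 2
    + D * y2 ^ 3 := ⟨_, rfl⟩
  obtain ⟨e1, he1⟩ : ∃ e1 : ℤ, e1 = 3 * p * x1 ^ 2 * x2 + 3 * s * (x1 ^ 2 * y2 + 2 * x1 * x2 * y1)
    + C * (x2 * y1 ^ 2 + 2 * x1 * y1 * y2) + 3 * D * y1 ^ 2 * y2 := ⟨_, rfl⟩
  obtain ⟨e2, he2⟩ : ∃ e2 : ℤ, e2 = 3 * p * x2 ^ 2 * x1 + 3 * s * (x2 ^ 2 * y1 + 2 * x1 * x2 * y2)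
    + C * (x1 * y2 ^ 2 + 2 * x2 * y1 * y2) + 3 * D * y2 ^ 2 * y1 := ⟨_, rfl⟩
  have f0 : (p : ℤ) ^ 2 * e0 = u1 ^ 3 - 4 * b * u1 * y1 ^ 2 - a ^ 2 * y1 ^ 3 := by
    rw [he0, hu1d]; linear_combination (p * x1 * y1 ^ 2) * hC + y1 ^ 3 * hD
  have f3 : (p : ℤ) ^ 2 * e3 = u2 ^ 3 - 4 * b * u2 * y2 ^ 2 - a ^ 2 * y2 ^ 3 := by
    rw [he3, hu2d]; linear_combination (p * x2 * y2 ^ 2) * hC + y2 ^ 3 * hD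
  have f1 : (p : ℤ) ^ 2 * e1 = 3 * (u1 * u1 * u2) - 4 * b * (u1 * y1 * y2 + y1 * u1 * y2
      + y1 * y1 * u2) - 3 * a ^ 2 * (y1 * y1 * y2) := by
    rw [he1, hu1d, hu2d]
    linear_combination (p * (x2 * y1 ^ 2 + 2 * x1 * y1 * y2)) * hC + 3 * y1 ^ 2 * y2 * hD
  have f2 : (p : ℤ) ^ 2 * e2 = 3 * (u2 * u2 * u1) - 4 * b * (u2 * y2 * y1 + y2 * u2 * y1
      + y2 * y2 * u1) - 3 * a ^ 2 * (y2 * y2 * y1) := by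
    rw [he2, hu1d, hu2d]
    linear_combination (p * (x1 * y2 ^ 2 + 2 * x2 * y1 * y2)) * hC + 3 * y2 ^ 2 * y1 * hD
  by_cases h0 : e0 = 0
  · left
    rw [h0, mul_zero] at f0
    exact root_case hX0 ha hb hy1.ne' f0.symm
  by_cases h3 : e3 = 0
  · left
    rw [h3, mul_zero] at f3
    refine root_case hX0 ha hb ?_ f3.symm
    rintro hy
    rw [hy] at f3
    have hu0 : u2 = 0 := by
      have : u2 ^ 3 = 0 := by linear_combination -f3
      exact pow_eq_zero_iff (by norm_num) |>.mp this
    rw [hu2d, hy] at hu0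
    have hx2 : x2 = 0 := by
      have : (p : ℤ) * x2 = 0 := by linear_combination hu0
      rcases mul_eq_zero.mp this with h | h
      · exact absurd (by exact_mod_cast h) hp.ne_zero
      · exact h
    rw [hx2, hy] at hdet
    norm_num at hdet
  right
  have hc : |((a : ℝ) ^ 2)| ≤ X ^ 6 := by
    rw [abs_pow]
    calc |(a : ℝ)| ^ 2 ≤ (X ^ 3) ^ 2 := by gcongr
      _ = _ := by ring
  set N2 : ℝ := 2 * p / N with hN2
  have hp2 : (0 : ℝ) < (p : ℝ) ^ 2 := by positivity
  have hNN : N * N2 = 2 * p := by rw [hN2]; field_simp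
  have hN20 : 0 < N2 := by positivity
  have b0 : (p : ℝ) ^ 2 * |(e0 : ℝ)| ≤ 6 * (X ^ 3 * (N * N * N)) := by
    have f : (p : ℝ) ^ 2 * e0 = u1 ^ 3 - 4 * b * u1 * y1 ^ 2 - a ^ 2 * y1 ^ 3 := by exact_mod_cast f0
    have t := tri_bound hX0 hb hc hu1 hu1 hu1 hk1 hk1 hk1
    rw [← abs_of_pos hp2, ← abs_mul, f]
    have e : 3 * ((u1 : ℝ) * u1 * u1) - 4 * b * (u1 * y1 * y1 + y1 * u1 * y1 + y1 * y1 * u1)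
      - 3 * a ^ 2 * (y1 * y1 * y1) = 3 * (u1 ^ 3 - 4 * b * u1 * y1 ^ 2 - a ^ 2 * y1 ^ 3) := by ring
    rw [e, abs_mul, abs_of_pos (by norm_num : (0 : ℝ) < 3)] at t
    linarith
  have b3 : (p : ℝ) ^ 2 * |(e3 : ℝ)| ≤ 6 * (X ^ 3 * (N2 * N2 * N2)) := by
    have f : (p : ℝ) ^ 2 * e3 = u2 ^ 3 - 4 * b * u2 * y2 ^ 2 - a ^ 2 * y2 ^ 3 := by exact_mod_cast f3
    have t := tri_bound hX0 hb hc hu2 hu2 hu2 hk2 hk2 hk2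
    rw [← abs_of_pos hp2, ← abs_mul, f]
    have e : 3 * ((u2 : ℝ) * u2 * u2) - 4 * b * (u2 * y2 * y2 + y2 * u2 * y2 + y2 * y2 * u2)
      - 3 * a ^ 2 * (y2 * y2 * y2) = 3 * (u2 ^ 3 - 4 * b * u2 * y2 ^ 2 - a ^ 2 * y2 ^ 3) := by ring
    rw [e, abs_mul, abs_of_pos (by norm_num : (0 : ℝ) < 3)] at t
    linarith
  have b1 : (p : ℝ) ^ 2 * |(e1 : ℝ)| ≤ 18 * (X ^ 3 * (N * N * N2)) := by
    have f : (p : ℝ) ^ 2 * e1 = 3 * (u1 * u1 * u2) - 4 * b * (u1 * y1 * y2 + y1 * u1 * y2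
      + y1 * y1 * u2) - 3 * a ^ 2 * (y1 * y1 * y2) := by exact_mod_cast f1
    rw [← abs_of_pos hp2, ← abs_mul, f]
    exact tri_bound hX0 hb hc hu1 hu1 hu2 hk1 hk1 hk2
  have b2 : (p : ℝ) ^ 2 * |(e2 : ℝ)| ≤ 18 * (X ^ 3 * (N2 * N2 * N)) := by
    have f : (p : ℝ) ^ 2 * e2 = 3 * (u2 * u2 * u1) - 4 * b * (u2 * y2 * y1 + y2 * u2 * y1
      + y2 * y2 * u1) - 3 * a ^ 2 * (y2 * y2 * y1) := by exact_mod_cast f2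
    rw [← abs_of_pos hp2, ← abs_mul, f]
    exact tri_bound hX0 hb hc hu2 hu2 hu1 hk2 hk2 hk1
  -- product bounds
  have b03 : |(e0 : ℝ)| * |(e3 : ℝ)| * p ≤ 288 * X ^ 6 := by
    have := mul_le_mul b0 b3 (by positivity) (by positivity)
    have e : 6 * (X ^ 3 * (N * N * N)) * (6 * (X ^ 3 * (N2 * N2 * N2))) =
        (p : ℝ) ^ 3 * (288 * X ^ 6) := by
      calc _ = 36 * X ^ 6 * (N * N2) ^ 3 := by ring
        _ = _ := by rw [hNN]; ring
    rw [e] at this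
    refine le_of_mul_le_mul_left (a := (p : ℝ) ^ 3) ?_ (by positivity)
    calc _ = (p : ℝ) ^ 2 * |(e0 : ℝ)| * ((p : ℝ) ^ 2 * |(e3 : ℝ)|) := by ring
      _ ≤ _ := this
  have b12 : |(e1 : ℝ)| * |(e2 : ℝ)| * p ≤ 2592 * X ^ 6 := by
    have := mul_le_mul b1 b2 (by positivity) (by positivity)
    have e : 18 * (X ^ 3 * (N * N * N2)) * (18 * (X ^ 3 * (N2 * N2 * N))) =
        (p : ℝ) ^ 3 * (2592 * X ^ 6) := by
      calc _ = 324 * X ^ 6 * (N * N2) ^ 3 := by ring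
        _ = _ := by rw [hNN]; ring
    rw [e] at this
    refine le_of_mul_le_mul_left (a := (p : ℝ) ^ 3) ?_ (by positivity)
    calc _ = (p : ℝ) ^ 2 * |(e1 : ℝ)| * ((p : ℝ) ^ 2 * |(e2 : ℝ)|) := by ring
      _ ≤ _ := this
  have b12' : |(e1 : ℝ)| * |(e2 : ℝ)| ≤ 2592 * R := by
    refine le_of_mul_le_mul_right (b12.trans ?_) hp0
    linarith
  have b03' : |(e0 : ℝ)| * |(e3 : ℝ)| ≤ 288 * R := by
    refine le_of_mul_le_mul_right (b03.trans ?_) hp0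
    linarith
  have b2' : |(e2 : ℝ)| ≤ 72 * X ^ 2 := by
    refine le_of_mul_le_mul_left (a := (p : ℝ) ^ 2 * N) ?_ (by positivity)
    calc (p : ℝ) ^ 2 * N * |(e2 : ℝ)| = N * ((p : ℝ) ^ 2 * |(e2 : ℝ)|) := by ring
      _ ≤ N * (18 * (X ^ 3 * (N2 * N2 * N))) := by gcongr
      _ = 18 * X ^ 3 * (N * N2) ^ 2 := by ring
      _ = 72 * X ^ 2 * p ^ 2 * X := by rw [hNN]; ring
      _ ≤ 72 * X ^ 2 * p ^ 2 * N := by gcongr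
      _ = _ := by ring
  have b1' : |(e1 : ℝ)| ≤ 72 * X ^ 2 := by
    refine le_of_mul_le_mul_left (a := (p : ℝ) ^ 2 * N) ?_ (by positivity)
    calc (p : ℝ) ^ 2 * N * |(e1 : ℝ)| = N * ((p : ℝ) ^ 2 * |(e1 : ℝ)|) := by ring
      _ ≤ N * (18 * (X ^ 3 * (N * N * N2))) := by gcongr
      _ = 18 * X ^ 3 * N ^ 2 * (N * N2) := by ring
      _ ≤ 18 * X ^ 3 * p * (N * N2) := by gcongr
      _ = 36 * X ^ 2 * p ^ 2 * X := by rw [hNN]; ring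
      _ ≤ 72 * X ^ 2 * p ^ 2 * N := by gcongr; norm_num
      _ = _ := by ring
  have byy : |(y1 : ℝ)| * |(y2 : ℝ)| * X ^ 2 ≤ 2 * p := by
    have := mul_le_mul hk1 hk2 (by positivity) (by positivity)
    rw [hNN] at this
    linarith
  have P1 : max 1 |(e1 : ℝ)| * max 1 |(e2 : ℝ)| ≤ 2592 * R := by
    have hX2 : 1 ≤ X ^ 2 := one_le_pow₀ (by linarith)
    by_cases z1 : e1 = 0
    · rw [z1]
      simp only [Int.cast_zero, abs_zero, zero_le_one, sup_of_le_left, one_mul]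
      exact max_le (by linarith) (by linarith)
    by_cases z2 : e2 = 0
    · rw [z2]
      simp only [Int.cast_zero, abs_zero, zero_le_one, sup_of_le_left, mul_one]
      exact max_le (by linarith) (by linarith)
    rw [max_abs_int z1, max_abs_int z2]
    exact b12'
  have P2 : max 1 |(e0 : ℝ)| * max 1 |(e3 : ℝ)| * (max 1 |(y1 : ℝ)| * max 1 |(y2 : ℝ)|)
      ≤ 576 * X ^ 4 := by
    rw [max_abs_int h0, max_abs_int h3, max_abs_int hy1.ne']
    by_cases z2 : y2 = 0
    · rw [z2] at hdet ⊢
      have hy11 : y1 = 1 := by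
        have : y1 ∣ 1 := ⟨-x2, by linear_combination -hdet⟩
        exact Int.eq_one_of_dvd_one hy1.le this
      rw [hy11]
      simp only [Int.cast_zero, abs_zero, zero_le_one, sup_of_le_left, mul_one, Int.cast_one, abs_one]
      linarith
    · rw [max_abs_int z2]
      have := mul_le_mul b03 byy (by positivity) (by positivity)
      refine le_of_mul_le_mul_left (a := (p : ℝ) * X ^ 2) ?_ (by positivity)
      calc _ = |(e0 : ℝ)| * |(e3 : ℝ)| * p * (|(y1 : ℝ)| * |(y2 : ℝ)| * X ^ 2) := by ring
        _ ≤ _ := this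
        _ = _ := by ring
  have g1 : Hf ![e0, e1, e2, e3, y1, y2] = (9 * s ^ 2 - 3 * p * C) * (x1 * y2 - x2 * y1) ^ 4 := by
    show (e1 ^ 2 - 3 * e0 * e2) * y2 ^ 2 - (e1 * e2 - 9 * e0 * e3) * y2 * y1 +
      (e2 ^ 2 - 3 * e1 * e3) * y1 ^ 2 = _
    rw [he0, he1, he2, he3]; ring
  have g2 : Pf ![e0, e1, e2, e3, y1, y2] = p * (x1 * y2 - x2 * y1) ^ 3 := by
    show e0 * y2 ^ 3 - e1 * y2 ^ 2 * y1 + e2 * y2 * y1 ^ 2 - e3 * y1 ^ 3 = _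
    rw [he0, he1, he2, he3]; ring
  have g3 : Df ![e0, e1, e2, e3, y1, y2] = ((3 * s) ^ 2 * C ^ 2 - 4 * p * C ^ 3
      - 4 * (3 * s) ^ 3 * D - 27 * p ^ 2 * D ^ 2 + 18 * p * (3 * s) * C * D)
        * (x1 * y2 - x2 * y1) ^ 6 := by
    show e1 ^ 2 * e2 ^ 2 - 4 * e0 * e2 ^ 3 - 4 * e1 ^ 3 * e3 - 27 * e0 ^ 2 * e3 ^ 2 +
      18 * e0 * e1 * e2 * e3 = _
    rw [he0, he1, he2, he3]; ring
  refine ⟨![e0, e1, e2, e3, y1, y2], ?_, ?_, ?_⟩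
  · rw [Fin.prod_univ_six]
    show max 1 |(e0 : ℝ)| * max 1 |(e1 : ℝ)| * max 1 |(e2 : ℝ)| * max 1 |(e3 : ℝ)| *
      max 1 |(y1 : ℝ)| * max 1 |(y2 : ℝ)| ≤ _
    calc _ = (max 1 |(e0 : ℝ)| * max 1 |(e3 : ℝ)| * (max 1 |(y1 : ℝ)| * max 1 |(y2 : ℝ)|)) *
        (max 1 |(e1 : ℝ)| * max 1 |(e2 : ℝ)|) := by ring
      _ ≤ _ := mul_le_mul P2 P1 (by positivity) (by positivity)
  · rw [g1, hdet]; linear_combination (-3) * hC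
  · rw [g2, g3, hdet]
    have hdisc : ((3 * s) ^ 2 * C ^ 2 - 4 * p * C ^ 3 - 4 * (3 * s) ^ 3 * D - 27 * p ^ 2 * D ^ 2
        + 18 * p * (3 * s) * C * D) * (p : ℤ) ^ 2 = (3 * s) ^ 2 * (p * C) ^ 2 - 4 * (p * C) ^ 3
        - 4 * (3 * s) ^ 3 * (p ^ 2 * D) - 27 * (p ^ 2 * D) ^ 2
        + 18 * (3 * s) * (p * C) * (p ^ 2 * D) := by ring
    simp only [one_pow, mul_one]
    rw [hdisc, hC, hD]; ring

lemma box_bounds {X : ℝ} (hX : 0 < X) {t : ℤ × ℤ} (ht : t ∈ Box X) :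
    |(t.1 : ℝ)| ≤ X ^ 3 ∧ |(t.2 : ℝ)| ≤ X ^ 4 := by
  rw [Box, Finset.mem_product, Finset.mem_Icc, Finset.mem_Icc] at ht
  obtain ⟨⟨h1, h2⟩, h3, h4⟩ := ht
  have f3 : (⌊X ^ 3⌋₊ : ℝ) ≤ X ^ 3 := Nat.floor_le (by positivity)
  have f4 : (⌊X ^ 4⌋₊ : ℝ) ≤ X ^ 4 := Nat.floor_le (by positivity)
  have h1' : -(⌊X ^ 3⌋₊ : ℝ) ≤ t.1 := by exact_mod_cast h1
  have h2' : (t.1 : ℝ) ≤ ⌊X ^ 3⌋₊ := by exact_mod_cast h2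
  have h3' : -(⌊X ^ 4⌋₊ : ℝ) ≤ t.2 := by exact_mod_cast h3
  have h4' : (t.2 : ℝ) ≤ ⌊X ^ 4⌋₊ := by exact_mod_cast h4
  exact ⟨abs_le.mpr ⟨by linarith, by linarith⟩, abs_le.mpr ⟨by linarith, by linarith⟩⟩

lemma eq_of_sq {a c : ℤ} (h : a ^ 2 = c ^ 2) (hs : decide (0 ≤ a) = decide (0 ≤ c)) : a = c := by
  have hs' : 0 ≤ a ↔ 0 ≤ c := by simpa using hs
  rcases sq_eq_sq_iff_eq_or_eq_neg.mp h with h | h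
  · exact h
  · omega

lemma log_six (δ : ℝ) (hδ : 0 < δ) : ∃ C : ℝ, 0 < C ∧ ∀ X : ℝ, 2 ≤ X →
    (1492992 * X ^ (13 / 2 : ℝ)) * (3 + 2 * Real.log (1492992 * X ^ (13 / 2 : ℝ))) ^ 6
      ≤ C * (X ^ δ * X ^ (13 / 2 : ℝ)) := by
  set η := δ / 39 with hη
  have hη0 : 0 < η := by positivity
  refine ⟨1492992 * ((3 + 2 / η) * 1492992 ^ η) ^ 6, by positivity, fun X hX => ?_⟩
  have hX0 : 0 < X := by linarith
  have hX1 : 1 ≤ X ^ (13 / 2 : ℝ) := Real.one_le_rpow (by linarith) (by norm_num)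
  set Z := 1492992 * X ^ (13 / 2 : ℝ) with hZ
  have hZ1 : 1 ≤ Z := by linarith
  have h1 : 3 + 2 * Real.log Z ≤ (3 + 2 / η) * Z ^ η := by
    have g1 := Real.log_le_rpow_div (by linarith : (0 : ℝ) ≤ Z) hη0
    have g2 : 1 ≤ Z ^ η := Real.one_le_rpow hZ1 hη0.le
    have : 2 * (Z ^ η / η) = 2 / η * Z ^ η := by ring
    linarith
  have h2 : Z ^ η = 1492992 ^ η * X ^ (13 / 2 * η) := by
    rw [hZ, Real.mul_rpow (by norm_num) (by positivity), ← Real.rpow_mul hX0.le]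
  have h3 : (X ^ (13 / 2 * η)) ^ 6 = X ^ δ := by
    rw [← Real.rpow_natCast, ← Real.rpow_mul hX0.le]
    congr 1; rw [hη]; push_cast; ring
  have hl : 0 ≤ Real.log Z := Real.log_nonneg hZ1
  calc Z * (3 + 2 * Real.log Z) ^ 6 ≤ Z * ((3 + 2 / η) * Z ^ η) ^ 6 := by gcongr
    _ = 1492992 * ((3 + 2 / η) * 1492992 ^ η) ^ 6 *
        ((X ^ (13 / 2 * η)) ^ 6 * X ^ (13 / 2 : ℝ)) := by rw [h2, hZ]; ring
    _ = _ := by rw [h3]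

lemma large_count (δ : ℝ) (hδ : 0 < δ) : ∃ C : ℝ, 0 < C ∧ ∀ X : ℝ, 2 ≤ X →
    ∀ T : Finset (ℤ × ℤ), T ⊆ Box X →
    (∀ t ∈ T, ∃ p : ℕ, p.Prime ∧ X ^ (7 / 2 : ℝ) ≤ p ∧ Wk p t.1 t.2) →
    (T.card : ℝ) ≤ C * (X ^ δ * X ^ (13 / 2 : ℝ)) := by
  classical
  obtain ⟨C, hC, hC'⟩ := log_six δ hδ
  refine ⟨42 + 2 * C, by positivity, ?_⟩
  intro X hX T hT h
  have hX0 : 0 < X := by linarith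
  have hX1 : 1 ≤ X := by linarith
  set R : ℝ := X ^ (5 / 2 : ℝ) with hR
  have hR1 : X ^ 2 ≤ R := by
    rw [hR, ← Real.rpow_natCast]
    exact Real.rpow_le_rpow_of_exponent_le hX1 (by norm_num)
  have hR2 : R ≤ X ^ 4 := by
    rw [hR, ← Real.rpow_natCast X 4]
    exact Real.rpow_le_rpow_of_exponent_le hX1 (by norm_num)
  have hZ : (576 * X ^ 4) * (2592 * R) = 1492992 * X ^ (13 / 2 : ℝ) := by
    have : X ^ 4 * R = X ^ (13 / 2 : ℝ) := by
      rw [hR, ← Real.rpow_natCast X 4, ← Real.rpow_add hX0]; norm_num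
    rw [← this]; ring
  have hkey : ∀ t ∈ T, (∃ w : ℤ, |(w : ℝ)| ≤ 3 * X ^ 2 ∧ w ^ 3 - 4 * t.2 * w - t.1 ^ 2 = 0) ∨
    ∃ e : Fin 6 → ℤ, ∏ i, max 1 |(e i : ℝ)| ≤ 1492992 * X ^ (13 / 2 : ℝ) ∧
      Hf e = 12 * t.2 ∧ Df e * Pf e ^ 2 = 256 * t.2 ^ 3 - 27 * t.1 ^ 4 := by
    intro t ht
    obtain ⟨p, hp, hpX, hw⟩ := h t ht
    obtain ⟨h1, h2⟩ := box_bounds hX0 (hT ht)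
    rw [← hZ]
    refine key hX hp hR1 hR2 ?_ h1 h2 hw
    calc X ^ 6 = R * X ^ (7 / 2 : ℝ) := by
          rw [hR, ← Real.rpow_natCast X 6, ← Real.rpow_add hX0]; norm_num
      _ ≤ R * p := by gcongr
  set T1 := T.filter (fun t => ∃ w : ℤ, |(w : ℝ)| ≤ 3 * X ^ 2 ∧
    w ^ 3 - 4 * t.2 * w - t.1 ^ 2 = 0) with hT1
  set T2 := T.filter (fun t => ∃ e : Fin 6 → ℤ,
    ∏ i, max 1 |(e i : ℝ)| ≤ 1492992 * X ^ (13 / 2 : ℝ) ∧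
      Hf e = 12 * t.2 ∧ Df e * Pf e ^ 2 = 256 * t.2 ^ 3 - 27 * t.1 ^ 4) with hT2
  have hsub : T ⊆ T1 ∪ T2 := by
    intro t ht
    rw [Finset.mem_union, hT1, hT2, Finset.mem_filter, Finset.mem_filter]
    rcases hkey t ht with h | h
    · exact Or.inl ⟨ht, h⟩
    · exact Or.inr ⟨ht, h⟩
  have hc : (T.card : ℝ) ≤ T1.card + T2.card := by
    exact_mod_cast (Finset.card_le_card hsub).trans (Finset.card_union_le _ _)
  have hc1 : (T1.card : ℝ) ≤ 42 * X ^ 6 := by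
    have hex : ∀ t : ℤ × ℤ, ∃ w : ℤ, t ∈ T1 → |(w : ℝ)| ≤ 3 * X ^ 2 ∧
        w ^ 3 - 4 * t.2 * w - t.1 ^ 2 = 0 := by
      intro t
      by_cases ht : t ∈ T1
      · obtain ⟨w, hw⟩ := (Finset.mem_filter.mp ht).2
        exact ⟨w, fun _ => hw⟩
      · exact ⟨0, fun h => absurd h ht⟩
    choose w hw using hex
    have hle : T1.card ≤ (Finset.Icc (-(⌊3 * X ^ 2⌋₊ : ℤ)) ⌊3 * X ^ 2⌋₊ ×ˢ
        (Finset.Icc (-(⌊X ^ 4⌋₊ : ℤ)) ⌊X ^ 4⌋₊ ×ˢ (Finset.univ : Finset Bool))).card := by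
      apply Finset.card_le_card_of_injOn (fun t => (w t, t.2, decide (0 ≤ t.1)))
      · intro t ht
        have hb := hT (Finset.mem_filter.mp ht).1
        rw [Box, Finset.mem_product] at hb
        rw [Finset.mem_coe, Finset.mem_product, Finset.mem_product]
        refine ⟨?_, hb.2, Finset.mem_univ _⟩
        have : (w t).natAbs ≤ ⌊3 * X ^ 2⌋₊ := by
          apply Nat.le_floor
          rw [Nat.cast_natAbs]
          push_cast
          exact (hw t ht).1
        rw [Finset.mem_Icc]
        show _ ≤ w t ∧ w t ≤ _
        omega
      · intro t ht t' ht' he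
        simp only [Prod.mk.injEq] at he
        obtain ⟨e1, e2, e3⟩ := he
        have k1 := (hw t ht).2
        have k2 := (hw t' ht').2
        rw [e1, e2] at k1
        exact Prod.ext (eq_of_sq (by linarith) e3) e2
    have hcard : (Finset.Icc (-(⌊3 * X ^ 2⌋₊ : ℤ)) ⌊3 * X ^ 2⌋₊ ×ˢ
        (Finset.Icc (-(⌊X ^ 4⌋₊ : ℤ)) ⌊X ^ 4⌋₊ ×ˢ (Finset.univ : Finset Bool))).card =
        (2 * ⌊3 * X ^ 2⌋₊ + 1) * ((2 * ⌊X ^ 4⌋₊ + 1) * 2) := by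
      rw [Finset.card_product, Finset.card_product, Int.card_Icc, Int.card_Icc, Finset.card_univ,
        Fintype.card_bool]
      congr 1
      · omega
      · congr 1; omega
    rw [hcard] at hle
    have hle' : (T1.card : ℝ) ≤ (2 * ⌊3 * X ^ 2⌋₊ + 1) * ((2 * ⌊X ^ 4⌋₊ + 1) * 2) := by
      exact_mod_cast hle
    have f3 : (⌊3 * X ^ 2⌋₊ : ℝ) ≤ 3 * X ^ 2 := Nat.floor_le (by positivity)
    have f4 : (⌊X ^ 4⌋₊ : ℝ) ≤ X ^ 4 := Nat.floor_le (by positivity)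
    have g3 : 1 ≤ X ^ 2 := one_le_pow₀ hX1
    have g4 : 1 ≤ X ^ 4 := one_le_pow₀ hX1
    calc _ ≤ _ := hle'
      _ ≤ (7 * X ^ 2) * ((3 * X ^ 4) * 2) := by
          apply mul_le_mul (by linarith) (by linarith) (by positivity) (by positivity)
      _ = _ := by ring
  have hc2 : (T2.card : ℝ) ≤ 2 * (C * (X ^ δ * X ^ (13 / 2 : ℝ))) := by
    have hex : ∀ t : ℤ × ℤ, ∃ e : Fin 6 → ℤ, t ∈ T2 →
        ∏ i, max 1 |(e i : ℝ)| ≤ 1492992 * X ^ (13 / 2 : ℝ) ∧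
        Hf e = 12 * t.2 ∧ Df e * Pf e ^ 2 = 256 * t.2 ^ 3 - 27 * t.1 ^ 4 := by
      intro t
      by_cases ht : t ∈ T2
      · obtain ⟨w, hw⟩ := (Finset.mem_filter.mp ht).2
        exact ⟨w, fun _ => hw⟩
      · exact ⟨0, fun h => absurd h ht⟩
    choose e he using hex
    have hle : T2.card ≤ (T2.image e ×ˢ (Finset.univ : Finset Bool)).card := by
      apply Finset.card_le_card_of_injOn (fun t => (e t, decide (0 ≤ t.1)))
      · intro t ht
        rw [Finset.mem_coe, Finset.mem_product]
        exact ⟨Finset.mem_image_of_mem e ht, Finset.mem_univ _⟩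
      · intro t ht t' ht' hee
        simp only [Prod.mk.injEq] at hee
        obtain ⟨e1, e3⟩ := hee
        have k1 := (he t ht).2
        have k2 := (he t' ht').2
        rw [e1] at k1
        have e2 : t.2 = t'.2 := by linarith [k1.1, k2.1]
        have k3 := k1.2.symm.trans k2.2
        rw [e2] at k3
        have k4 : (t.1 ^ 2) ^ 2 = (t'.1 ^ 2) ^ 2 := by linarith
        have k5 : t.1 ^ 2 = t'.1 ^ 2 :=
          (sq_eq_sq₀ (sq_nonneg _) (sq_nonneg _)).mp k4
        exact Prod.ext (eq_of_sq k5 e3) e2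
    rw [Finset.card_product, Finset.card_univ, Fintype.card_bool] at hle
    have hle' : (T2.card : ℝ) ≤ (T2.image e).card * 2 := by exact_mod_cast hle
    have hX13 : 1 ≤ X ^ (13 / 2 : ℝ) := Real.one_le_rpow hX1 (by norm_num)
    have ht := tuple_count (1492992 * X ^ (13 / 2 : ℝ)) (by linarith) (T2.image e) (by
      intro v hv
      obtain ⟨t, ht, rfl⟩ := Finset.mem_image.mp hv
      exact (he t ht).1)
    have := hC' X hX
    linarith
  have hX6 : X ^ 6 ≤ X ^ δ * X ^ (13 / 2 : ℝ) := by
    rw [← Real.rpow_natCast, ← Real.rpow_add hX0]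
    apply Real.rpow_le_rpow_of_exponent_le hX1
    push_cast
    linarith
  linarith

lemma exists_divisor {m : ℕ} (hm0 : m ≠ 0) {Z Y : ℝ} (hZ0 : 0 < Z) (hY : 1 ≤ Y)
    (hZY : Z * Z ≤ Y) (hm : Y < m) :
    (∃ d : ℕ, d ∣ m ∧ Z ≤ d ∧ (d : ℝ) ≤ Y) ∨ (∃ p : ℕ, p.Prime ∧ p ∣ m ∧ Y ≤ p) := by
  classical
  set S := m.divisors.filter (fun d : ℕ => (d : ℝ) ≤ Y) with hS
  have hne : S.Nonempty := ⟨1, by simp [hS, hm0, hY]⟩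
  obtain ⟨d, hd, hmax⟩ := S.exists_max_image id hne
  rw [hS, Finset.mem_filter, Nat.mem_divisors] at hd
  obtain ⟨⟨hdm, -⟩, hdY⟩ := hd
  by_cases hdZ : Z ≤ d
  · exact Or.inl ⟨d, hdm, hdZ, hdY⟩
  right
  push Not at hdZ
  obtain ⟨k, hk⟩ := hdm
  have hk1 : k ≠ 1 := by
    rintro rfl
    rw [mul_one] at hk
    rw [hk] at hm
    linarith
  obtain ⟨q, hq, hqk⟩ := Nat.exists_prime_and_dvd hk1
  have hd0 : 0 < d := Nat.pos_of_ne_zero (by rintro rfl; simp at hk; exact hm0 hk)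
  have hdqm : d * q ∣ m := by rw [hk]; exact Nat.mul_dvd_mul_left d hqk
  have hqm : q ∣ m := (Dvd.intro_left d rfl).trans hdqm
  refine ⟨q, hq, hqm, ?_⟩
  by_contra hqY
  push Not at hqY
  have h1 : q ≤ d := hmax q (by
    rw [hS, Finset.mem_filter, Nat.mem_divisors]; exact ⟨⟨hqm, hm0⟩, hqY.le⟩)
  have h2 : Y < d * q := by
    by_contra hcon
    push Not at hcon
    have h3 : d * q ≤ d := hmax (d * q) (by
      rw [hS, Finset.mem_filter, Nat.mem_divisors]
      exact ⟨⟨hdqm, hm0⟩, by push_cast; exact hcon⟩)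
    have := hq.two_le
    nlinarith
  have h1' : (q : ℝ) ≤ d := by exact_mod_cast h1
  have h4 : (d : ℝ) * q ≤ Z * Z := by
    apply mul_le_mul hdZ.le (h1'.trans hdZ.le) (by positivity) hZ0.le
  linarith

open scoped BigOperators

/-- **Theorem 1.4(b)**: the number of pairs (a,b) with H(a,b) < X lying in
𝒲_m^{(2)} (weak divisibility) for some squarefree m > M is
O_ε(X^{6.992+ε} + X^{7+ε}/M). -/
theorem stmt_4 :
    ∀ ε : ℝ, 0 < ε → ∃ Cε : ℝ, 0 < Cε ∧ ∀ M X : ℝ, 0 < M → 2 ≤ X →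
      ({p : ℤ × ℤ | (|p.1| : ℝ) < X ^ 3 ∧ (|p.2| : ℝ) < X ^ 4 ∧
          ∃ m : ℕ, Squarefree m ∧ M < (m : ℝ) ∧
            ∀ q : ℕ, q.Prime → q ∣ m →
              ((q : ℤ) ^ 2 ∣ (256 * p.2 ^ 3 - 27 * p.1 ^ 4) ∧
                ∃ a' b' : ℤ, a' ≡ p.1 [ZMOD q] ∧ b' ≡ p.2 [ZMOD q] ∧
                  ¬ ((q : ℤ) ^ 2 ∣ (256 * b' ^ 3 - 27 * a' ^ 4)))}.ncard : ℝ)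
        ≤ Cε * (X ^ ((6.992 : ℝ) + ε) + X ^ ((7 : ℝ) + ε) / M) := by
  classical
  intro ε hε
  obtain ⟨C1, hC1, h1⟩ := small_count ε hε
  obtain ⟨C2, hC2, h2⟩ := large_count ε hε
  refine ⟨3 * C1 + C2, by positivity, ?_⟩
  intro M X hM hX
  have hX0 : 0 < X := by linarith
  have hX1 : 1 ≤ X := by linarith
  set S : Set (ℤ × ℤ) := {p : ℤ × ℤ | (|p.1| : ℝ) < X ^ 3 ∧ (|p.2| : ℝ) < X ^ 4 ∧
          ∃ m : ℕ, Squarefree m ∧ M < (m : ℝ) ∧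
            ∀ q : ℕ, q.Prime → q ∣ m →
              ((q : ℤ) ^ 2 ∣ (256 * p.2 ^ 3 - 27 * p.1 ^ 4) ∧
                ∃ a' b' : ℤ, a' ≡ p.1 [ZMOD q] ∧ b' ≡ p.2 [ZMOD q] ∧
                  ¬ ((q : ℤ) ^ 2 ∣ (256 * b' ^ 3 - 27 * a' ^ 4)))} with hS
  have hSB : S ⊆ (Box X : Set (ℤ × ℤ)) := by
    rintro ⟨a, b⟩ ⟨ha, hb, -⟩
    have k1 : a.natAbs ≤ ⌊X ^ 3⌋₊ := by
      apply Nat.le_floor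
      rw [Nat.cast_natAbs]
      push_cast
      exact ha.le
    have k2 : b.natAbs ≤ ⌊X ^ 4⌋₊ := by
      apply Nat.le_floor
      rw [Nat.cast_natAbs]
      push_cast
      exact hb.le
    rw [Finset.mem_coe, Box, Finset.mem_product, Finset.mem_Icc, Finset.mem_Icc]
    show (_ ≤ a ∧ a ≤ _) ∧ (_ ≤ b ∧ b ≤ _)
    omega
  set Y : ℝ := X ^ (7 / 2 : ℝ) with hY
  set Z : ℝ := X ^ (7 / 4 : ℝ) with hZ
  have hY1 : 1 ≤ Y := Real.one_le_rpow hX1 (by norm_num)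
  have hZ0 : 0 < Z := by positivity
  have hZY : Z * Z ≤ Y := by
    rw [hZ, hY, ← Real.rpow_add hX0]; norm_num
  set A : ℝ → Finset (ℤ × ℤ) := fun L => (Box X).filter (fun t => ∃ m : ℕ, Squarefree m ∧ L ≤ m ∧
    (m : ℝ) ≤ X ^ (7 / 2 : ℝ) ∧ ∀ q : ℕ, q.Prime → q ∣ m → Wk q t.1 t.2) with hA
  set D := (Box X).filter
    (fun t => ∃ p : ℕ, p.Prime ∧ X ^ (7 / 2 : ℝ) ≤ p ∧ Wk p t.1 t.2) with hD
  have hsub : S ⊆ ((A M ∪ A Z ∪ D : Finset (ℤ × ℤ)) : Set (ℤ × ℤ)) := by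
    intro t ht
    have hB := hSB ht
    obtain ⟨-, -, m, hm, hMm, hw⟩ := ht
    have hw' : ∀ q : ℕ, q.Prime → q ∣ m → Wk q t.1 t.2 := hw
    rw [Finset.mem_coe] at hB ⊢
    rw [Finset.mem_union, Finset.mem_union]
    rcases le_or_gt (m : ℝ) Y with hmY | hmY
    · left; left
      exact Finset.mem_filter.mpr ⟨hB, m, hm, hMm.le, hmY, hw'⟩
    · rcases exists_divisor hm.ne_zero hZ0 hY1 hZY hmY with ⟨d, k1, k2, k3⟩ | ⟨p, k1, k2, k3⟩
      · left; right
        exact Finset.mem_filter.mpr ⟨hB, d, hm.squarefree_of_dvd k1, k2, k3,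
          fun q hq hqd => hw' q hq (hqd.trans k1)⟩
      · right
        exact Finset.mem_filter.mpr ⟨hB, p, k1, k3, hw' p k1 k2⟩
  have hcard : (S.ncard : ℝ) ≤ (A M).card + (A Z).card + D.card := by
    have k := Set.ncard_le_ncard hsub (Finset.finite_toSet _)
    rw [Set.ncard_coe_finset] at k
    have k2 := Finset.card_union_le (A M ∪ A Z) D
    have k3 := Finset.card_union_le (A M) (A Z)
    have : S.ncard ≤ (A M).card + (A Z).card + D.card := by omega
    exact_mod_cast this
  have c1 := h1 X M hX hM (A M) (Finset.filter_subset _ _)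
    (fun t ht => (Finset.mem_filter.mp ht).2)
  have c2 := h1 X Z hX hZ0 (A Z) (Finset.filter_subset _ _)
    (fun t ht => (Finset.mem_filter.mp ht).2)
  have c3 := h2 X hX D (Finset.filter_subset _ _) (fun t ht => (Finset.mem_filter.mp ht).2)
  have p1 : X ^ ε * X ^ (13 / 2 : ℝ) ≤ X ^ ((6.992 : ℝ) + ε) := by
    rw [← Real.rpow_add hX0]
    apply Real.rpow_le_rpow_of_exponent_le hX1
    norm_num; linarith
  have p2 : X ^ ε * (X ^ (7 : ℝ) / Z) ≤ X ^ ((6.992 : ℝ) + ε) := by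
    rw [hZ, ← Real.rpow_sub hX0, ← Real.rpow_add hX0]
    apply Real.rpow_le_rpow_of_exponent_le hX1
    norm_num; linarith
  have p3 : X ^ ε * (X ^ (7 : ℝ) / M) = X ^ ((7 : ℝ) + ε) / M := by
    rw [Real.rpow_add hX0]; ring
  set E := X ^ ((6.992 : ℝ) + ε) with hE
  set F := X ^ ((7 : ℝ) + ε) / M with hF
  have hF0 : 0 ≤ F := by positivity
  have q1 : ((A M).card : ℝ) ≤ C1 * (F + E) := by
    refine c1.trans (mul_le_mul_of_nonneg_left ?_ hC1.le)
    rw [mul_add, p3]; linarith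
  have q2 : ((A Z).card : ℝ) ≤ C1 * (E + E) := by
    refine c2.trans (mul_le_mul_of_nonneg_left ?_ hC1.le)
    rw [mul_add]; linarith
  have q3 : (D.card : ℝ) ≤ C2 * E := c3.trans (mul_le_mul_of_nonneg_left p1 hC2.le)
  have r1 : 0 ≤ C1 * F := by positivity
  have r2 : 0 ≤ C2 * F := by positivity
  nlinarith
end
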